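/- Let n ≥ 2. There exists ε > 0 with the following property: if u₀ : S¹ → S^{n−1} and u, v are energy-class solutions of the half-harmonic gradient flow with initial datum u₀ satisfying ‖u(t,·)‖_{Ḣ^{1/2}} ≤ ε and ‖v(t,·)‖_{Ḣ^{1/2}} ≤ ε for a.e. t ≥ 0, then u = v almost everywhere on [0,∞)×S¹. -/

import Mathlib

open MeasureTheory Real Filter
open scoped BigOperators ENNReal Real Topology

noncomputable section

/-- Chord distance on `S¹ ≃ ℝ/2πℤ`: `|x-y| = 2|sin((x-y)/2)|`. -/
def cd (x y : ℝ) : ℝ := 2 * |Real.sin ((x - y) / 2)|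

/-- Fundamental domain for the circle `S¹ ≃ ℝ/2πℤ`. -/
def circ : Set ℝ := Set.Ioc (-π) π

/-- `k`-th Fourier coefficient of a `2π`-periodic function `ℝ → ℂ`. -/
def fc (f : ℝ → ℂ) (k : ℤ) : ℂ :=
  ((1 / (2 * π) : ℝ) : ℂ) * ∫ x in circ, f x * Complex.exp (-(Complex.I * (k : ℂ) * (x : ℂ)))

/-- Fourier coefficient of a real-valued function. -/
def fcR (f : ℝ → ℝ) (k : ℤ) : ℂ := fc (fun x => (f x : ℂ)) k

/-- `ℝⁿ` as a Euclidean space. -/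
abbrev E (n : ℕ) := EuclideanSpace ℝ (Fin n)

/-- Componentwise Fourier coefficients of a vector-valued map. -/
def fcV {n : ℕ} (u : ℝ → E n) (k : ℤ) (i : Fin n) : ℂ := fcR (fun x => u x i) k

/-- Squared homogeneous `Ḣ^{1/2}` seminorm: `∑_k |k| |û(k)|²` (valued in `[0,∞]`). -/
def hHalf {n : ℕ} (u : ℝ → E n) : ℝ≥0∞ :=
  ∑' k : ℤ, (k.natAbs : ℝ≥0∞) * ∑ i, (‖fcV u k i‖₊ : ℝ≥0∞) ^ 2

/-- Squared inhomogeneous `H^s` norm: `∑_k (1+k²)^s |û(k)|²` (valued in `[0,∞]`). -/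
def hSob {n : ℕ} (s : ℝ) (u : ℝ → E n) : ℝ≥0∞ :=
  ∑' k : ℤ, ENNReal.ofReal ((1 + (k : ℝ) ^ 2) ^ s) * ∑ i, (‖fcV u k i‖₊ : ℝ≥0∞) ^ 2

/-- Squared homogeneous `Ḣ^{1/2}` seminorm of a scalar function. -/
def hHalfR (f : ℝ → ℝ) : ℝ≥0∞ :=
  ∑' k : ℤ, (k.natAbs : ℝ≥0∞) * (‖fcR f k‖₊ : ℝ≥0∞) ^ 2

/-- Squared inhomogeneous `H^s` norm of a scalar function. -/
def hSobR (s : ℝ) (f : ℝ → ℝ) : ℝ≥0∞ :=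
  ∑' k : ℤ, ENNReal.ofReal ((1 + (k : ℝ) ^ 2) ^ s) * (‖fcR f k‖₊ : ℝ≥0∞) ^ 2

/-- `|d_{1/2}u|²(x) = ∫_{S¹} |u(x)-u(y)|²/|x-y|² dy`. -/
def gagl {n : ℕ} (u : ℝ → E n) (x : ℝ) : ℝ :=
  ∫ y in circ, (∑ i, (u x i - u y i) ^ 2) / cd x y ^ 2

/-- `∫_{S¹}∫_{S¹} d_{1/2}u(x,y)·d_{1/2}φ(x,y) dy dx/|x-y|`. -/
def pairing {n : ℕ} (u φ : ℝ → E n) : ℝ :=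
  ∫ x in circ, ∫ y in circ, (∑ i, (u x i - u y i) * (φ x i - φ y i)) / cd x y ^ 2

/-- The product measure on `(0,∞) × S¹`. -/
def STmeasure : Measure (ℝ × ℝ) :=
  (volume.restrict (Set.Ioi (0 : ℝ))).prod (volume.restrict circ)

/-- Smooth test functions on `(0,∞) × S¹`, compactly supported in time. -/
structure IsSTTest (n : ℕ) (φ : ℝ → ℝ → E n) : Prop where
  smooth : ContDiff ℝ (⊤ : ℕ∞) (fun p : ℝ × ℝ => φ p.1 p.2)
  periodic : ∀ t, Function.Periodic (φ t) (2 * π)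
  suppTime : ∃ a b : ℝ, 0 < a ∧ ∀ t, t ∉ Set.Icc a b → ∀ x, φ t x = 0

/-- Energy-class solution of the half-harmonic gradient flow, with explicit
weak time derivative `w`. -/
structure IsEnergySolAux (n : ℕ) (u₀ : ℝ → E n) (u w : ℝ → ℝ → E n) : Prop where
  meas : Measurable (Function.uncurry u)
  periodic : ∀ t, Function.Periodic (u t) (2 * π)
  sphere : ∀ᵐ p ∂STmeasure, ‖u p.1 p.2‖ = 1
  energyBdd : ∃ M : ℝ≥0∞, M < ⊤ ∧
    ∀ᵐ t ∂(volume.restrict (Set.Ioi (0 : ℝ))), hHalf (u t) ≤ M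
  wMeas : Measurable (Function.uncurry w)
  wL2 : (∫⁻ t in Set.Ioi (0 : ℝ), ∫⁻ x in circ, (‖w t x‖₊ : ℝ≥0∞) ^ 2) < ⊤
  weakDeriv : ∀ φ : ℝ → ℝ → E n, IsSTTest n φ →
    (∫ t in Set.Ioi (0 : ℝ), ∫ x in circ, ∑ i, u t x i * deriv (fun s => φ s x i) t)
      = - ∫ t in Set.Ioi (0 : ℝ), ∫ x in circ, ∑ i, w t x i * φ t x i
  flow : ∀ φ : ℝ → ℝ → E n, IsSTTest n φ →
    (∫ t in Set.Ioi (0 : ℝ), ∫ x in circ, ∑ i, w t x i * φ t x i)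
      + (∫ t in Set.Ioi (0 : ℝ), pairing (u t) (φ t))
      = ∫ t in Set.Ioi (0 : ℝ), ∫ x in circ, gagl (u t) x * ∑ i, u t x i * φ t x i
  init : Tendsto (fun t => ∫⁻ x in circ, (‖u t x - u₀ x‖₊ : ℝ≥0∞) ^ 2)
      (nhdsWithin 0 (Set.Ioi 0)) (nhds 0)

/-- Energy-class solution of the half-harmonic gradient flow. -/
def IsEnergySol (n : ℕ) (u₀ : ℝ → E n) (u : ℝ → ℝ → E n) : Prop :=
  ∃ w, IsEnergySolAux n u₀ u w

/-- Energy decay: `‖u(t,·)‖_{Ḣ^{1/2}} ≤ ‖u₀‖_{Ḣ^{1/2}}` for a.e. `t ≥ 0`. -/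
def EnergyDecay {n : ℕ} (u₀ : ℝ → E n) (u : ℝ → ℝ → E n) : Prop :=
  ∀ᵐ t ∂(volume.restrict (Set.Ioi (0 : ℝ))), hHalf (u t) ≤ hHalf u₀

/-- Fractional Laplacian `(-Δ)^s` of a `2π`-periodic function, via Fourier series. -/
def fracLapC (s : ℝ) (f : ℝ → ℂ) (x : ℝ) : ℂ :=
  ∑' k : ℤ, (((k.natAbs : ℝ) ^ s : ℝ) : ℂ) * fc f k * Complex.exp (Complex.I * (k : ℂ) * (x : ℂ))

/-- Fractional Laplacian of a real-valued function. -/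
def fracLapR (s : ℝ) (f : ℝ → ℝ) (x : ℝ) : ℝ := (fracLapC s (fun y => (f y : ℂ)) x).re

/-- Half-Laplacian of a vector-valued map. -/
def halfLap {n : ℕ} (u : ℝ → E n) (x : ℝ) : E n :=
  (EuclideanSpace.equiv (Fin n) ℝ).symm fun i => fracLapR 1 (fun y => u y i) x

/-- The integral `C(j,k) = ∫_{-π}^{π} (e^{ijh}-1)(e^{ikh}-1)/(4sin²(h/2)) dh`. -/
def Cjk (j k : ℤ) : ℂ :=
  ∫ h in circ, (Complex.exp (Complex.I * (j : ℂ) * (h : ℂ)) - 1)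
      * (Complex.exp (Complex.I * (k : ℂ) * (h : ℂ)) - 1)
      / ((4 * Real.sin (h / 2) ^ 2 : ℝ) : ℂ)

/-- A real trigonometric polynomial: the function equals a finite Fourier sum. -/
def IsTrigPoly (u : ℝ → ℝ) : Prop :=
  ∃ s : Finset ℤ, ∀ x : ℝ,
    (u x : ℂ) = ∑ k ∈ s, fcR u k * Complex.exp (Complex.I * (k : ℂ) * (x : ℂ))

/-- `d_{1/2}u · d_{1/2}v` as a (complex-valued) function on the circle. -/
def d12prod (u v : ℝ → ℝ) (x : ℝ) : ℂ :=
  ((∫ y in circ, (u x - u y) * (v x - v y) / cd x y ^ 2 : ℝ) : ℂ)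

/-- Stereographic projection of `S¹ ∖ {-i}`. -/
def stproj (θ : ℝ) : ℝ := Real.cos θ / (1 + Real.sin θ)

/-- Lebesgue measure on the fundamental domain of the circle. -/
abbrev muc : Measure ℝ := volume.restrict circ

/-- The character `x ↦ exp (i k x)`. -/
def ek (k : ℤ) (x : ℝ) : ℂ := Complex.exp (Complex.I * (k : ℂ) * (x : ℂ))

lemma muc_univ : muc Set.univ = ENNReal.ofReal (2 * π) := by
  simp only [muc, circ, Measure.restrict_apply_univ, Real.volume_Ioc]
  congr 1; ring

instance : IsFiniteMeasure muc := ⟨by rw [muc_univ]; exact ENNReal.ofReal_lt_top⟩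

lemma integral_muc {F : Type*} [NormedAddCommGroup F] [NormedSpace ℝ F] (f : ℝ → F) :
    ∫ x, f x ∂muc = ∫ x in (-π)..π, f x := by
  rw [intervalIntegral.integral_of_le (by linarith [pi_pos])]; rfl

lemma norm_ek (k : ℤ) (x : ℝ) : ‖ek k x‖ = 1 := by
  have : Complex.I * (k : ℂ) * (x : ℂ) = ((k * x : ℝ) : ℂ) * Complex.I := by push_cast; ring
  rw [ek, this, Complex.norm_exp_ofReal_mul_I]

lemma ek_zero (x : ℝ) : ek 0 x = 1 := by simp [ek]

lemma ek_add (k l : ℤ) (x : ℝ) : ek (k + l) x = ek k x * ek l x := by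
  rw [ek, ek, ek, ← Complex.exp_add]; congr 1; push_cast; ring

lemma ek_conj (k : ℤ) (x : ℝ) : (starRingEnd ℂ) (ek k x) = ek (-k) x := by
  rw [ek, ek, ← Complex.exp_conj]; congr 1; simp

lemma ek_add_right (k : ℤ) (x y : ℝ) : ek k (x + y) = ek k x * ek k y := by
  rw [ek, ek, ek, ← Complex.exp_add]; congr 1; push_cast; ring

lemma ek_neg_right (k : ℤ) (x : ℝ) : ek k (-x) = ek (-k) x := by
  rw [ek, ek]; congr 1; push_cast; ring

@[fun_prop]
lemma continuous_ek (k : ℤ) : Continuous (ek k) := by unfold ek; fun_prop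

lemma ek_eq (k : ℤ) (x : ℝ) :
    ek k x = (Real.cos (k * x) : ℂ) + (Real.sin (k * x) : ℂ) * Complex.I := by
  have : Complex.I * (k : ℂ) * (x : ℂ) = ((k * x : ℝ) : ℂ) * Complex.I := by push_cast; ring
  rw [ek, this, Complex.exp_mul_I, Complex.ofReal_cos, Complex.ofReal_sin]

lemma ek_periodic (k : ℤ) : Function.Periodic (ek k) (2 * π) := by
  intro x
  rw [ek_add_right]
  have : ek k (2 * π) = 1 := by
    rw [ek]
    have := Complex.exp_int_mul_two_pi_mul_I k
    convert this using 2; push_cast; ring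
  rw [this, mul_one]

lemma fc_eq (f : ℝ → ℂ) (k : ℤ) :
    fc f k = ((1 / (2 * π) : ℝ) : ℂ) * ∫ x, f x * ek (-k) x ∂muc := by
  unfold fc ek
  congr 2; ext x; congr 2; push_cast; ring

lemma integrable_mul_ek {f : ℝ → ℂ} {μ : Measure ℝ} (hf : Integrable f μ) (k : ℤ) :
    Integrable (fun x => f x * ek k x) μ :=
  hf.mul_bdd (c := 1) (continuous_ek k).aestronglyMeasurable
    (Eventually.of_forall fun x => (norm_ek k x).le)

lemma fc_congr {f g : ℝ → ℂ} (h : f =ᵐ[muc] g) (k : ℤ) : fc f k = fc g k := by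
  rw [fc_eq, fc_eq]; congr 1
  exact integral_congr_ae (h.mono fun x hx => by simp only [hx])

lemma fc_add {f g : ℝ → ℂ} (hf : Integrable f muc) (hg : Integrable g muc) (k : ℤ) :
    fc (fun x => f x + g x) k = fc f k + fc g k := by
  simp only [fc_eq, add_mul]
  rw [integral_add (integrable_mul_ek hf _) (integrable_mul_ek hg _), mul_add]

lemma fc_sub {f g : ℝ → ℂ} (hf : Integrable f muc) (hg : Integrable g muc) (k : ℤ) :
    fc (fun x => f x - g x) k = fc f k - fc g k := by
  simp only [fc_eq, sub_mul]
  rw [integral_sub (integrable_mul_ek hf _) (integrable_mul_ek hg _), mul_sub]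

lemma fc_const_mul (c : ℂ) (f : ℝ → ℂ) (k : ℤ) :
    fc (fun x => c * f x) k = c * fc f k := by
  simp only [fc_eq, mul_assoc]
  rw [integral_const_mul]; ring

lemma fc_sum {ι : Type*} (s : Finset ι) {f : ι → ℝ → ℂ} (hf : ∀ i ∈ s, Integrable (f i) muc)
    (k : ℤ) : fc (fun x => ∑ i ∈ s, f i x) k = ∑ i ∈ s, fc (f i) k := by
  simp only [fc_eq, Finset.sum_mul]
  rw [integral_finsetSum _ fun i hi => integrable_mul_ek (hf i hi) _, Finset.mul_sum]

lemma fc_mul_ek (f : ℝ → ℂ) (m k : ℤ) : fc (fun x => f x * ek m x) k = fc f (k - m) := by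
  simp only [fc_eq, mul_assoc, ← ek_add]
  congr 3; ext x; congr 2; ring

lemma fc_conj (f : ℝ → ℂ) (k : ℤ) :
    fc (fun x => (starRingEnd ℂ) (f x)) k = (starRingEnd ℂ) (fc f (-k)) := by
  simp only [fc_eq, map_mul, Complex.conj_ofReal]
  rw [← integral_conj]
  simp only [map_mul, ek_conj, neg_neg]

lemma integral_ek (k : ℤ) : ∫ x, ek k x ∂muc = if k = 0 then ((2 * π : ℝ) : ℂ) else 0 := by
  rw [integral_muc]
  split_ifs with h
  · subst h; simp [ek_zero]; ring
  · have hk : Complex.I * (k : ℂ) ≠ 0 := by simp [h]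
    have := integral_exp_mul_complex (a := -π) (b := π) hk
    simp only [ek]
    rw [this]
    have h2 := ek_periodic k (-π)
    rw [show -π + 2 * π = π by ring] at h2
    unfold ek at h2
    rw [h2]; simp

lemma fc_ek (m k : ℤ) : fc (ek m) k = if k = m then 1 else 0 := by
  rw [fc_eq]
  simp only [← ek_add]
  rw [integral_ek]
  by_cases h : k = m
  · subst h
    simp only [add_neg_cancel, if_true, ← Complex.ofReal_mul]
    rw [one_div_mul_cancel (by positivity)]; simp
  · rw [if_neg h, if_neg (by omega), mul_zero]

lemma fourierCoeffOn_eq_fc (f : ℝ → ℂ) (k : ℤ) :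
    fourierCoeffOn (show -π < π by linarith [pi_pos]) f k = fc f k := by
  rw [fourierCoeffOn_eq_integral, fc_eq, integral_muc, ← Complex.real_smul]
  congr 1
  · ring
  · refine intervalIntegral.integral_congr fun x _ => ?_
    rw [smul_eq_mul, mul_comm]
    congr 1
    rw [fourier_coe_apply, ek]
    congr 1
    have : (π : ℂ) ≠ 0 := by exact_mod_cast pi_ne_zero
    push_cast
    field_simp
    ring

lemma hasSum_fc_sq {f : ℝ → ℂ} (hf : MemLp f 2 muc) :
    HasSum (fun k => ‖fc f k‖ ^ 2) (1 / (2 * π) * ∫ x, ‖f x‖ ^ 2 ∂muc) := by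
  have := hasSum_sq_fourierCoeffOn (show -π < π by linarith [pi_pos]) hf
  simp only [fourierCoeffOn_eq_fc] at this
  convert this using 1
  rw [integral_muc, smul_eq_mul]; congr 1; ring

lemma MemLp.int1 {f : ℝ → ℂ} (hf : MemLp f 2 muc) : Integrable f muc :=
  hf.integrable (by norm_num)

lemma hasSum_fc_mul_conj {f g : ℝ → ℂ} (hf : MemLp f 2 muc) (hg : MemLp g 2 muc) :
    HasSum (fun k => fc f k * (starRingEnd ℂ) (fc g k))
      (((1 / (2 * π) : ℝ) : ℂ) * ∫ x, f x * (starRingEnd ℂ) (g x) ∂muc) := by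
  have key : ∀ c : ℂ, HasSum (fun k => ((‖fc f k + c * fc g k‖ ^ 2 : ℝ) : ℂ))
      (((1 / (2 * π) : ℝ) : ℂ) * ∫ x, ((‖f x + c * g x‖ ^ 2 : ℝ) : ℂ) ∂muc) := by
    intro c
    have h := hasSum_fc_sq (hf.add (hg.const_mul c))
    have h2 := Complex.hasSum_ofReal.mpr h
    rw [Complex.ofReal_mul, ← integral_complex_ofReal] at h2
    have e : ∀ k, fc f k + c * fc g k = fc (f + fun x => c * g x) k := fun k => by
      rw [← fc_const_mul, ← fc_add (MemLp.int1 hf) (MemLp.int1 (hg.const_mul c))]; rfl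
    simp only [e]
    exact h2
  have hint : ∀ c : ℂ, Integrable (fun x => ((‖f x + c * g x‖ ^ 2 : ℝ) : ℂ)) muc := fun c =>
    ((hf.add (hg.const_mul c)).integrable_norm_pow (by norm_num)).ofReal
  have pol : ∀ a b : ℂ, a * (starRingEnd ℂ) b = (1 / 4) * ((‖a + 1 * b‖ ^ 2 : ℝ) : ℂ)
      + (-1 / 4) * ((‖a + (-1) * b‖ ^ 2 : ℝ) : ℂ)
      + (Complex.I / 4) * ((‖a + Complex.I * b‖ ^ 2 : ℝ) : ℂ)
      + (-Complex.I / 4) * ((‖a + (-Complex.I) * b‖ ^ 2 : ℝ) : ℂ) := by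
    intro a b
    simp only [Complex.ofReal_pow, ← Complex.mul_conj', map_add, map_mul, map_neg, map_one,
      Complex.conj_I]
    ring_nf
    simp only [Complex.I_sq]
    ring_nf
  have H := ((((key 1).mul_left (1 / 4)).add ((key (-1)).mul_left (-1 / 4))).add
    ((key Complex.I).mul_left (Complex.I / 4))).add ((key (-Complex.I)).mul_left (-Complex.I / 4))
  have e : ((1 / (2 * π) : ℝ) : ℂ) * ∫ x, f x * (starRingEnd ℂ) (g x) ∂muc = _ :=
    congrArg _ (integral_congr_ae (Eventually.of_forall fun x => pol (f x) (g x)))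
  rw [integral_add, integral_add, integral_add] at e
  · simp only [integral_const_mul] at e
    rw [e, funext fun k => pol (fc f k) (fc g k)]
    refine (Eq.subst (motive := fun z => HasSum _ z) ?_ H)
    ring
  all_goals
    repeat' apply Integrable.add
  all_goals exact (hint _).const_mul _

lemma fc_mul {f g : ℝ → ℂ} (hf : MemLp f 2 muc) (hg : MemLp g 2 muc) (m : ℤ) :
    HasSum (fun a => fc f a * fc g (m - a)) (fc (fun x => f x * g x) m) := by
  have hg' : MemLp (fun x => (starRingEnd ℂ) (g x) * ek m x) 2 muc :=
    (MemLp.star hg).of_le (hg.1.star.mul (continuous_ek m).aestronglyMeasurable)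
      (Eventually.of_forall fun x => by simp [norm_ek])
  have := hasSum_fc_mul_conj hf hg'
  convert this using 1
  · ext a; rw [fc_mul_ek, fc_conj]; simp
  · rw [fc_eq]; congr 2; ext x; simp [ek_conj, mul_assoc]

lemma measurePreserving_muc :
    have : Fact (0 < 2 * π) := ⟨by positivity⟩
    MeasurePreserving ((↑) : ℝ → AddCircle (2 * π)) muc volume := by
  have : Fact (0 < 2 * π) := ⟨by positivity⟩
  have := AddCircle.measurePreserving_mk (2 * π) (-π)
  rw [show -π + 2 * π = π by ring] at this
  exact this

/-- Riesz–Fischer on the circle. -/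
lemma exists_memLp_of_summable_sq {c : ℤ → ℂ} (hc : Summable fun k => ‖c k‖ ^ 2) :
    ∃ f : ℝ → ℂ, MemLp f 2 muc ∧ ∀ k, fc f k = c k := by
  have hT : Fact (0 < 2 * π) := ⟨by positivity⟩
  have hl : Memℓp c 2 := by
    rw [memℓp_gen_iff (by norm_num)]; simpa using hc
  set F := (fourierBasis (T := 2 * π)).repr.symm (⟨c, hl⟩ : lp (fun _ : ℤ => ℂ) 2) with hF
  have hrep : ∀ k, fourierCoeff (F : AddCircle (2 * π) → ℂ) k = c k := by
    intro k
    rw [← fourierBasis_repr, hF, LinearIsometryEquiv.apply_symm_apply]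
  have hmem : MemLp (F : AddCircle (2 * π) → ℂ) 2 volume := by
    have h1 : MemLp (F : AddCircle (2 * π) → ℂ) 2 AddCircle.haarAddCircle := Lp.memLp F
    rw [AddCircle.volume_eq_smul_haarAddCircle]
    exact h1.smul_measure ENNReal.ofReal_ne_top
  refine ⟨fun x => F x, hmem.comp_measurePreserving measurePreserving_muc, fun k => ?_⟩
  rw [← hrep k, fourierCoeff_eq_intervalIntegral _ k (-π), fc_eq, integral_muc, ← Complex.real_smul,
    show -π + 2 * π = π by ring]
  congr 1
  refine intervalIntegral.integral_congr fun x _ => ?_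
  rw [smul_eq_mul, mul_comm]
  congr 1
  rw [fourier_coe_apply, ek]
  congr 1
  have : (π : ℂ) ≠ 0 := by exact_mod_cast pi_ne_zero
  push_cast
  field_simp

/-- Fejér means of the Fourier series of `φ`. -/
def fej (N : ℕ) (φ : ℝ → ℂ) (x : ℝ) : ℂ :=
  (N : ℂ)⁻¹ * ∑ i ∈ Finset.range N, ∑ j ∈ Finset.range N,
    fc φ ((i : ℤ) - j) * ek ((i : ℤ) - j) x

/-- The Fejér multiplier. -/
def fejMul (N : ℕ) (k : ℤ) : ℝ :=
  (N : ℝ)⁻¹ * ∑ i ∈ Finset.range N, ∑ j ∈ Finset.range N, if k = (i : ℤ) - j then 1 else 0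

lemma sum_ek_sub (N : ℕ) (z : ℝ) :
    ∑ i ∈ Finset.range N, ∑ j ∈ Finset.range N, ek ((i : ℤ) - j) z
      = ((‖∑ i ∈ Finset.range N, ek i z‖ ^ 2 : ℝ) : ℂ) := by
  rw [Complex.ofReal_pow, ← Complex.mul_conj', map_sum, Finset.sum_mul_sum]
  refine Finset.sum_congr rfl fun i _ => Finset.sum_congr rfl fun j _ => ?_
  rw [ek_conj, ← ek_add, sub_eq_add_neg]

lemma fej_eq {φ : ℝ → ℂ} (hφ : Integrable φ muc) (N : ℕ) (x : ℝ) :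
    fej N φ x = (N : ℂ)⁻¹ * (((1 / (2 * π) : ℝ) : ℂ) *
      ∫ y, φ y * ((‖∑ i ∈ Finset.range N, ek i (x - y)‖ ^ 2 : ℝ) : ℂ) ∂muc) := by
  unfold fej
  congr 1
  have h1 : ∀ k : ℤ, fc φ k * ek k x = ((1 / (2 * π) : ℝ) : ℂ) * ∫ y, φ y * ek k (x - y) ∂muc := by
    intro k
    rw [fc_eq, mul_assoc, ← integral_mul_const]
    congr 2; ext y
    rw [sub_eq_add_neg, ek_add_right, ek_neg_right]; ring
  have hint : ∀ k : ℤ, Integrable (fun y => φ y * ek k (x - y)) muc := fun k =>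
    hφ.mul_bdd (c := 1) (by fun_prop) (Eventually.of_forall fun y => (norm_ek k _).le)
  simp only [h1, ← Finset.mul_sum]
  congr 1
  simp only [← sum_ek_sub, Finset.mul_sum]
  rw [integral_finsetSum]
  · refine Finset.sum_congr rfl fun i _ => ?_
    rw [integral_finsetSum _ fun j _ => hint _]
  · exact fun i _ => integrable_finsetSum _ fun j _ => hint _

lemma fej_one {N : ℕ} (hN : N ≠ 0) (x : ℝ) : fej N (fun _ => 1) x = 1 := by
  have h : ∀ k : ℤ, fc (fun _ => 1) k = if k = 0 then 1 else 0 := by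
    intro k
    rw [← fc_ek 0 k]; congr 1; ext x; simp [ek_zero]
  unfold fej
  have : ∀ i ∈ Finset.range N, ∑ j ∈ Finset.range N,
      fc (fun _ => 1) ((i : ℤ) - j) * ek ((i : ℤ) - j) x = 1 := by
    intro i hi
    rw [Finset.sum_eq_single i]
    · simp [h, ek_zero]
    · intro j _ hj
      rw [h, if_neg (by omega), zero_mul]
    · exact fun h => absurd hi h
  rw [Finset.sum_congr rfl this]
  simp [hN]

lemma norm_fej_le {φ : ℝ → ℂ} (hφ : AEStronglyMeasurable φ muc) {C : ℝ}
    (hC : ∀ᵐ x ∂muc, ‖φ x‖ ≤ C) {N : ℕ} (hN : N ≠ 0) (x : ℝ) : ‖fej N φ x‖ ≤ C := by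
  have hi : Integrable φ muc := Integrable.of_bound hφ C hC
  set K : ℝ → ℝ := fun y => ‖∑ i ∈ Finset.range N, ek i (x - y)‖ ^ 2 with hK
  have hKc : Continuous K := by simp only [hK]; fun_prop
  have hKi : Integrable K muc :=
    (hKc.continuousOn.integrableOn_compact (isCompact_Icc (a := -π) (b := π))).mono_set
      Set.Ioc_subset_Icc_self
  have h1 : (N : ℝ)⁻¹ * ((1 / (2 * π)) * ∫ y, K y ∂muc) = 1 := by
    have := (fej_eq (integrable_const (1 : ℂ)) N x).symm.trans (fej_one hN x)
    simp only [one_mul] at this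
    rw [integral_complex_ofReal, ← Complex.ofReal_natCast, ← Complex.ofReal_inv,
      ← Complex.ofReal_mul, ← Complex.ofReal_mul] at this
    exact_mod_cast this
  rw [fej_eq hi, norm_mul, norm_mul, Complex.norm_real, norm_inv, Complex.norm_natCast,
    Real.norm_of_nonneg (by positivity)]
  calc (N : ℝ)⁻¹ * ((1 / (2 * π)) * ‖∫ y, φ y * ((K y : ℝ) : ℂ) ∂muc‖)
      ≤ (N : ℝ)⁻¹ * ((1 / (2 * π)) * ∫ y, C * K y ∂muc) := by
        gcongr
        refine norm_integral_le_of_norm_le (hKi.const_mul C) ?_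
        filter_upwards [hC] with y hy
        rw [norm_mul, Complex.norm_real, Real.norm_of_nonneg (by positivity)]
        have : 0 ≤ K y := by positivity
        gcongr
    _ = C := by
        rw [integral_const_mul]
        linear_combination C * h1

@[fun_prop]
lemma continuous_fej (N : ℕ) (φ : ℝ → ℂ) : Continuous (fej N φ) := by unfold fej; fun_prop

lemma hasSum_fejMul (N : ℕ) (g : ℤ → ℂ) :
    HasSum (fun k => (fejMul N k : ℂ) * g k)
      ((N : ℂ)⁻¹ * ∑ i ∈ Finset.range N, ∑ j ∈ Finset.range N, g ((i : ℤ) - j)) := by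
  have : (fun k => (fejMul N k : ℂ) * g k) = fun k => (N : ℂ)⁻¹ *
      ∑ i ∈ Finset.range N, ∑ j ∈ Finset.range N,
        if k = (i : ℤ) - j then g ((i : ℤ) - j) else 0 := by
    ext k
    unfold fejMul
    push_cast
    rw [mul_assoc, Finset.sum_mul]
    congr 1
    refine Finset.sum_congr rfl fun i _ => ?_
    rw [Finset.sum_mul]
    refine Finset.sum_congr rfl fun j _ => ?_
    split_ifs with h <;> simp [h]
  rw [this]
  exact (hasSum_sum fun i _ => hasSum_sum fun j _ => hasSum_ite_eq _ _).mul_left _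

lemma fejMul_nonneg (N : ℕ) (k : ℤ) : 0 ≤ fejMul N k := by
  unfold fejMul
  refine mul_nonneg (by positivity) (Finset.sum_nonneg fun i _ => Finset.sum_nonneg fun j _ => ?_)
  split_ifs <;> norm_num

lemma fejMul_le_one (N : ℕ) (k : ℤ) : fejMul N k ≤ 1 := by
  unfold fejMul
  have : ∀ i ∈ Finset.range N,
      ∑ j ∈ Finset.range N, (if k = (i : ℤ) - j then (1 : ℝ) else 0) ≤ 1 := by
    intro i _
    by_cases h : ∃ j ∈ Finset.range N, k = (i : ℤ) - j
    · obtain ⟨j, hj, e⟩ := h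
      rw [Finset.sum_eq_single_of_mem j hj fun j' _ hne => if_neg (by omega), if_pos e]
    · push Not at h
      rw [Finset.sum_eq_zero fun j hj => if_neg (h j hj)]; norm_num
  have h2 := Finset.sum_le_sum this
  simp only [Finset.sum_const, Finset.card_range, nsmul_eq_mul, mul_one] at h2
  rcases eq_or_ne N 0 with rfl | hN
  · simp
  · have : (0 : ℝ) < N := by positivity
    rw [inv_mul_le_iff₀ this]; linarith

lemma fejMul_ge (N : ℕ) (hN : N ≠ 0) (k : ℤ) : 1 - k.natAbs / (N : ℝ) ≤ fejMul N k := by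
  have hN' : (0 : ℝ) < N := by positivity
  unfold fejMul
  rw [← Finset.sum_product', le_inv_mul_iff₀ hN']
  have e : (N : ℝ) * (1 - k.natAbs / (N : ℝ)) = N - k.natAbs := by field_simp
  rw [e, Finset.sum_boole]
  have hc : N - k.natAbs ≤ (Finset.filter (fun p : ℕ × ℕ => k = (p.1 : ℤ) - p.2)
      (Finset.range N ×ˢ Finset.range N)).card := by
    rw [← Finset.card_range (N - k.natAbs)]
    refine Finset.card_le_card_of_injOn
      (fun l => if 0 ≤ k then (l + k.natAbs, l) else (l, l + k.natAbs)) ?_ ?_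
    · intro l hl
      simp only [Finset.coe_range, Set.mem_Iio] at hl
      split_ifs with h <;> simp only [Finset.coe_filter, Set.mem_ofPred_eq, Finset.mem_product,
        Finset.mem_range] <;> omega
    · intro a _ b _ hab
      simp only at hab
      split_ifs at hab <;> simp at hab <;> omega
  have : ((N - k.natAbs : ℕ) : ℝ) ≤ _ := Nat.cast_le.mpr hc
  have h3 : (N : ℝ) ≤ ((N - k.natAbs : ℕ) : ℝ) + k.natAbs := by exact_mod_cast (by omega)
  linarith

lemma tendsto_fejMul (k : ℤ) : Tendsto (fun N => fejMul N k) atTop (𝓝 1) := by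
  have h : Tendsto (fun N : ℕ => 1 - k.natAbs / (N : ℝ)) atTop (𝓝 1) := by
    simpa using tendsto_const_nhds.sub (tendsto_const_div_atTop_nhds_zero_nat (k.natAbs : ℝ))
  refine tendsto_of_tendsto_of_tendsto_of_le_of_le' h tendsto_const_nhds ?_
    (Eventually.of_forall fun N => fejMul_le_one N k)
  filter_upwards [eventually_ne_atTop 0] with N hN using fejMul_ge N hN k

lemma memLp_of_bdd {f : ℝ → ℂ} (hf : AEStronglyMeasurable f muc) {C : ℝ}
    (hC : ∀ᵐ x ∂muc, ‖f x‖ ≤ C) (p : ℝ≥0∞) : MemLp f p muc :=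
  (memLp_const C).of_le hf (hC.mono fun _ hx => hx.trans (le_abs_self C))

lemma fc_mul_fej {F φ : ℝ → ℂ} (hF : Integrable F muc) (N : ℕ) (m : ℤ) :
    fc (fun x => F x * fej N φ x) m = ∑' k, (fejMul N k : ℂ) * (fc φ k * fc F (m - k)) := by
  rw [(hasSum_fejMul N fun k => fc φ k * fc F (m - k)).tsum_eq]
  have : (fun x => F x * fej N φ x) = fun x => (N : ℂ)⁻¹ * ∑ i ∈ Finset.range N,
      ∑ j ∈ Finset.range N, fc φ ((i : ℤ) - j) * (F x * ek ((i : ℤ) - j) x) := by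
    ext x; unfold fej
    rw [mul_left_comm]; congr 1
    simp only [Finset.mul_sum]
    refine Finset.sum_congr rfl fun i _ => Finset.sum_congr rfl fun j _ => by ring
  rw [this, fc_const_mul, fc_sum]
  · congr 1
    refine Finset.sum_congr rfl fun i _ => ?_
    rw [fc_sum]
    · refine Finset.sum_congr rfl fun j _ => ?_
      rw [fc_const_mul, fc_mul_ek]
    · exact fun j _ => (integrable_mul_ek hF _).const_mul _
  · exact fun i _ => integrable_finsetSum _ fun j _ => (integrable_mul_ek hF _).const_mul _

lemma fc_fej (φ : ℝ → ℂ) (N : ℕ) (k : ℤ) : fc (fej N φ) k = fejMul N k * fc φ k := by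
  have h := fc_mul_fej (φ := φ) (integrable_const (1 : ℂ)) N k
  simp only [one_mul] at h
  rw [h, tsum_eq_single k]
  · have := fc_ek 0 0
    simp only [if_true] at this
    rw [show (fun _ : ℝ => (1 : ℂ)) = ek 0 from funext fun x => (ek_zero x).symm, sub_self, this,
      mul_one]
  · intro l hl
    rw [show (fun _ : ℝ => (1 : ℂ)) = ek 0 from funext fun x => (ek_zero x).symm, fc_ek,
      if_neg (by omega)]; simp

lemma exists_fej_ae_tendsto {φ : ℝ → ℂ} (hφ : MemLp φ 2 muc) :
    ∃ ns : ℕ → ℕ, StrictMono ns ∧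
      ∀ᵐ x ∂muc, Tendsto (fun i => fej (ns i) φ x) atTop (𝓝 (φ x)) := by
  have hfm : ∀ N, MemLp (fej N φ) 2 muc := fun N => by
    obtain ⟨C, hC⟩ := (isCompact_Icc (a := -π) (b := π)).exists_bound_of_continuousOn
      (continuous_fej N φ).continuousOn
    refine memLp_of_bdd (continuous_fej N φ).aestronglyMeasurable (C := C) ?_ 2
    filter_upwards [ae_restrict_mem (measurableSet_Ioc)] with x hx
    exact hC x (Set.Ioc_subset_Icc_self hx)
  have hd : ∀ N, MemLp (fun x => fej N φ x - φ x) 2 muc := fun N => (hfm N).sub hφ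
  have hpar : ∀ N, ∫ x, ‖fej N φ x - φ x‖ ^ 2 ∂muc
      = 2 * π * ∑' k, (1 - fejMul N k) ^ 2 * ‖fc φ k‖ ^ 2 := by
    intro N
    have h := (hasSum_fc_sq (hd N)).tsum_eq
    have e : ∀ k, ‖fc (fun x => fej N φ x - φ x) k‖ ^ 2 = (1 - fejMul N k) ^ 2 * ‖fc φ k‖ ^ 2 := by
      intro k
      rw [fc_sub (MemLp.int1 (hfm N)) (MemLp.int1 hφ), fc_fej]
      rw [show (fejMul N k : ℂ) * fc φ k - fc φ k = ((fejMul N k - 1 : ℝ) : ℂ) * fc φ k by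
        push_cast; ring, norm_mul, mul_pow, Complex.norm_real, Real.norm_eq_abs, sq_abs]
      ring
    simp only [e] at h
    rw [h]; field_simp
  have hlim : Tendsto (fun N => ∫ x, ‖fej N φ x - φ x‖ ^ 2 ∂muc) atTop (𝓝 0) := by
    simp only [hpar]
    have : Tendsto (fun N => ∑' k, (1 - fejMul N k) ^ 2 * ‖fc φ k‖ ^ 2) atTop
        (𝓝 (∑' _ : ℤ, (0 : ℝ))) := by
      refine tendsto_tsum_of_dominated_convergence (hasSum_fc_sq hφ).summable ?_ ?_
      · intro k
        have := (((tendsto_fejMul k).const_sub 1).pow 2).mul_const (‖fc φ k‖ ^ 2)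
        simpa using this
      · refine Eventually.of_forall fun N k => ?_
        have h1 := fejMul_nonneg N k
        have h2 := fejMul_le_one N k
        rw [norm_mul, Real.norm_of_nonneg (by positivity), Real.norm_of_nonneg (by positivity)]
        have : (1 - fejMul N k) ^ 2 ≤ 1 := by nlinarith
        nlinarith [sq_nonneg ‖fc φ k‖]
    simpa using this.const_mul (2 * π)
  have hLp : Tendsto (fun N => eLpNorm (fej N φ - φ) 2 muc) atTop (𝓝 0) := by
    have e : ∀ N, eLpNorm (fej N φ - φ) 2 muc
        = ENNReal.ofReal ((∫ x, ‖fej N φ x - φ x‖ ^ 2 ∂muc) ^ (1 / 2 : ℝ)) := by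
      intro N
      rw [MemLp.eLpNorm_eq_integral_rpow_norm (by norm_num) (by norm_num) ((hfm N).sub hφ)]
      simp
    simp only [e]
    have := (hlim.rpow_const (p := (1 / 2 : ℝ)) (Or.inr (by norm_num)))
    rw [Real.zero_rpow (by norm_num)] at this
    simpa using ENNReal.tendsto_ofReal this
  exact (tendstoInMeasure_of_tendsto_eLpNorm (by norm_num)
    (fun N => (hfm N).1) hφ.1 hLp).exists_seq_tendsto_ae

/-- Fourier coefficients of a product of an integrable and a bounded function. -/
lemma fc_mul_of_summable {F φ : ℝ → ℂ} (hF : Integrable F muc) (hφ : AEStronglyMeasurable φ muc)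
    {C : ℝ} (hC : ∀ᵐ x ∂muc, ‖φ x‖ ≤ C) {m : ℤ}
    (hs : Summable fun k => ‖fc φ k * fc F (m - k)‖) :
    fc (fun x => F x * φ x) m = ∑' k, fc φ k * fc F (m - k) := by
  obtain ⟨ns, hns, hae⟩ := exists_fej_ae_tendsto (memLp_of_bdd hφ hC 2)
  have h1 : Tendsto (fun i => fc (fun x => F x * fej (ns i) φ x) m) atTop
      (𝓝 (fc (fun x => F x * φ x) m)) := by
    simp only [fc_eq]
    refine Tendsto.const_mul _ (tendsto_integral_filter_of_dominated_convergence
      (fun x => ‖F x‖ * C) ?_ ?_ (hF.norm.mul_const C) ?_)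
    · exact Eventually.of_forall fun i => (hF.1.mul
        (continuous_fej _ _).aestronglyMeasurable).mul (continuous_ek _).aestronglyMeasurable
    · filter_upwards [hns.tendsto_atTop.eventually (eventually_ne_atTop 0)] with i hi
      refine Eventually.of_forall fun x => ?_
      rw [norm_mul, norm_mul, norm_ek, mul_one]
      gcongr
      exact norm_fej_le hφ hC hi x
    · filter_upwards [hae] with x hx
      exact (hx.const_mul _).mul_const _
  have h2 : Tendsto (fun i => ∑' k, (fejMul (ns i) k : ℂ) * (fc φ k * fc F (m - k))) atTop
      (𝓝 (∑' k, fc φ k * fc F (m - k))) := by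
    refine tendsto_tsum_of_dominated_convergence hs ?_ ?_
    · intro k
      have := ((Complex.continuous_ofReal.tendsto _).comp
        ((tendsto_fejMul k).comp hns.tendsto_atTop)).mul_const (fc φ k * fc F (m - k))
      simpa using this
    · refine Eventually.of_forall fun i k => ?_
      rw [norm_mul, Complex.norm_real, Real.norm_of_nonneg (fejMul_nonneg _ _)]
      exact mul_le_of_le_one_left (norm_nonneg _) (fejMul_le_one _ _)
  simp only [fc_mul_fej hF] at h1
  exact tendsto_nhds_unique h1 h2

lemma ae_eq_zero_of_fc_eq_zero {F : ℝ → ℂ} (hF : Integrable F muc) (h : ∀ k, fc F k = 0) :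
    F =ᵐ[muc] 0 := by
  refine hF.ae_eq_zero_of_forall_setIntegral_eq_zero fun s hs _ => ?_
  have h1 := fc_mul_of_summable hF (φ := s.indicator 1)
    ((stronglyMeasurable_one.indicator hs).aestronglyMeasurable) (C := 1)
    (Eventually.of_forall fun x => by by_cases hx : x ∈ s <;> simp [hx]) (m := 0) (by simp [h])
  simp only [h, mul_zero, tsum_zero] at h1
  rw [fc_eq] at h1
  have : ((1 / (2 * π) : ℝ) : ℂ) ≠ 0 := by
    rw [Complex.ofReal_ne_zero]; positivity
  rw [← integral_indicator hs]
  rw [mul_eq_zero, or_iff_right this] at h1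
  rw [← h1]
  congr 1; ext x
  by_cases hx : x ∈ s <;> simp [hx, ek_zero]

lemma ae_eq_of_fc_eq {F G : ℝ → ℂ} (hF : Integrable F muc) (hG : Integrable G muc)
    (h : ∀ k, fc F k = fc G k) : F =ᵐ[muc] G := by
  have := ae_eq_zero_of_fc_eq_zero (hF.sub hG) fun k => by
    rw [show (F - G) = fun x => F x - G x from rfl, fc_sub hF hG, h, sub_self]
  filter_upwards [this] with x hx
  simpa [sub_eq_zero] using hx

/-- The truncated weight `min (x, √(N x))`. -/
def lw (N : ℕ) (x : ℝ) : ℝ := √(x * min x N)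

lemma lw_nonneg (N : ℕ) (x : ℝ) : 0 ≤ lw N x := Real.sqrt_nonneg _

lemma lw_sq (N : ℕ) {x : ℝ} (hx : 0 ≤ x) : lw N x ^ 2 = x * min x N :=
  Real.sq_sqrt (by positivity)

lemma lw_mono (N : ℕ) {x y : ℝ} (hx : 0 ≤ x) (h : x ≤ y) : lw N x ≤ lw N y := by
  have : (0 : ℝ) ≤ min x N := by positivity
  have hy := hx.trans h
  unfold lw
  gcongr

lemma lw_zero (N : ℕ) : lw N 0 = 0 := by simp [lw]

lemma lw_ratio_sqrt (N : ℕ) {x y : ℝ} (hx : 0 ≤ x) (h : x ≤ y) :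
    lw N x ^ 2 * y ≤ lw N y ^ 2 * x := by
  rw [lw_sq N hx, lw_sq N (hx.trans h)]
  have h1 : min x (N : ℝ) ≤ min y N := by gcongr
  nlinarith [mul_nonneg hx (hx.trans h)]

lemma lw_ratio (N : ℕ) {x y : ℝ} (hx : 0 ≤ x) (h : x ≤ y) : lw N y * x ≤ lw N x * y := by
  have hy := hx.trans h
  have h1 : min y (N : ℝ) * x ≤ min x N * y := by
    rcases le_total x N with h2 | h2
    · rw [min_eq_left h2, mul_comm]; gcongr; exact min_le_left _ _
    · rw [min_eq_right h2, min_eq_right (h2.trans h)]; gcongr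
  refine le_of_sq_le_sq ?_ (mul_nonneg (lw_nonneg _ _) hy)
  rw [mul_pow, mul_pow, lw_sq N hx, lw_sq N hy]
  nlinarith [mul_nonneg hx hy]

lemma lw_add_le (N : ℕ) {x y : ℝ} (hx : 0 ≤ x) (hy : 0 ≤ y) :
    lw N (x + y) ≤ lw N x + lw N y := by
  rcases (add_nonneg hx hy).eq_or_lt with h0 | h0
  · rw [← h0, lw_zero]; exact add_nonneg (lw_nonneg _ _) (lw_nonneg _ _)
  · have h1 := lw_ratio N hx (le_add_of_nonneg_right hy)
    have h2 := lw_ratio N hy (le_add_of_nonneg_left hx)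
    refine le_of_mul_le_mul_right ?_ h0
    nlinarith

lemma lw_le_add (N : ℕ) {x y z : ℝ} (hx : 0 ≤ x) (hy : 0 ≤ y) (hz : 0 ≤ z) (h : z ≤ x + y) :
    lw N z ≤ lw N x + lw N y :=
  (lw_mono N hz h).trans (lw_add_le N hx hy)

lemma lw_symbol_sum (N : ℕ) {x y z : ℝ} (hx : 0 ≤ x) (hy : 0 ≤ y) (hz : 0 ≤ z)
    (h1 : z ≤ x + y) (h2 : x ≤ y + z) (h3 : y ≤ x + z) :
    |lw N x + lw N y - lw N z| ≤ 2 * min (lw N x) (lw N y) := by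
  have a1 := lw_le_add N hx hy hz h1
  have a2 := lw_le_add N hy hz hx h2
  have a3 := lw_le_add N hx hz hy h3
  rw [abs_of_nonneg (by linarith)]
  rcases min_choice (lw N x) (lw N y) with h | h <;> rw [h] <;> linarith

lemma lw_symbol_diff_aux (N : ℕ) {x y z : ℝ} (hx : 0 ≤ x) (hy : 0 ≤ y) (hz : 0 ≤ z)
    (h1 : z ≤ x + y) (h3 : y ≤ x + z) (hxy : x ≤ y) :
    |lw N y - lw N x - lw N z / z * (y - x)| ≤ 2 * lw N x := by
  have a1 := lw_le_add N hx hy hz h1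
  have a3 := lw_le_add N hx hz hy h3
  have n1 := lw_nonneg N x
  have n3 := lw_nonneg N z
  rcases hz.eq_or_lt with h0 | h0
  · subst h0
    have : x = y := by linarith
    subst this; simp; linarith
  set θ := lw N z / z with hθ
  have hθz : θ * z = lw N z := by rw [hθ]; field_simp
  have hθ0 : 0 ≤ θ := by positivity
  have b1 : 0 ≤ θ * (z - y + x) := mul_nonneg hθ0 (by linarith)
  have b2 : θ * (z - y + x) ≤ 2 * lw N x := by
    rcases le_total x z with h | h
    · have c := lw_ratio N hx h
      have : θ * x ≤ lw N x := by
        rw [hθ, div_mul_eq_mul_div, div_le_iff₀ h0]; exact c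
      nlinarith
    · have c := lw_mono N hz h
      nlinarith
  rw [abs_le]; constructor <;> nlinarith

lemma lw_symbol_diff (N : ℕ) {x y z : ℝ} (hx : 0 ≤ x) (hy : 0 ≤ y) (hz : 0 ≤ z)
    (h1 : z ≤ x + y) (h2 : x ≤ y + z) (h3 : y ≤ x + z) :
    |lw N y - lw N x - lw N z / z * (y - x)| ≤ 2 * min (lw N x) (lw N y) := by
  rcases le_total x y with h | h
  · rw [min_eq_left (lw_mono N hx h)]
    exact lw_symbol_diff_aux N hx hy hz h1 h3 h
  · rw [min_eq_right (lw_mono N hy h)]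
    have := lw_symbol_diff_aux N hy hx hz (by linarith) h2 h
    rw [← abs_neg]
    convert this using 2; ring

lemma enn_cauchy {ι : Type*} (x y : ι → ℝ≥0∞) :
    (∑' i, x i * y i) ^ 2 ≤ (∑' i, x i ^ 2) * ∑' i, y i ^ 2 := by
  let : MeasurableSpace ι := ⊤
  have := ENNReal.lintegral_mul_le_Lp_mul_Lq (μ := (Measure.count : Measure ι))
    (p := 2) (q := 2) (by constructor <;> norm_num) (f := x) (g := y)
    (measurable_from_top).aemeasurable (measurable_from_top).aemeasurable
  simp only [lintegral_count, Pi.mul_apply] at this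
  have h2 := pow_le_pow_left' this 2
  refine h2.trans (le_of_eq ?_)
  rw [mul_pow, ← ENNReal.rpow_natCast, ← ENNReal.rpow_natCast, ← ENNReal.rpow_mul,
    ← ENNReal.rpow_mul]
  norm_num

lemma conv_low_high (p r : ℤ → ℝ≥0∞) :
    ∑' m : ℤ, (∑' a : ℤ, if a.natAbs ≤ (m - a).natAbs then p a * r (m - a) else 0) ^ 2
      ≤ (∑' a, p a ^ 2) * ∑' b : ℤ, (2 * (b.natAbs : ℝ≥0∞) + 1) * r b ^ 2 := by
  have h1 : ∀ m : ℤ, (∑' a : ℤ, if a.natAbs ≤ (m - a).natAbs then p a * r (m - a) else 0) ^ 2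
      ≤ (∑' a, p a ^ 2) * ∑' a : ℤ, if a.natAbs ≤ (m - a).natAbs then r (m - a) ^ 2 else 0 := by
    intro m
    have := enn_cauchy p (fun a => if a.natAbs ≤ (m - a).natAbs then r (m - a) else 0)
    simpa only [mul_ite, mul_zero, ite_pow, ne_eq, OfNat.ofNat_ne_zero, not_false_eq_true,
      zero_pow] using this
  refine (ENNReal.tsum_le_tsum h1).trans ?_
  rw [ENNReal.tsum_mul_left]
  refine mul_le_mul' le_rfl ?_
  rw [ENNReal.tsum_comm]
  have h2 : ∀ a : ℤ, (∑' m : ℤ, if a.natAbs ≤ (m - a).natAbs then r (m - a) ^ 2 else 0)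
      = ∑' b : ℤ, if a.natAbs ≤ b.natAbs then r b ^ 2 else 0 := fun a =>
    (Equiv.subRight a).tsum_eq (fun b : ℤ => if a.natAbs ≤ b.natAbs then r b ^ 2 else 0)
  simp only [h2]
  rw [ENNReal.tsum_comm]
  refine ENNReal.tsum_le_tsum fun b => ?_
  rw [tsum_eq_sum (s := Finset.Icc (-(b.natAbs : ℤ)) b.natAbs)]
  · refine (Finset.sum_le_card_nsmul _ _ (r b ^ 2) fun a _ => by split_ifs <;> simp).trans ?_
    rw [Int.card_Icc, nsmul_eq_mul]
    gcongr
    have : ((b.natAbs : ℤ) + 1 - -(b.natAbs : ℤ)).toNat = 2 * b.natAbs + 1 := by omega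
    rw [this]; push_cast; rfl
  · intro a ha
    rw [Finset.mem_Icc] at ha
    rw [if_neg (by omega)]

lemma enn_add_sq_le (a b : ℝ≥0∞) : (a + b) ^ 2 ≤ 2 * (a ^ 2 + b ^ 2) := by
  have := ENNReal.rpow_add_le_mul_rpow_add_rpow a b (p := 2) (by norm_num)
  norm_num at this
  exact_mod_cast this

lemma tsum_conv_le_sym (g : ℤ → ℤ → ℝ≥0∞) (hg : ∀ a b, g a b = g b a) (m : ℤ) :
    ∑' a : ℤ, g a (m - a)
      ≤ 2 * ∑' a : ℤ, if a.natAbs ≤ (m - a).natAbs then g a (m - a) else 0 := by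
  have h2 : (∑' a : ℤ, if (m - a).natAbs ≤ a.natAbs then g a (m - a) else 0)
      = ∑' a : ℤ, if a.natAbs ≤ (m - a).natAbs then g a (m - a) else 0 := by
    rw [← (Equiv.subLeft m).tsum_eq]
    refine tsum_congr fun a => ?_
    simp only [Equiv.subLeft_apply, sub_sub_cancel]
    rw [hg]
  rw [two_mul]
  conv_rhs => enter [2]; rw [← h2]
  rw [← ENNReal.tsum_add]
  refine ENNReal.tsum_le_tsum fun a => ?_
  rcases le_total a.natAbs (m - a).natAbs with h | h <;> simp [h]

/-- Square sum of the self-convolution. -/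
lemma conv_self_le (z : ℤ → ℝ≥0∞) :
    ∑' m : ℤ, (∑' a : ℤ, z a * z (m - a)) ^ 2
      ≤ 4 * ((∑' a, z a ^ 2) * ∑' b : ℤ, (2 * (b.natAbs : ℝ≥0∞) + 1) * z b ^ 2) := by
  have h := conv_low_high z z
  have : ∀ m : ℤ, (∑' a : ℤ, z a * z (m - a)) ^ 2 ≤
      4 * (∑' a : ℤ, if a.natAbs ≤ (m - a).natAbs then z a * z (m - a) else 0) ^ 2 := by
    intro m
    refine (pow_le_pow_left' (tsum_conv_le_sym (fun a b => z a * z b) (fun a b => mul_comm _ _) m)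
      2).trans (le_of_eq ?_)
    rw [mul_pow]; norm_num
  refine (ENNReal.tsum_le_tsum this).trans ?_
  rw [ENNReal.tsum_mul_left]
  gcongr

/-- The truncated weight on frequencies. -/
def lwz (N : ℕ) (k : ℤ) : ℝ := lw N k.natAbs

lemma lwz_nonneg (N : ℕ) (k : ℤ) : 0 ≤ lwz N k := lw_nonneg _ _

/-- Low-high estimate for the weighted self-convolution. -/
lemma conv_lwz_le (N : ℕ) {c : ℤ → ℝ} (hc : ∀ k, 0 ≤ c k) :
    ∑' m : ℤ, (∑' a : ℤ, ENNReal.ofReal (min (lwz N a) (lwz N (m - a)) * (c a * c (m - a)))) ^ 2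
      ≤ 12 * ((∑' k : ℤ, ENNReal.ofReal (k.natAbs * c k ^ 2)) *
          ∑' k : ℤ, ENNReal.ofReal (lwz N k ^ 2 * c k ^ 2)) := by
  set p : ℤ → ℝ≥0∞ := fun a => ENNReal.ofReal (√a.natAbs * c a) with hp
  set r : ℤ → ℝ≥0∞ := fun b => ENNReal.ofReal (lwz N b / √b.natAbs * c b) with hr
  have h := conv_low_high p r
  have key : ∀ m : ℤ,
      (∑' a : ℤ, ENNReal.ofReal (min (lwz N a) (lwz N (m - a)) * (c a * c (m - a)))) ^ 2 ≤
      4 * (∑' a : ℤ, if a.natAbs ≤ (m - a).natAbs then p a * r (m - a) else 0) ^ 2 := by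
    intro m
    have hm : ∑' a : ℤ, ENNReal.ofReal (min (lwz N a) (lwz N (m - a)) * (c a * c (m - a)))
        ≤ 2 * ∑' a : ℤ, if a.natAbs ≤ (m - a).natAbs then p a * r (m - a) else 0 := by
      refine (tsum_conv_le_sym
        (fun a b => ENNReal.ofReal (min (lwz N a) (lwz N b) * (c a * c b)))
        (fun a b => by rw [min_comm, mul_comm (c a)]) m).trans
        (mul_le_mul' le_rfl (ENNReal.tsum_le_tsum fun a => ?_))
      split_ifs with hab
      · simp only [hp, hr]
        rw [← ENNReal.ofReal_mul (mul_nonneg (Real.sqrt_nonneg _) (hc a))]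
        refine ENNReal.ofReal_le_ofReal ?_
        set b := m - a
        have hab' : (a.natAbs : ℝ) ≤ b.natAbs := by exact_mod_cast hab
        have h1 : lwz N a ≤ √a.natAbs * (lwz N b / √b.natAbs) := by
          rcases Nat.eq_zero_or_pos b.natAbs with h0 | h0
          · have : a.natAbs = 0 := by omega
            simp [lwz, this, lw_zero]
          · have h0' : (0 : ℝ) < b.natAbs := by exact_mod_cast h0
            rw [← mul_div_assoc, le_div_iff₀ (Real.sqrt_pos.mpr h0')]
            refine le_of_sq_le_sq ?_ (mul_nonneg (Real.sqrt_nonneg _) (lwz_nonneg _ _))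
            rw [mul_pow, mul_pow, Real.sq_sqrt (by positivity), Real.sq_sqrt (by positivity),
              mul_comm (a.natAbs : ℝ)]
            exact lw_ratio_sqrt N (by positivity) hab'
        have h2 := (min_le_left (lwz N a) (lwz N b)).trans h1
        have h3 := mul_nonneg (hc a) (hc b)
        calc _ ≤ (√a.natAbs * (lwz N b / √b.natAbs)) * (c a * c b) := by gcongr
          _ = _ := by ring
      · exact le_rfl
    refine (pow_le_pow_left' hm 2).trans (le_of_eq ?_)
    rw [mul_pow]; norm_num
  refine (ENNReal.tsum_le_tsum key).trans ?_
  rw [ENNReal.tsum_mul_left]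
  have e1 : ∀ a, p a ^ 2 = ENNReal.ofReal (a.natAbs * c a ^ 2) := by
    intro a
    simp only [hp]
    rw [← ENNReal.ofReal_pow (mul_nonneg (Real.sqrt_nonneg _) (hc a)), mul_pow,
      Real.sq_sqrt (by positivity)]
  have e2 : ∀ b : ℤ, (2 * (b.natAbs : ℝ≥0∞) + 1) * r b ^ 2
      ≤ 3 * ENNReal.ofReal (lwz N b ^ 2 * c b ^ 2) := by
    intro b
    simp only [hr]
    rw [← ENNReal.ofReal_pow (by have := hc b; have := lwz_nonneg N b; positivity), mul_pow,
      div_pow, Real.sq_sqrt (by positivity),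
      show (2 * (b.natAbs : ℝ≥0∞) + 1) = ENNReal.ofReal (2 * b.natAbs + 1) by
        rw [ENNReal.ofReal_add (by positivity) (by norm_num), ENNReal.ofReal_mul (by norm_num),
          ENNReal.ofReal_natCast]
        simp,
      show (3 : ℝ≥0∞) = ENNReal.ofReal 3 by simp, ← ENNReal.ofReal_mul (by positivity),
      ← ENNReal.ofReal_mul (by positivity)]
    refine ENNReal.ofReal_le_ofReal ?_
    rcases Nat.eq_zero_or_pos b.natAbs with h0 | h0
    · simp [h0, lwz, lw_zero]
    · have h0' : (1 : ℝ) ≤ b.natAbs := by exact_mod_cast h0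
      rw [← mul_assoc, ← mul_assoc]
      refine mul_le_mul_of_nonneg_right ?_ (sq_nonneg _)
      rw [mul_div_assoc', div_le_iff₀ (by positivity)]
      nlinarith [sq_nonneg (lwz N b)]
  simp only [e1] at h
  calc _ ≤ 4 * ((∑' k : ℤ, ENNReal.ofReal (k.natAbs * c k ^ 2)) *
        ∑' b : ℤ, 3 * ENNReal.ofReal (lwz N b ^ 2 * c b ^ 2)) := by
        gcongr
        exact h.trans (mul_le_mul' le_rfl (ENNReal.tsum_le_tsum e2))
    _ = _ := by
      rw [ENNReal.tsum_mul_left]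
      rw [show (12 : ℝ≥0∞) = 4 * 3 by norm_num]; ring

lemma lintegral_muc_shift {G : ℝ → ℝ≥0∞} (hG : Function.Periodic G (2 * π)) (x : ℝ) :
    ∫⁻ h, G (x + h) ∂muc = ∫⁻ y, G y ∂muc := by
  have h2π : (0 : ℝ) < 2 * π := by positivity
  have e1 := (isAddFundamentalDomain_Ioc h2π (-π)).setLIntegral_eq
    (isAddFundamentalDomain_Ioc h2π (x + -π)) G (by
      rintro ⟨g, hg⟩ y
      obtain ⟨n, rfl⟩ := AddSubgroup.mem_zmultiples_iff.mp hg
      change G (n • (2 * π) + y) = G y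
      rw [add_comm]
      exact hG.zsmul n y)
  have e2 := (measurePreserving_add_left volume x).setLIntegral_comp_preimage_emb
    (Homeomorph.addLeft x).measurableEmbedding G (Set.Ioc (x + -π) (x + -π + 2 * π))
  have e3 : (fun h => x + h) ⁻¹' (Set.Ioc (x + -π) (x + -π + 2 * π)) = circ := by
    ext h; simp only [Set.mem_preimage, Set.mem_Ioc, circ]
    constructor <;> rintro ⟨h1, h2⟩ <;> constructor <;> linarith
  rw [show -π + 2 * π = π by ring] at e1
  rw [e3] at e2
  exact e2.trans e1.symm

lemma memLp_two_iff {f : ℝ → ℂ} (hf : AEStronglyMeasurable f muc) :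
    MemLp f 2 muc ↔ ∫⁻ x, ‖f x‖ₑ ^ 2 ∂muc < ⊤ := by
  rw [MemLp, and_iff_right hf, eLpNorm_lt_top_iff_lintegral_rpow_enorm_lt_top (by norm_num)
    (by norm_num)]
  simp

lemma memLp_shift {f : ℝ → ℂ} (hm : Measurable f) (hp : Function.Periodic f (2 * π))
    (hf : MemLp f 2 muc) (h : ℝ) : MemLp (fun x => f (x + h)) 2 muc := by
  rw [memLp_two_iff hm.aestronglyMeasurable] at hf
  have hm' : Measurable fun x => f (x + h) := hm.comp (measurable_add_const h)
  rw [memLp_two_iff hm'.aestronglyMeasurable]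
  have := lintegral_muc_shift (G := fun x => ‖f x‖ₑ ^ 2) (fun x => by simp only [hp x]) h
  simp only [add_comm h] at this
  rw [this]; exact hf

lemma fc_shift {f : ℝ → ℂ} (hp : Function.Periodic f (2 * π)) (h : ℝ) (k : ℤ) :
    fc (fun x => f (x + h)) k = ek k h * fc f k := by
  rw [fc_eq, fc_eq, mul_left_comm]
  congr 1
  have hF : Function.Periodic (fun x => f x * ek (-k) x) (2 * π) := fun x => by
    simp only [hp x, ek_periodic (-k) x]
  have e : ∀ x, f (x + h) * ek (-k) x = ek k h * (f (x + h) * ek (-k) (x + h)) := by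
    intro x
    have : ek k h * ek (-k) h = 1 := by rw [← ek_add, add_neg_cancel, ek_zero]
    rw [ek_add_right]; linear_combination (-f (x + h) * ek (-k) x) * this
  simp only [e]
  rw [integral_const_mul, integral_muc, integral_muc]
  congr 1
  rw [intervalIntegral.integral_comp_add_right (fun x => f x * ek (-k) x)]
  have := hF.intervalIntegral_add_eq (-π) (-π + h)
  rw [show -π + 2 * π = π by ring, show -π + h + 2 * π = π + h by ring] at this
  exact this.symm

lemma integral_norm_dirichlet_sq (N : ℕ) :
    ∫ h, ‖∑ i ∈ Finset.range N, ek i h‖ ^ 2 ∂muc = 2 * π * N := by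
  have : ((∫ h, ‖∑ i ∈ Finset.range N, ek i h‖ ^ 2 ∂muc : ℝ) : ℂ) = ((2 * π * N : ℝ) : ℂ) := by
    rw [← integral_complex_ofReal]
    simp only [← sum_ek_sub]
    have hi : ∀ k : ℤ, Integrable (ek k) muc := fun k => by
      simpa using integrable_mul_ek (integrable_const (1 : ℂ)) k
    rw [integral_finsetSum _ fun i _ => integrable_finsetSum _ fun j _ => hi _]
    have : ∀ i ∈ Finset.range N, ∫ h, ∑ j ∈ Finset.range N, ek ((i : ℤ) - j) h ∂muc
        = ((2 * π : ℝ) : ℂ) := by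
      intro i hi'
      rw [integral_finsetSum _ fun j _ => hi _, Finset.sum_eq_single_of_mem i hi']
      · rw [integral_ek, if_pos (by ring)]
      · intro j _ hj
        rw [integral_ek, if_neg (by omega)]
    rw [Finset.sum_congr rfl this]
    simp; ring
  exact_mod_cast this

lemma norm_one_sub_ek_one_sq (h : ℝ) : ‖1 - ek 1 h‖ ^ 2 = (2 * |Real.sin (h / 2)|) ^ 2 := by
  rw [mul_pow, sq_abs, ← Complex.normSq_eq_norm_sq, ek_eq]
  simp only [Complex.normSq_apply]
  simp [-Complex.ofReal_cos, -Complex.ofReal_sin]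
  have := Real.cos_sq_add_sin_sq h
  have h2 : Real.cos h = 1 - 2 * Real.sin (h / 2) ^ 2 := by
    have := Real.cos_two_mul (h / 2)
    have h3 := Real.cos_sq_add_sin_sq (h / 2)
    rw [show 2 * (h / 2) = h by ring] at this
    rw [this]; linarith
  nlinarith

lemma norm_one_sub_ek (k : ℤ) (h : ℝ) :
    ‖1 - ek k h‖ = ‖1 - ek 1 h‖ * ‖∑ i ∈ Finset.range k.natAbs, ek i h‖ := by
  have hp : ∀ N : ℕ, ‖1 - ek N h‖ = ‖1 - ek 1 h‖ * ‖∑ i ∈ Finset.range N, ek i h‖ := by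
    intro N
    have hpow : ∀ i : ℕ, ek i h = ek 1 h ^ i := by
      intro i
      induction i with
      | zero => simp [ek_zero]
      | succ i ih => rw [pow_succ, ← ih, ← ek_add]; push_cast; rfl
    simp only [hpow]
    rw [← norm_mul, mul_comm, ← geom_sum_mul_neg]
  rcases Int.natAbs_eq k with hk | hk
  · rw [← hp, ← hk]
  · rw [← hp]
    conv_lhs => rw [hk, ← ek_conj, ← map_one (starRingEnd ℂ), ← map_sub, RCLike.norm_conj]

lemma sin_half_ne_zero_ae : ∀ᵐ h ∂muc, Real.sin (h / 2) ≠ 0 := by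
  have h0 : ∀ᵐ h ∂muc, h ≠ 0 := by
    refine ae_restrict_of_ae ?_
    simp [ae_iff]
  filter_upwards [h0, ae_restrict_mem measurableSet_Ioc] with h h1 h2
  rw [Ne, Real.sin_eq_zero_iff_of_lt_of_lt (by linarith [h2.1, pi_pos])
    (by linarith [h2.2, pi_pos])]
  simpa using h1

lemma lintegral_symbol (k : ℤ) :
    ∫⁻ h, ENNReal.ofReal (‖1 - ek k h‖ ^ 2 / (2 * |Real.sin (h / 2)|) ^ 2) ∂muc
      = ENNReal.ofReal (2 * π * k.natAbs) := by
  have hc : Continuous fun h => ‖∑ i ∈ Finset.range k.natAbs, ek i h‖ ^ 2 := by fun_prop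
  have hi : Integrable (fun h => ‖∑ i ∈ Finset.range k.natAbs, ek i h‖ ^ 2) muc :=
    (hc.continuousOn.integrableOn_compact (isCompact_Icc (a := -π) (b := π))).mono_set
      Set.Ioc_subset_Icc_self
  rw [← integral_norm_dirichlet_sq,
    ofReal_integral_eq_lintegral_ofReal hi (Eventually.of_forall fun h => by positivity)]
  refine lintegral_congr_ae ?_
  filter_upwards [sin_half_ne_zero_ae] with h hh
  rw [norm_one_sub_ek, mul_pow, norm_one_sub_ek_one_sq, mul_div_assoc, mul_div_cancel₀]
  positivity

/-- The Gagliardo double integral in Fourier variables. -/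
lemma lintegral_gagliardo {f : ℝ → ℝ} (hm : Measurable f) (hp : Function.Periodic f (2 * π))
    (hf : MemLp (fun x => (f x : ℂ)) 2 muc) :
    ∫⁻ x, ∫⁻ y, ENNReal.ofReal ((f x - f y) ^ 2 / cd x y ^ 2) ∂muc ∂muc
      = ENNReal.ofReal (4 * π ^ 2) * hHalfR f := by
  have hmc : Measurable fun x => (f x : ℂ) := by fun_prop
  have hpc : Function.Periodic (fun x => (f x : ℂ)) (2 * π) := fun x => by simp only [hp x]
  have h1 : ∀ x, ∫⁻ y, ENNReal.ofReal ((f x - f y) ^ 2 / cd x y ^ 2) ∂muc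
      = ∫⁻ h, ENNReal.ofReal ((f x - f (x + h)) ^ 2 / (2 * |Real.sin (h / 2)|) ^ 2) ∂muc := by
    intro x
    rw [← lintegral_muc_shift _ x]
    · refine lintegral_congr fun h => ?_
      unfold cd
      rw [show (x - (x + h)) / 2 = -(h / 2) by ring, Real.sin_neg, abs_neg]
    · intro y
      simp only [hp y, cd]
      rw [show (x - (y + 2 * π)) / 2 = (x - y) / 2 - π by ring, Real.sin_sub_pi, abs_neg]
  simp only [h1]
  rw [lintegral_lintegral_swap (by fun_prop)]
  have h2 : ∀ h, ∫⁻ x, ENNReal.ofReal ((f x - f (x + h)) ^ 2 / (2 * |Real.sin (h / 2)|) ^ 2) ∂muc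
      = ∑' k : ℤ, ENNReal.ofReal (2 * π * ‖fcR f k‖ ^ 2) *
        ENNReal.ofReal (‖1 - ek k h‖ ^ 2 / (2 * |Real.sin (h / 2)|) ^ 2) := by
    intro h
    have hd : MemLp (fun x => (f x : ℂ) - f (x + h)) 2 muc := hf.sub (memLp_shift hmc hpc hf h)
    have hs := hasSum_fc_sq hd
    have e : ∀ k, ‖fc (fun x => (f x : ℂ) - f (x + h)) k‖ ^ 2
        = ‖fcR f k‖ ^ 2 * ‖1 - ek k h‖ ^ 2 := by
      intro k
      rw [fc_sub (MemLp.int1 hf) (MemLp.int1 (memLp_shift hmc hpc hf h)), fc_shift hpc, fcR,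
        ← mul_pow, ← norm_mul]
      congr 2; ring
    simp only [e] at hs
    have hs2 := hs.mul_left (2 * π / (2 * |Real.sin (h / 2)|) ^ 2)
    have hi : Integrable (fun x => (f x - f (x + h)) ^ 2 / (2 * |Real.sin (h / 2)|) ^ 2) muc := by
      have := (hd.integrable_norm_pow (by norm_num)).div_const ((2 * |Real.sin (h / 2)|) ^ 2)
      refine this.congr (Eventually.of_forall fun x => ?_)
      simp only
      rw [← Complex.ofReal_sub, Complex.norm_real, Real.norm_eq_abs]; simp
    rw [← ofReal_integral_eq_lintegral_ofReal hi (Eventually.of_forall fun x => by positivity)]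
    have e2 : ∫ x, (f x - f (x + h)) ^ 2 / (2 * |Real.sin (h / 2)|) ^ 2 ∂muc
        = 2 * π / (2 * |Real.sin (h / 2)|) ^ 2 *
          (1 / (2 * π) * ∫ x, ‖(f x : ℂ) - f (x + h)‖ ^ 2 ∂muc) := by
      rw [integral_div]
      have : ∀ x, ‖(f x : ℂ) - f (x + h)‖ ^ 2 = (f x - f (x + h)) ^ 2 := fun x => by
        rw [← Complex.ofReal_sub, Complex.norm_real, Real.norm_eq_abs, sq_abs]
      simp only [this]
      field_simp
    rw [e2, ← hs2.tsum_eq, ENNReal.ofReal_tsum_of_nonneg (fun k => by positivity) hs2.summable]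
    refine tsum_congr fun k => ?_
    rw [← ENNReal.ofReal_mul (by positivity)]
    congr 1; ring
  simp only [h2]
  rw [lintegral_tsum (fun k => by fun_prop)]
  unfold hHalfR
  rw [← ENNReal.tsum_mul_left]
  refine tsum_congr fun k => ?_
  rw [lintegral_const_mul _ (by fun_prop), lintegral_symbol]
  have e : (‖fcR f k‖₊ : ℝ≥0∞) ^ 2 = ENNReal.ofReal (‖fcR f k‖ ^ 2) := by
    rw [ENNReal.ofReal_pow (norm_nonneg _), ofReal_norm]; rfl
  rw [e, ← ENNReal.ofReal_natCast k.natAbs, ← ENNReal.ofReal_mul (by positivity),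
    ← ENNReal.ofReal_mul (by positivity), ← ENNReal.ofReal_mul (by positivity)]
  congr 1; ring

lemma hHalfR_eq (f : ℝ → ℝ) :
    hHalfR f = ∑' k : ℤ, ENNReal.ofReal (k.natAbs * ‖fcR f k‖ ^ 2) := by
  unfold hHalfR
  refine tsum_congr fun k => ?_
  rw [ENNReal.ofReal_mul (by positivity), ENNReal.ofReal_natCast,
    ENNReal.ofReal_pow (norm_nonneg _), ofReal_norm]; rfl

lemma summable_of_tsum_ofReal_ne_top {ι : Type*} {g : ι → ℝ} (hg : ∀ i, 0 ≤ g i)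
    (h : ∑' i, ENNReal.ofReal (g i) ≠ ⊤) : Summable g :=
  (ENNReal.summable_toReal h).congr fun i => ENNReal.toReal_ofReal (hg i)

lemma summable_hHalfR {f : ℝ → ℝ} (h : hHalfR f ≠ ⊤) :
    Summable fun k : ℤ => (k.natAbs : ℝ) * ‖fcR f k‖ ^ 2 :=
  summable_of_tsum_ofReal_ne_top (fun k => by positivity) (hHalfR_eq f ▸ h)

lemma hHalfR_eq_ofReal {f : ℝ → ℝ}
    (h : Summable fun k : ℤ => (k.natAbs : ℝ) * ‖fcR f k‖ ^ 2) :
    hHalfR f = ENNReal.ofReal (∑' k : ℤ, (k.natAbs : ℝ) * ‖fcR f k‖ ^ 2) := by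
  rw [hHalfR_eq, ENNReal.ofReal_tsum_of_nonneg (fun k => by positivity) h]

lemma hHalf_eq_sum {n : ℕ} (u : ℝ → E n) : hHalf u = ∑ i, hHalfR (fun x => u x i) := by
  unfold hHalf hHalfR
  simp only [Finset.mul_sum]
  rw [Summable.tsum_finsetSum fun i _ => ENNReal.summable]
  rfl

/-- Measurable, periodic, square integrable functions with finite `Ḣ^{1/2}` seminorm. -/
structure HalfReg (f : ℝ → ℝ) : Prop where
  meas : Measurable f
  per : Function.Periodic f (2 * π)
  mem : MemLp (fun x => (f x : ℂ)) 2 muc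
  fin : hHalfR f ≠ ⊤

/-- The Gagliardo energy density. -/
def gagK (f g : ℝ → ℝ) (p : ℝ × ℝ) : ℝ := (f p.1 - f p.2) * (g p.1 - g p.2) / cd p.1 p.2 ^ 2

lemma measurable_gagK {f g : ℝ → ℝ} (hf : Measurable f) (hg : Measurable g) :
    Measurable (gagK f g) := by
  unfold gagK cd; fun_prop

lemma gagK_self_nonneg (f : ℝ → ℝ) (p : ℝ × ℝ) : 0 ≤ gagK f f p := by
  unfold gagK
  exact div_nonneg (mul_self_nonneg _) (sq_nonneg _)

lemma HalfReg.lintegral_gagK {f : ℝ → ℝ} (hf : HalfReg f) :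
    ∫⁻ p, ENNReal.ofReal (gagK f f p) ∂(muc.prod muc) = ENNReal.ofReal (4 * π ^ 2) * hHalfR f := by
  rw [lintegral_prod _ (measurable_gagK hf.meas hf.meas).ennreal_ofReal.aemeasurable,
    ← lintegral_gagliardo hf.meas hf.per hf.mem]
  simp only [gagK, sq (f _ - f _)]

lemma HalfReg.integrable_gagK_self {f : ℝ → ℝ} (hf : HalfReg f) :
    Integrable (gagK f f) (muc.prod muc) := by
  refine ⟨(measurable_gagK hf.meas hf.meas).aestronglyMeasurable, ?_⟩
  rw [hasFiniteIntegral_iff_ofReal (Eventually.of_forall fun p => gagK_self_nonneg f p),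
    hf.lintegral_gagK]
  exact ENNReal.mul_lt_top ENNReal.ofReal_lt_top hf.fin.lt_top

lemma HalfReg.integral_gagK_self {f : ℝ → ℝ} (hf : HalfReg f) :
    ∫ p, gagK f f p ∂(muc.prod muc) = 4 * π ^ 2 * ∑' k : ℤ, (k.natAbs : ℝ) * ‖fcR f k‖ ^ 2 := by
  rw [integral_eq_lintegral_of_nonneg_ae (Eventually.of_forall fun p => gagK_self_nonneg f p)
    (measurable_gagK hf.meas hf.meas).aestronglyMeasurable, hf.lintegral_gagK,
    hHalfR_eq_ofReal (summable_hHalfR hf.fin), ← ENNReal.ofReal_mul (by positivity),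
    ENNReal.toReal_ofReal (mul_nonneg (by positivity) (tsum_nonneg fun k => by positivity))]

lemma fcR_add {f g : ℝ → ℝ} (hf : HalfReg f) (hg : HalfReg g) (k : ℤ) :
    fcR (fun x => f x + g x) k = fcR f k + fcR g k := by
  unfold fcR
  rw [← fc_add (MemLp.int1 hf.mem) (MemLp.int1 hg.mem)]; simp

lemma fcR_neg (f : ℝ → ℝ) (k : ℤ) : fcR (fun x => -f x) k = -fcR f k := by
  unfold fcR
  have := fc_const_mul (-1) (fun x => (f x : ℂ)) k
  simpa using this

lemma HalfReg.neg {f : ℝ → ℝ} (hf : HalfReg f) : HalfReg (fun x => -f x) := by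
  refine ⟨hf.meas.neg, fun x => by simp only [hf.per x], ?_, ?_⟩
  · have := hf.mem.neg
    convert this using 1
    ext x; simp
  · simpa [hHalfR, fcR_neg] using hf.fin

lemma HalfReg.add {f g : ℝ → ℝ} (hf : HalfReg f) (hg : HalfReg g) :
    HalfReg (fun x => f x + g x) := by
  refine ⟨hf.meas.add hg.meas, fun x => by simp only [hf.per x, hg.per x], ?_, ?_⟩
  · have := hf.mem.add hg.mem
    convert this using 1
    ext x; simp
  have hs : Summable fun k : ℤ => (k.natAbs : ℝ) * ‖fcR (fun x => f x + g x) k‖ ^ 2 := by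
    refine Summable.of_nonneg_of_le (fun k => by positivity) (fun k => ?_)
      (((summable_hHalfR hf.fin).add (summable_hHalfR hg.fin)).mul_left 2)
    rw [fcR_add hf hg, ← mul_add, mul_left_comm]
    gcongr
    have h1 := norm_add_le (fcR f k) (fcR g k)
    nlinarith [sq_nonneg (‖fcR f k‖ - ‖fcR g k‖), norm_nonneg (fcR f k + fcR g k)]
  rw [hHalfR_eq_ofReal hs]
  exact ENNReal.ofReal_ne_top

lemma gagK_polar (f g : ℝ → ℝ) (p : ℝ × ℝ) :
    gagK f g p = (gagK (fun x => f x + g x) (fun x => f x + g x) p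
      - gagK (fun x => f x + -g x) (fun x => f x + -g x) p) / 4 := by
  unfold gagK; ring

lemma HalfReg.integrable_gagK {f g : ℝ → ℝ} (hf : HalfReg f) (hg : HalfReg g) :
    Integrable (gagK f g) (muc.prod muc) := by
  rw [show gagK f g = _ from funext (gagK_polar f g)]
  exact ((hf.add hg).integrable_gagK_self.sub (hf.add hg.neg).integrable_gagK_self).div_const 4

/-- The Gagliardo form in Fourier variables. -/
lemma HalfReg.hasSum_gagK {f g : ℝ → ℝ} (hf : HalfReg f) (hg : HalfReg g) :
    HasSum (fun k : ℤ => 4 * π ^ 2 * ((k.natAbs : ℝ) * (fcR f k * (starRingEnd ℂ) (fcR g k)).re))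
      (∫ x, ∫ y, (f x - f y) * (g x - g y) / cd x y ^ 2 ∂muc ∂muc) := by
  have h0 : ∫ x, ∫ y, (f x - f y) * (g x - g y) / cd x y ^ 2 ∂muc ∂muc
      = ∫ p, gagK f g p ∂(muc.prod muc) :=
    (integral_prod _ (hf.integrable_gagK hg)).symm
  rw [h0, integral_congr_ae (Eventually.of_forall (gagK_polar f g)), integral_div,
    integral_sub (hf.add hg).integrable_gagK_self (hf.add hg.neg).integrable_gagK_self,
    (hf.add hg).integral_gagK_self, (hf.add hg.neg).integral_gagK_self]
  have := ((((summable_hHalfR (hf.add hg).fin).hasSum.mul_left (4 * π ^ 2)).sub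
    ((summable_hHalfR (hf.add hg.neg).fin).hasSum.mul_left (4 * π ^ 2)))).div_const 4
  refine Eq.subst (motive := fun z => HasSum z _) (funext fun k => ?_) this
  rw [fcR_add hf hg, fcR_add hf hg.neg, fcR_neg, ← Complex.normSq_eq_norm_sq,
    ← Complex.normSq_eq_norm_sq, Complex.normSq_add, Complex.normSq_add, Complex.normSq_neg,
    map_neg, mul_neg, Complex.neg_re]
  ring

lemma fcR_neg_freq (f : ℝ → ℝ) (k : ℤ) : fcR f (-k) = (starRingEnd ℂ) (fcR f k) := by
  unfold fcR
  have := fc_conj (fun x => (f x : ℂ)) (-k)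
  simpa using this

lemma integrable_ek (k : ℤ) : Integrable (ek k) muc := by
  simpa using integrable_mul_ek (integrable_const (1 : ℂ)) k

lemma ofReal_cos_eq (k : ℤ) (x : ℝ) :
    ((Real.cos (k * x) : ℝ) : ℂ) = (1 / 2) * (ek k x + ek (-k) x) := by
  rw [ek_eq, ek_eq]
  have : ((-k : ℤ) : ℝ) * x = -(k * x) := by push_cast; ring
  rw [this, Real.cos_neg, Real.sin_neg]
  push_cast; ring

lemma ofReal_sin_eq (k : ℤ) (x : ℝ) :
    ((Real.sin (k * x) : ℝ) : ℂ) = (-Complex.I / 2) * (ek k x + (-1) * ek (-k) x) := by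
  rw [ek_eq, ek_eq]
  have : ((-k : ℤ) : ℝ) * x = -(k * x) := by push_cast; ring
  rw [this, Real.cos_neg, Real.sin_neg]
  push_cast
  linear_combination (Complex.sin (k * x)) * Complex.I_sq

lemma fcR_cos (k l : ℤ) : fcR (fun x => Real.cos (k * x)) l
    = (1 / 2) * ((if l = k then 1 else 0) + if l = -k then 1 else 0) := by
  unfold fcR
  simp only [ofReal_cos_eq]
  rw [fc_const_mul, fc_add (integrable_ek _) (integrable_ek _), fc_ek, fc_ek]

lemma fcR_sin (k l : ℤ) : fcR (fun x => Real.sin (k * x)) l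
    = (-Complex.I / 2) * ((if l = k then 1 else 0) + (-1) * if l = -k then 1 else 0) := by
  unfold fcR
  simp only [ofReal_sin_eq]
  rw [fc_const_mul, fc_add (integrable_ek _) ((integrable_ek _).const_mul _), fc_const_mul,
    fc_ek, fc_ek]

lemma halfReg_of_support {f : ℝ → ℝ} (hc : Continuous f) (hp : Function.Periodic f (2 * π))
    (s : Finset ℤ) (hs : ∀ k ∉ s, fcR f k = 0) : HalfReg f := by
  refine ⟨hc.measurable, hp, ?_, ?_⟩
  · obtain ⟨C, hC⟩ := (isCompact_Icc (a := -π) (b := π)).exists_bound_of_continuousOn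
      hc.continuousOn
    refine memLp_of_bdd (by fun_prop) (C := C) ?_ 2
    filter_upwards [ae_restrict_mem (measurableSet_Ioc)] with x hx
    simpa using hC x (Set.Ioc_subset_Icc_self hx)
  · rw [hHalfR_eq_ofReal]
    · exact ENNReal.ofReal_ne_top
    · exact summable_of_ne_finset_zero (s := s) fun k hk => by simp [hs k hk]

lemma periodic_int_mul {g : ℝ → ℝ} (hg : Function.Periodic g (2 * π)) (k : ℤ) :
    Function.Periodic (fun x => g (k * x)) (2 * π) := by
  intro x
  simp only [mul_add]
  exact hg.int_mul k _

lemma halfReg_cos (k : ℤ) : HalfReg fun x => Real.cos (k * x) :=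
  halfReg_of_support (by fun_prop) (periodic_int_mul Real.cos_periodic k) {k, -k} fun l hl => by
    simp only [Finset.mem_insert, Finset.mem_singleton, not_or] at hl
    simp [fcR_cos, hl.1, hl.2]

lemma halfReg_sin (k : ℤ) : HalfReg fun x => Real.sin (k * x) :=
  halfReg_of_support (by fun_prop) (periodic_int_mul Real.sin_periodic k) {k, -k} fun l hl => by
    simp only [Finset.mem_insert, Finset.mem_singleton, not_or] at hl
    simp [fcR_sin, hl.1, hl.2]

lemma HalfReg.gagK_cos {f : ℝ → ℝ} (hf : HalfReg f) (k : ℤ) :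
    ∫ x, ∫ y, (f x - f y) * (Real.cos (k * x) - Real.cos (k * y)) / cd x y ^ 2 ∂muc ∂muc
      = 4 * π ^ 2 * (k.natAbs * (fcR f k).re) := by
  refine (hf.hasSum_gagK (halfReg_cos k)).unique ?_
  have h := (hasSum_ite_eq k (2 * π ^ 2 * (k.natAbs * (fcR f k).re))).add
    (hasSum_ite_eq (-k) (2 * π ^ 2 * (k.natAbs * (fcR f k).re)))
  convert h using 1
  · ext l
    rw [fcR_cos]
    split_ifs with h1 h2 h2
    · subst h1; norm_num; ring
    · subst h1; norm_num; ring
    · subst h2; rw [fcR_neg_freq]; norm_num; ring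
    · simp
  · ring

lemma HalfReg.gagK_sin {f : ℝ → ℝ} (hf : HalfReg f) (k : ℤ) :
    ∫ x, ∫ y, (f x - f y) * (Real.sin (k * x) - Real.sin (k * y)) / cd x y ^ 2 ∂muc ∂muc
      = -(4 * π ^ 2 * (k.natAbs * (fcR f k).im)) := by
  have h2c : (starRingEnd ℂ) (2 : ℂ) = 2 := Complex.conj_ofNat 2
  refine (hf.hasSum_gagK (halfReg_sin k)).unique ?_
  have h := (hasSum_ite_eq k (-(2 * π ^ 2 * (k.natAbs * (fcR f k).im)))).add
    (hasSum_ite_eq (-k) (-(2 * π ^ 2 * (k.natAbs * (fcR f k).im))))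
  convert h using 1
  · ext l
    rw [fcR_sin]
    split_ifs with h1 h2 h2
    · have : k = 0 := by omega
      subst this; simp [h1]
    · subst h1; simp [h2c]; norm_num; ring
    · subst h2; rw [fcR_neg_freq]; simp [h2c]; norm_num; ring
    · simp
  · ring

/-- Measurable periodic maps to the unit sphere with finite `Ḣ^{1/2}` seminorm. -/
structure SphereReg {n : ℕ} (u : ℝ → E n) : Prop where
  meas : Measurable u
  per : Function.Periodic u (2 * π)
  sphere : ∀ᵐ x ∂muc, ‖u x‖ = 1
  fin : hHalf u ≠ ⊤

lemma measurable_coord {α : Type*} [MeasurableSpace α] {n : ℕ} {u : α → E n} (hu : Measurable u)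
    (i : Fin n) : Measurable fun x => u x i := by
  fun_prop

lemma SphereReg.sum_sq {n : ℕ} {u : ℝ → E n} (hu : SphereReg u) :
    ∀ᵐ x ∂muc, ∑ i, u x i ^ 2 = 1 := by
  filter_upwards [hu.sphere] with x hx
  have := EuclideanSpace.real_norm_sq_eq (u x)
  rw [hx] at this
  linarith

lemma SphereReg.abs_le {n : ℕ} {u : ℝ → E n} (hu : SphereReg u) (i : Fin n) :
    ∀ᵐ x ∂muc, ‖((u x i : ℝ) : ℂ)‖ ≤ 1 := by
  filter_upwards [hu.sphere] with x hx
  rw [Complex.norm_real, ← hx]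
  exact PiLp.norm_apply_le (u x) i

lemma SphereReg.half {n : ℕ} {u : ℝ → E n} (hu : SphereReg u) (i : Fin n) :
    HalfReg (fun x => u x i) where
  meas := measurable_coord hu.meas i
  per := fun x => by simp only [hu.per x]
  mem := memLp_of_bdd
    (Complex.measurable_ofReal.comp (measurable_coord hu.meas i)).aestronglyMeasurable
    (hu.abs_le i) 2
  fin := by
    have := hu.fin
    rw [hHalf_eq_sum, ENNReal.sum_ne_top] at this
    exact this i (Finset.mem_univ i)

lemma gagl_nonneg {n : ℕ} (u : ℝ → E n) (x : ℝ) : 0 ≤ gagl u x :=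
  integral_nonneg fun _ => div_nonneg (Finset.sum_nonneg fun _ _ => sq_nonneg _) (sq_nonneg _)

lemma gagl_eq {n : ℕ} (u : ℝ → E n) :
    gagl u
      = fun x => ∫ y, (fun p => ∑ i, gagK (fun x => u x i) (fun x => u x i) p) (x, y) ∂muc := by
  ext x
  unfold gagl gagK
  simp only [Finset.sum_div, sq (u _ _ - u _ _)]

lemma SphereReg.integrable_sum_gagK {n : ℕ} {u : ℝ → E n} (hu : SphereReg u) :
    Integrable (fun p => ∑ i, gagK (fun x => u x i) (fun x => u x i) p) (muc.prod muc) :=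
  integrable_finsetSum _ fun i _ => (hu.half i).integrable_gagK_self

lemma SphereReg.integrable_gagl {n : ℕ} {u : ℝ → E n} (hu : SphereReg u) :
    Integrable (gagl u) muc := by
  rw [gagl_eq]
  exact hu.integrable_sum_gagK.integral_prod_left

lemma SphereReg.integrable_gagl_mul {n : ℕ} {u : ℝ → E n} (hu : SphereReg u) (i : Fin n) :
    Integrable (fun x => gagl u x * u x i) muc := by
  refine hu.integrable_gagl.mul_bdd (c := 1) ?_ ?_
  · exact (measurable_coord hu.meas i).aestronglyMeasurable
  · filter_upwards [hu.abs_le i] with x hx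
    simpa using hx

lemma SphereReg.integral_gagl {n : ℕ} {u : ℝ → E n} (hu : SphereReg u) :
    ENNReal.ofReal (∫ x, gagl u x ∂muc) = ENNReal.ofReal (4 * π ^ 2) * hHalf u := by
  have h : ∫ x, gagl u x ∂muc
      = ∑ i, ∫ p, gagK (fun x => u x i) (fun x => u x i) p ∂(muc.prod muc) := by
    rw [gagl_eq, ← integral_finsetSum _ fun i _ => (hu.half i).integrable_gagK_self,
      integral_prod _ hu.integrable_sum_gagK]
  rw [h, hHalf_eq_sum, Finset.mul_sum, ENNReal.ofReal_sum_of_nonneg]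
  · refine Finset.sum_congr rfl fun i _ => ?_
    rw [(hu.half i).integral_gagK_self, hHalfR_eq_ofReal (summable_hHalfR (hu.half i).fin),
      ENNReal.ofReal_mul (by positivity)]
  · exact fun i _ => integral_nonneg fun p => gagK_self_nonneg _ p

lemma sum_mul_smul_single {n : ℕ} (c : Fin n → ℝ) (i : Fin n) (a : ℝ) :
    ∑ j, c j * (a • EuclideanSpace.single i (1 : ℝ) : E n) j = c i * a := by
  rw [Finset.sum_eq_single i]
  · simp
  · intro j _ hj; simp [hj]
  · simp

lemma pairing_single {n : ℕ} (u : ℝ → E n) (i : Fin n) (η : ℝ) (ψ : ℝ → ℝ) :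
    pairing u (fun x => (η * ψ x) • EuclideanSpace.single i (1 : ℝ))
      = η * ∫ x, ∫ y, (u x i - u y i) * (ψ x - ψ y) / cd x y ^ 2 ∂muc ∂muc := by
  unfold pairing
  rw [← integral_const_mul]
  refine integral_congr_ae (Eventually.of_forall fun x => ?_)
  simp only
  rw [← integral_const_mul]
  refine integral_congr_ae (Eventually.of_forall fun y => ?_)
  have : ∀ j, (u x j - u y j) * (((η * ψ x) • EuclideanSpace.single i (1 : ℝ) : E n) j
      - ((η * ψ y) • EuclideanSpace.single i (1 : ℝ) : E n) j)
      = (u x j - u y j) * ((η * ψ x - η * ψ y) • EuclideanSpace.single i (1 : ℝ) : E n) j := by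
    intro j
    simp only [PiLp.smul_apply, smul_eq_mul]
    ring
  simp only [this]
  rw [sum_mul_smul_single (fun j => u x j - u y j)]
  ring

lemma isSTTest_single {n : ℕ} (i : Fin n) {η ψ : ℝ → ℝ} (hη : ContDiff ℝ (⊤ : ℕ∞) η)
    (hc : HasCompactSupport η) (hs : tsupport η ⊆ Set.Ioi 0) (hψ : ContDiff ℝ (⊤ : ℕ∞) ψ)
    (hp : Function.Periodic ψ (2 * π)) :
    IsSTTest n (fun t x => (η t * ψ x) • EuclideanSpace.single i (1 : ℝ)) where
  smooth := by
    have h1 : ContDiff ℝ (⊤ : ℕ∞) fun p : ℝ × ℝ => η p.1 * ψ p.2 :=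
      (hη.comp contDiff_fst).mul (hψ.comp contDiff_snd)
    exact h1.smul contDiff_const
  periodic := fun t x => by simp only [hp x]
  suppTime := by
    obtain ⟨b, hb⟩ := hc.isCompact.bddAbove
    rcases (tsupport η).eq_empty_or_nonempty with he | hne
    · refine ⟨1, 1, one_pos, fun t _ x => ?_⟩
      have : η t = 0 := image_eq_zero_of_notMem_tsupport (by simp [he])
      simp [this]
    · obtain ⟨a, ha⟩ := hc.isCompact.exists_isLeast hne
      refine ⟨a, b, hs ha.1, fun t ht x => ?_⟩
      have : η t = 0 := image_eq_zero_of_notMem_tsupport fun h => ht ⟨ha.2 h, hb h⟩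
      simp [this]

section

variable {n : ℕ} {u₀ : ℝ → E n} {u w : ℝ → ℝ → E n}

lemma IsEnergySolAux.sphereReg (h : IsEnergySolAux n u₀ u w) :
    ∀ᵐ t ∂(volume.restrict (Set.Ioi (0 : ℝ))), SphereReg (u t) := by
  obtain ⟨M, hM, hE⟩ := h.energyBdd
  filter_upwards [Measure.ae_ae_of_ae_prod h.sphere, hE] with t h1 h2
  exact ⟨h.meas.of_uncurry_left, h.periodic t, h1, (h2.trans_lt hM).ne⟩

lemma ae_Ioc {p : ℝ → Prop} (h : ∀ᵐ t ∂(volume.restrict (Set.Ioi (0 : ℝ))), p t) (T : ℝ) :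
    ∀ᵐ t ∂(volume.restrict (Set.Ioc (0 : ℝ) T)), p t :=
  ae_restrict_of_ae_restrict_of_subset Set.Ioc_subset_Ioi_self h

lemma IsEnergySolAux.ae_abs_le (h : IsEnergySolAux n u₀ u w) (T : ℝ) (i : Fin n) :
    ∀ᵐ p ∂((volume.restrict (Set.Ioc (0 : ℝ) T)).prod muc), ‖u p.1 p.2 i‖ ≤ 1 := by
  have hs : (volume.restrict (Set.Ioc (0 : ℝ) T)).prod muc ≪ STmeasure :=
    Measure.AbsolutelyContinuous.prod
      (Measure.absolutelyContinuous_of_le (Measure.restrict_mono Set.Ioc_subset_Ioi_self le_rfl))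
      Measure.AbsolutelyContinuous.rfl
  filter_upwards [hs.ae_le h.sphere] with p hp
  rw [← hp]
  exact PiLp.norm_apply_le (u p.1 p.2) i

lemma IsEnergySolAux.integrable_u (h : IsEnergySolAux n u₀ u w) (T : ℝ) (i : Fin n) :
    Integrable (fun p : ℝ × ℝ => u p.1 p.2 i) ((volume.restrict (Set.Ioc (0 : ℝ) T)).prod muc) :=
  have hm : Measurable fun p : ℝ × ℝ => u p.1 p.2 i := measurable_coord h.meas i
  Integrable.of_bound hm.aestronglyMeasurable 1 (h.ae_abs_le T i)

lemma IsEnergySolAux.memLp_w (h : IsEnergySolAux n u₀ u w) (T : ℝ) (i : Fin n) :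
    MemLp (fun p : ℝ × ℝ => w p.1 p.2 i) 2 ((volume.restrict (Set.Ioc (0 : ℝ) T)).prod muc) := by
  have hm : Measurable fun p : ℝ × ℝ => w p.1 p.2 i := measurable_coord h.wMeas i
  refine ⟨hm.aestronglyMeasurable, ?_⟩
  rw [eLpNorm_lt_top_iff_lintegral_rpow_enorm_lt_top (by norm_num) (by norm_num)]
  refine lt_of_le_of_lt ?_ h.wL2
  have hm2 : Measurable fun p : ℝ × ℝ => (‖w p.1 p.2‖₊ : ℝ≥0∞) ^ 2 := by
    have := h.wMeas.nnnorm.coe_nnreal_ennreal.pow_const 2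
    exact this
  calc _ ≤ ∫⁻ p, (‖w p.1 p.2‖₊ : ℝ≥0∞) ^ 2 ∂((volume.restrict (Set.Ioc (0 : ℝ) T)).prod muc) := by
        refine lintegral_mono fun p => ?_
        simp only [ENNReal.toReal_ofNat, ENNReal.rpow_ofNat]
        gcongr
        rw [enorm_eq_nnnorm]
        exact_mod_cast PiLp.norm_apply_le (w p.1 p.2) i
    _ = ∫⁻ t in Set.Ioc 0 T, ∫⁻ x in circ, (‖w t x‖₊ : ℝ≥0∞) ^ 2 := by
        rw [lintegral_prod _ hm2.aemeasurable]
    _ ≤ _ := lintegral_mono_set Set.Ioc_subset_Ioi_self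

lemma IsEnergySolAux.measurable_gagl (h : IsEnergySolAux n u₀ u w) :
    Measurable fun p : ℝ × ℝ => gagl (u p.1) p.2 := by
  unfold gagl
  refine StronglyMeasurable.measurable ?_
  refine StronglyMeasurable.integral_prod_right
    (f := fun (p : ℝ × ℝ) y => (∑ i, (u p.1 p.2 i - u p.1 y i) ^ 2) / cd p.2 y ^ 2) ?_
  refine Measurable.stronglyMeasurable ?_
  have h1 : ∀ i, Measurable fun q : (ℝ × ℝ) × ℝ => u q.1.1 q.1.2 i := fun i =>
    (measurable_coord h.meas i).comp measurable_fst
  have h2 : ∀ i, Measurable fun q : (ℝ × ℝ) × ℝ => u q.1.1 q.2 i := fun i =>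
    (measurable_coord h.meas i).comp (measurable_fst.fst.prodMk measurable_snd)
  simp only [Function.uncurry_def, cd]
  refine Measurable.div (Finset.measurable_sum _ fun i _ => ((h1 i).sub (h2 i)).pow_const 2) ?_
  fun_prop

lemma IsEnergySolAux.integrable_gagl (h : IsEnergySolAux n u₀ u w) (T : ℝ) :
    Integrable (fun p : ℝ × ℝ => gagl (u p.1) p.2)
      ((volume.restrict (Set.Ioc (0 : ℝ) T)).prod muc) := by
  refine ⟨h.measurable_gagl.aestronglyMeasurable, ?_⟩
  rw [hasFiniteIntegral_iff_ofReal (Eventually.of_forall fun p => gagl_nonneg _ _),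
    lintegral_prod _ h.measurable_gagl.ennreal_ofReal.aemeasurable]
  obtain ⟨M, hM, hE⟩ := h.energyBdd
  calc _ ≤ ∫⁻ t in Set.Ioc 0 T, ENNReal.ofReal (4 * π ^ 2) * M := by
        refine lintegral_mono_ae ?_
        filter_upwards [ae_Ioc h.sphereReg T, ae_Ioc hE T] with t h1 h2
        rw [← ofReal_integral_eq_lintegral_ofReal h1.integrable_gagl
          (Eventually.of_forall fun p => gagl_nonneg _ _), h1.integral_gagl]
        gcongr
    _ < ⊤ := by
        simp only [lintegral_const]
        exact ENNReal.mul_lt_top (ENNReal.mul_lt_top ENNReal.ofReal_lt_top hM) (by simp)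

lemma IsEnergySolAux.integrable_gagl_mul (h : IsEnergySolAux n u₀ u w) (T : ℝ) (i : Fin n) :
    Integrable (fun p : ℝ × ℝ => gagl (u p.1) p.2 * u p.1 p.2 i)
      ((volume.restrict (Set.Ioc (0 : ℝ) T)).prod muc) := by
  have hm : Measurable fun p : ℝ × ℝ => u p.1 p.2 i := measurable_coord h.meas i
  refine (h.integrable_gagl T).mul_bdd (c := 1) hm.aestronglyMeasurable ?_
  have hs : (volume.restrict (Set.Ioc (0 : ℝ) T)).prod muc ≪ STmeasure :=
    Measure.AbsolutelyContinuous.prod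
      (Measure.absolutelyContinuous_of_le (Measure.restrict_mono Set.Ioc_subset_Ioi_self le_rfl))
      Measure.AbsolutelyContinuous.rfl
  filter_upwards [hs.ae_le h.sphere] with p hp
  rw [← hp]
  exact PiLp.norm_apply_le (u p.1 p.2) i

end

lemma integrableOn_slice {G : ℝ × ℝ → ℝ} {T : ℝ}
    (hG : Integrable G ((volume.restrict (Set.Ioc (0 : ℝ) T)).prod muc)) {ψ : ℝ → ℝ}
    (hψ : Continuous ψ) (hb : ∀ x, |ψ x| ≤ 1) :
    IntegrableOn (fun t => ∫ x, G (t, x) * ψ x ∂muc) (Set.Ioc 0 T) := by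
  have : Integrable (fun p : ℝ × ℝ => G p * ψ p.2)
      ((volume.restrict (Set.Ioc (0 : ℝ) T)).prod muc) :=
    hG.mul_bdd (c := 1) (hψ.comp continuous_snd).aestronglyMeasurable
      (Eventually.of_forall fun p => hb p.2)
  exact this.integral_prod_left

lemma integrableOn_compactSupport_mul {η a : ℝ → ℝ} (hη : Continuous η)
    (hc : HasCompactSupport η) (ha : ∀ T, IntegrableOn a (Set.Ioc 0 T)) :
    IntegrableOn (fun t => η t * a t) (Set.Ioi 0) := by
  obtain ⟨T, hT⟩ := hc.isCompact.bddAbove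
  obtain ⟨C, hC⟩ := hc.exists_bound_of_continuous hη
  have h1 : IntegrableOn (fun t => η t * a t) (Set.Ioc 0 T) :=
    (ha T).bdd_mul (c := C) hη.aestronglyMeasurable (Eventually.of_forall hC)
  refine h1.of_forall_sdiff_eq_zero measurableSet_Ioi fun t ht => ?_
  have : η t = 0 := image_eq_zero_of_notMem_tsupport fun h => ht.2 ⟨ht.1, hT h⟩
  simp [this]

lemma ae_eq_zero_of_integral_test {g : ℝ → ℝ} (hg : ∀ T, IntegrableOn g (Set.Ioc 0 T))
    (h : ∀ η : ℝ → ℝ, ContDiff ℝ (⊤ : ℕ∞) η → HasCompactSupport η → tsupport η ⊆ Set.Ioi 0 →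
      ∫ t in Set.Ioi 0, η t * g t = 0) :
    ∀ᵐ t ∂(volume.restrict (Set.Ioi (0 : ℝ))), g t = 0 := by
  rw [ae_restrict_iff' measurableSet_Ioi]
  refine isOpen_Ioi.ae_eq_zero_of_integral_contDiff_smul_eq_zero ?_ fun η h1 h2 h3 => ?_
  · intro t ht
    refine ⟨Set.Ioc 0 (t + 1), ?_, hg _⟩
    exact mem_nhdsWithin_of_mem_nhds (Ioc_mem_nhds ht (lt_add_one t))
  · rw [← h η h1 h2 h3, ← integral_indicator measurableSet_Ioi]
    refine integral_congr_ae (Eventually.of_forall fun t => ?_)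
    by_cases ht : t ∈ Set.Ioi (0 : ℝ)
    · simp [ht]
    · have : η t = 0 := image_eq_zero_of_notMem_tsupport fun h => ht (h3 h)
      simp [ht, this]

section

variable {n : ℕ} {u₀ : ℝ → E n} {u w : ℝ → ℝ → E n}

lemma IsEnergySolAux.flow_slice (h : IsEnergySolAux n u₀ u w) (i : Fin n) {ψ : ℝ → ℝ} {κ : ℝ}
    (hψ : ContDiff ℝ (⊤ : ℕ∞) ψ) (hp : Function.Periodic ψ (2 * π)) (hb : ∀ x, |ψ x| ≤ 1)
    (hpair : ∀ f, HalfReg f →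
      ∫ x, ∫ y, (f x - f y) * (ψ x - ψ y) / cd x y ^ 2 ∂muc ∂muc = κ * ∫ x, f x * ψ x ∂muc) :
    ∀ᵐ t ∂(volume.restrict (Set.Ioi (0 : ℝ))),
      (∫ x, w t x i * ψ x ∂muc) + κ * (∫ x, u t x i * ψ x ∂muc)
        - ∫ x, gagl (u t) x * u t x i * ψ x ∂muc = 0 := by
  have I1 : ∀ T, IntegrableOn (fun t => ∫ x, w t x i * ψ x ∂muc) (Set.Ioc 0 T) := fun T =>
    integrableOn_slice ((h.memLp_w T i).integrable one_le_two) hψ.continuous hb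
  have I2 : ∀ T, IntegrableOn (fun t => κ * ∫ x, u t x i * ψ x ∂muc) (Set.Ioc 0 T) := fun T =>
    (integrableOn_slice (h.integrable_u T i) hψ.continuous hb).const_mul κ
  have I3 : ∀ T, IntegrableOn (fun t => ∫ x, gagl (u t) x * u t x i * ψ x ∂muc) (Set.Ioc 0 T) :=
    fun T => integrableOn_slice (h.integrable_gagl_mul T i) hψ.continuous hb
  refine ae_eq_zero_of_integral_test (fun T => ((I1 T).add (I2 T)).sub (I3 T)) ?_
  intro η h1 h2 h3
  have hf := h.flow _ (isSTTest_single i h1 h2 h3 hψ hp)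
  simp only [pairing_single, sum_mul_smul_single (fun j => u _ _ j),
    sum_mul_smul_single (fun j => w _ _ j)] at hf
  have e1 : ∀ t, ∫ x in circ, w t x i * (η t * ψ x) = η t * ∫ x, w t x i * ψ x ∂muc := fun t => by
    rw [← integral_const_mul]; congr 1; ext x; ring
  have e3 : ∀ t, ∫ x in circ, gagl (u t) x * (u t x i * (η t * ψ x))
      = η t * ∫ x, gagl (u t) x * u t x i * ψ x ∂muc := fun t => by
    rw [← integral_const_mul]; congr 1; ext x; ring
  have e2 : ∫ t in Set.Ioi 0, η t *
      ∫ x, ∫ y, (u t x i - u t y i) * (ψ x - ψ y) / cd x y ^ 2 ∂muc ∂muc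
      = ∫ t in Set.Ioi 0, η t * (κ * ∫ x, u t x i * ψ x ∂muc) := by
    refine integral_congr_ae ?_
    filter_upwards [h.sphereReg] with t ht
    rw [hpair _ (ht.half i)]
  simp only [e1, e3] at hf
  rw [e2] at hf
  have J1 := integrableOn_compactSupport_mul h1.continuous h2 I1
  have J2 := integrableOn_compactSupport_mul h1.continuous h2 I2
  have J3 := integrableOn_compactSupport_mul h1.continuous h2 I3
  simp only [mul_sub, mul_add]
  have J12 : IntegrableOn (fun t => η t * (∫ x, w t x i * ψ x ∂muc)
      + η t * (κ * ∫ x, u t x i * ψ x ∂muc)) (Set.Ioi 0) := J1.add J2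
  rw [integral_sub J12 J3, integral_add J1 J2, hf, sub_self]

end

lemma ek_eq_cos_sub (k : ℤ) (x : ℝ) :
    ek (-k) x = ((Real.cos (k * x) : ℝ) : ℂ) - ((Real.sin (k * x) : ℝ) : ℂ) * Complex.I := by
  have : ((-k : ℤ) : ℝ) * x = -(k * x) := by push_cast; ring
  rw [ek_eq, this, Real.cos_neg, Real.sin_neg]
  push_cast; ring

lemma fcR_eq_cos_sin {f : ℝ → ℝ} (hf : Integrable f muc) (k : ℤ) :
    ((2 * π : ℝ) : ℂ) * fcR f k = ((∫ x, f x * Real.cos (k * x) ∂muc : ℝ) : ℂ)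
      - ((∫ x, f x * Real.sin (k * x) ∂muc : ℝ) : ℂ) * Complex.I := by
  have hc : Integrable (fun x => ((f x * Real.cos (k * x) : ℝ) : ℂ)) muc :=
    (hf.mul_bdd (c := 1) (by fun_prop)
      (Eventually.of_forall fun x => Real.abs_cos_le_one _)).ofReal
  have hs : Integrable (fun x => ((f x * Real.sin (k * x) : ℝ) : ℂ)) muc :=
    (hf.mul_bdd (c := 1) (by fun_prop)
      (Eventually.of_forall fun x => Real.abs_sin_le_one _)).ofReal
  rw [fcR, fc_eq, ← mul_assoc, ← Complex.ofReal_mul, mul_one_div_cancel (by positivity),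
    Complex.ofReal_one, one_mul, ← integral_complex_ofReal, ← integral_complex_ofReal,
    ← integral_mul_const,
    ← integral_sub hc (hs.mul_const _)]
  refine integral_congr_ae (Eventually.of_forall fun x => ?_)
  simp only [ek_eq_cos_sub]
  push_cast; ring

lemma HalfReg.integrable {f : ℝ → ℝ} (hf : HalfReg f) : Integrable f muc := by
  simpa using (MemLp.int1 hf.mem).re

lemma HalfReg.pair_cos {f : ℝ → ℝ} (hf : HalfReg f) (k : ℤ) :
    ∫ x, ∫ y, (f x - f y) * (Real.cos (k * x) - Real.cos (k * y)) / cd x y ^ 2 ∂muc ∂muc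
      = 2 * π * k.natAbs * ∫ x, f x * Real.cos (k * x) ∂muc := by
  have h := congrArg Complex.re (fcR_eq_cos_sin hf.integrable k)
  rw [Complex.re_ofReal_mul] at h
  simp only [Complex.sub_re, Complex.ofReal_re, Complex.re_ofReal_mul, Complex.I_re, mul_zero,
    sub_zero] at h
  rw [hf.gagK_cos, ← h]; ring

lemma HalfReg.pair_sin {f : ℝ → ℝ} (hf : HalfReg f) (k : ℤ) :
    ∫ x, ∫ y, (f x - f y) * (Real.sin (k * x) - Real.sin (k * y)) / cd x y ^ 2 ∂muc ∂muc
      = 2 * π * k.natAbs * ∫ x, f x * Real.sin (k * x) ∂muc := by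
  have h := congrArg Complex.im (fcR_eq_cos_sin hf.integrable k)
  rw [Complex.im_ofReal_mul] at h
  simp only [Complex.sub_im, Complex.ofReal_im, Complex.im_ofReal_mul, Complex.I_im, mul_one,
    zero_sub] at h
  rw [hf.gagK_sin, ← neg_eq_iff_eq_neg.mpr h]; ring

section

variable {n : ℕ} {u₀ : ℝ → E n} {u w : ℝ → ℝ → E n}

lemma IsEnergySolAux.memLp_w_slice (h : IsEnergySolAux n u₀ u w) :
    ∀ᵐ t ∂(volume.restrict (Set.Ioi (0 : ℝ))), ∀ i, MemLp (fun x => w t x i) 2 muc := by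
  have hm2 : Measurable fun p : ℝ × ℝ => (‖w p.1 p.2‖₊ : ℝ≥0∞) ^ 2 :=
    h.wMeas.nnnorm.coe_nnreal_ennreal.pow_const 2
  filter_upwards [ae_lt_top hm2.lintegral_prod_right h.wL2.ne] with t ht i
  refine ⟨(measurable_coord h.wMeas.of_uncurry_left i).aestronglyMeasurable, ?_⟩
  rw [eLpNorm_lt_top_iff_lintegral_rpow_enorm_lt_top (by norm_num) (by norm_num)]
  refine lt_of_le_of_lt (lintegral_mono fun x => ?_) ht
  simp only [ENNReal.toReal_ofNat, ENNReal.rpow_ofNat]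
  gcongr
  rw [enorm_eq_nnnorm]
  exact_mod_cast PiLp.norm_apply_le (w t x) i

/-- The flow equation on almost every time slice, in Fourier variables. -/
lemma IsEnergySolAux.fourier_eq (h : IsEnergySolAux n u₀ u w) :
    ∀ᵐ t ∂(volume.restrict (Set.Ioi (0 : ℝ))), ∀ (i : Fin n) (k : ℤ),
      fcR (fun x => w t x i) k + ((2 * π * k.natAbs : ℝ) : ℂ) * fcR (fun x => u t x i) k
        = fcR (fun x => gagl (u t) x * u t x i) k := by
  have hc : ∀ᵐ t ∂(volume.restrict (Set.Ioi (0 : ℝ))), ∀ (i : Fin n) (k : ℤ), _ :=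
    ae_all_iff.mpr fun i => ae_all_iff.mpr fun k =>
      h.flow_slice i (ψ := fun x => Real.cos (k * x)) (κ := 2 * π * k.natAbs) (by fun_prop)
        (periodic_int_mul Real.cos_periodic k) (fun x => Real.abs_cos_le_one _)
        fun f hf => hf.pair_cos k
  have hs : ∀ᵐ t ∂(volume.restrict (Set.Ioi (0 : ℝ))), ∀ (i : Fin n) (k : ℤ), _ :=
    ae_all_iff.mpr fun i => ae_all_iff.mpr fun k =>
      h.flow_slice i (ψ := fun x => Real.sin (k * x)) (κ := 2 * π * k.natAbs) (by fun_prop)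
        (periodic_int_mul Real.sin_periodic k) (fun x => Real.abs_sin_le_one _)
        fun f hf => hf.pair_sin k
  filter_upwards [hc, hs, h.sphereReg, h.memLp_w_slice] with t h1 h2 h3 h4 i k
  have hpi : ((2 * π : ℝ) : ℂ) ≠ 0 := by exact_mod_cast Real.two_pi_pos.ne'
  apply mul_left_cancel₀ hpi
  have c1 := congrArg (fun r : ℝ => (r : ℂ)) (h1 i k)
  have c2 := congrArg (fun r : ℝ => (r : ℂ)) (h2 i k)
  rw [mul_add, mul_left_comm, fcR_eq_cos_sin ((h4 i).integrable one_le_two),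
    fcR_eq_cos_sin (h3.half i).integrable, fcR_eq_cos_sin (h3.integrable_gagl_mul i)]
  push_cast at c1 c2 ⊢
  linear_combination c1 - Complex.I * c2

end

lemma summable_reflect {g : ℤ → ℝ} (hg : Summable g) (m : ℤ) : Summable fun k => g (m - k) :=
  (Equiv.subLeft m).summable_iff.mpr hg

lemma summable_half_conv {a b : ℤ → ℂ} (ha : Summable fun k => (k.natAbs : ℝ) * ‖a k‖ ^ 2)
    (hb : Summable fun k => ‖b k‖ ^ 2) (hb' : Summable fun k => (k.natAbs : ℝ) * ‖b k‖ ^ 2)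
    (m : ℤ) : Summable fun k => ((m - k).natAbs : ℝ) * (‖a (m - k)‖ * ‖b k‖) := by
  refine Summable.of_nonneg_of_le (fun k => by positivity) (fun k => ?_)
    (((summable_reflect ha m).add (hb'.add (hb.mul_left (m.natAbs : ℝ)))))
  have h1 : ((m - k).natAbs : ℝ) ≤ k.natAbs + m.natAbs := by
    have : (m - k).natAbs ≤ k.natAbs + m.natAbs := by omega
    exact_mod_cast this
  have h2 : ‖a (m - k)‖ * ‖b k‖ ≤ ‖a (m - k)‖ ^ 2 + ‖b k‖ ^ 2 := by
    nlinarith [sq_nonneg (‖a (m - k)‖ - ‖b k‖), sq_nonneg (‖a (m - k)‖), sq_nonneg (‖b k‖)]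
  have h3 : ((m - k).natAbs : ℝ) * ‖b k‖ ^ 2 ≤ (k.natAbs + m.natAbs) * ‖b k‖ ^ 2 := by gcongr
  have h4 : ((m - k).natAbs : ℝ) * (‖a (m - k)‖ * ‖b k‖)
      ≤ (m - k).natAbs * (‖a (m - k)‖ ^ 2 + ‖b k‖ ^ 2) := by gcongr
  linarith

lemma HalfReg.hasSum_sq {f : ℝ → ℝ} (hf : HalfReg f) :
    Summable fun k => ‖fcR f k‖ ^ 2 := (hasSum_fc_sq hf.mem).summable

/-- A time slice of a solution: `f + (-Δ)^{1/2} u = l u` in Fourier variables. -/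
structure SliceSol {n : ℕ} (u : ℝ → E n) (l : ℝ → ℝ) (f : Fin n → ℝ → ℝ) : Prop where
  reg : SphereReg u
  mem : ∀ i, MemLp (fun x => (f i x : ℂ)) 2 muc
  int : ∀ i, Integrable (fun x => l x * u x i) muc
  eq : ∀ (i : Fin n) (k : ℤ), fcR (f i) k
    + ((2 * π * k.natAbs : ℝ) : ℂ) * fcR (fun x => u x i) k = fcR (fun x => l x * u x i) k

section

variable {n : ℕ} {u : ℝ → E n} {l : ℝ → ℝ} {f : Fin n → ℝ → ℝ}

lemma SphereReg.aesm (h : SphereReg u) (i : Fin n) :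
    AEStronglyMeasurable (fun x => ((u x i : ℝ) : ℂ)) muc := (h.half i).mem.1

lemma SliceSol.hasSum_lap_conv (h : SliceSol u l f) (i j : Fin n) (m : ℤ) :
    HasSum (fun k : ℤ => ((2 * π * (m - k).natAbs : ℝ) : ℂ) *
        (fcR (fun x => u x i) (m - k) * fcR (fun x => u x j) k))
      (fc (fun x => ((l x * u x i : ℝ) : ℂ) * ((u x j : ℝ) : ℂ)) m
        - fc (fun x => ((u x j : ℝ) : ℂ) * ((f i x : ℝ) : ℂ)) m) := by
  have h1 := fc_mul (h.reg.half j).mem (h.mem i) m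
  have hB := summable_half_conv (summable_hHalfR (h.reg.half i).fin) (h.reg.half j).hasSum_sq
    (summable_hHalfR (h.reg.half j).fin) m
  have hF : ∀ k, fcR (fun x => u x j) k * fcR (fun x => l x * u x i) (m - k)
      = fcR (fun x => u x j) k * fcR (f i) (m - k) + ((2 * π * (m - k).natAbs : ℝ) : ℂ) *
        (fcR (fun x => u x i) (m - k) * fcR (fun x => u x j) k) := fun k => by
    rw [← h.eq i (m - k)]; ring
  have hs : Summable fun k =>
      ‖fcR (fun x => u x j) k * fcR (fun x => l x * u x i) (m - k)‖ := by
    refine Summable.of_nonneg_of_le (fun k => norm_nonneg _) (fun k => ?_)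
      (h1.summable.norm.add (hB.mul_left (2 * π)))
    rw [hF]
    refine (norm_add_le _ _).trans (add_le_add le_rfl (le_of_eq ?_))
    rw [norm_mul, norm_mul, Complex.norm_real, Real.norm_of_nonneg (by positivity)]
    ring
  have h2 := fc_mul_of_summable (F := fun x => ((l x * u x i : ℝ) : ℂ)) (h.int i).ofReal
    (h.reg.aesm j) (h.reg.abs_le j) hs
  have h3 := hs.of_norm.hasSum
  rw [show (∑' k, fcR (fun x => u x j) k * fcR (fun x => l x * u x i) (m - k)) = _ from h2.symm]
    at h3
  refine Eq.subst (motive := fun z => HasSum z _) (funext fun k => ?_) (h3.sub h1)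
  rw [hF]
  exact add_sub_cancel_left _ _

/-- The conservation law: `u ∧ (-Δ)^{1/2} u` is controlled by `u ∧ f`. -/
lemma SliceSol.commutator (h : SliceSol u l f) (i j : Fin n) (m : ℤ) :
    HasSum (fun k : ℤ => ((2 * π * (k.natAbs - (m - k).natAbs) : ℝ) : ℂ) *
        (fcR (fun x => u x i) (m - k) * fcR (fun x => u x j) k))
      (fc (fun x => ((u x j : ℝ) : ℂ) * ((f i x : ℝ) : ℂ)) m
        - fc (fun x => ((u x i : ℝ) : ℂ) * ((f j x : ℝ) : ℂ)) m) := by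
  have h1 := h.hasSum_lap_conv i j m
  have h2 := (Equiv.subLeft m).hasSum_iff.mpr (h.hasSum_lap_conv j i m)
  have e : fc (fun x => ((l x * u x i : ℝ) : ℂ) * ((u x j : ℝ) : ℂ)) m
      = fc (fun x => ((l x * u x j : ℝ) : ℂ) * ((u x i : ℝ) : ℂ)) m := by
    congr 1; ext x; push_cast; ring
  have h3 := h2.sub h1
  rw [e, sub_sub_sub_cancel_left] at h3
  refine Eq.subst (motive := fun z => HasSum z _) (funext fun k => ?_) h3
  simp only [Function.comp_apply, Equiv.subLeft_apply, sub_sub_cancel]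
  push_cast; ring

end

lemma ofReal_norm_le_of_hasSum {ι : Type*} {g : ι → ℂ} {s : ℂ} (h : HasSum g s) {r : ι → ℝ}
    (hr : ∀ k, ‖g k‖ ≤ r k) : ENNReal.ofReal ‖s‖ ≤ ∑' k, ENNReal.ofReal (r k) := by
  have h0 : ∀ k, 0 ≤ r k := fun k => (norm_nonneg _).trans (hr k)
  by_cases hs : ∑' k, ENNReal.ofReal (r k) = ⊤
  · rw [hs]; exact le_top
  · have hs' := summable_of_tsum_ofReal_ne_top h0 hs
    rw [← ENNReal.ofReal_tsum_of_nonneg h0 hs', ← h.tsum_eq]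
    exact ENNReal.ofReal_le_ofReal (tsum_of_norm_bounded hs'.hasSum hr)

lemma lw_le_self (N : ℕ) {x : ℝ} (hx : 0 ≤ x) : lw N x ≤ x := by
  refine le_of_sq_le_sq ?_ hx
  rw [lw_sq N hx, sq]
  gcongr
  exact min_le_left _ _

/-- Sum of the moduli of the Fourier coefficients of the components. -/
def cSum {n : ℕ} (u : ℝ → E n) (k : ℤ) : ℝ := ∑ i, ‖fcR (fun x => u x i) k‖

/-- The commutator majorant. -/
def commP {n : ℕ} (N : ℕ) (u : ℝ → E n) (m : ℤ) : ℝ≥0∞ :=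
  ∑' a : ℤ, ENNReal.ofReal (min (lwz N a) (lwz N (m - a)) * (cSum u a * cSum u (m - a)))

section

variable {n : ℕ} {u : ℝ → E n} {l : ℝ → ℝ} {f : Fin n → ℝ → ℝ}

lemma le_cSum (u : ℝ → E n) (i : Fin n) (k : ℤ) : ‖fcR (fun x => u x i) k‖ ≤ cSum u k :=
  Finset.single_le_sum (f := fun i => ‖fcR (fun x => u x i) k‖) (fun _ _ => norm_nonneg _)
    (Finset.mem_univ i)

lemma cSum_nonneg (u : ℝ → E n) (k : ℤ) : 0 ≤ cSum u k :=
  Finset.sum_nonneg fun _ _ => norm_nonneg _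

lemma natAbs_triangle (m k : ℤ) : ((m.natAbs : ℝ) ≤ k.natAbs + (m - k).natAbs) ∧
    ((k.natAbs : ℝ) ≤ (m - k).natAbs + m.natAbs) ∧
      (((m - k).natAbs : ℝ) ≤ k.natAbs + m.natAbs) := by
  have h1 : m.natAbs ≤ k.natAbs + (m - k).natAbs := by omega
  have h2 : k.natAbs ≤ (m - k).natAbs + m.natAbs := by omega
  have h3 : (m - k).natAbs ≤ k.natAbs + m.natAbs := by omega
  exact ⟨by exact_mod_cast h1, by exact_mod_cast h2, by exact_mod_cast h3⟩

lemma SphereReg.hasSum_dot (h : SphereReg u) (m : ℤ) :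
    HasSum (fun k => ∑ i, fcR (fun x => u x i) k * fcR (fun x => u x i) (m - k))
      (if m = 0 then 1 else 0) := by
  have h1 := hasSum_sum (s := Finset.univ) fun i (_ : i ∈ Finset.univ) =>
    fc_mul (h.half i).mem (h.half i).mem m
  rw [← fc_sum] at h1
  · rw [← fc_ek 0 m, fc_congr (g := fun x => ∑ i, ((u x i : ℝ) : ℂ) * ((u x i : ℝ) : ℂ))]
    · exact h1
    · filter_upwards [h.sum_sq] with x hx
      rw [ek_zero, ← Complex.ofReal_one, ← hx]
      push_cast
      simp only [sq]
  · exact fun i _ => (h.half i).mem.integrable_mul (h.half i).mem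

variable {V : Fin n → ℝ → ℂ} {N : ℕ}

lemma SphereReg.norm_dot_le (h : SphereReg u) (hV : ∀ i, MemLp (V i) 2 muc)
    (hc : ∀ i k, fc (V i) k = (lwz N k : ℂ) * fcR (fun x => u x i) k) (m : ℤ) :
    ENNReal.ofReal ‖fc (fun x => ∑ i, ((u x i : ℝ) : ℂ) * V i x) m‖ ≤ commP N u m := by
  have h1 : HasSum (fun k => ∑ i, fcR (fun x => u x i) k * fc (V i) (m - k))
      (fc (fun x => ∑ i, ((u x i : ℝ) : ℂ) * V i x) m) := by
    rw [fc_sum (f := fun i x => ((u x i : ℝ) : ℂ) * V i x) _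
      fun i _ => (h.half i).mem.integrable_mul (hV i)]
    exact hasSum_sum fun i _ => fc_mul (h.half i).mem (hV i) m
  have h2 := (Equiv.subLeft m).hasSum_iff.mpr h1
  have h3 := (h.hasSum_dot m).mul_left (lwz N m : ℂ)
  have h4 : (lwz N m : ℂ) * (if m = 0 then 1 else 0) = 0 := by
    by_cases hm : m = 0
    · simp [hm, lwz, lw_zero]
    · simp [hm]
  rw [h4] at h3
  have h5 := ((h1.add h2).sub h3).mul_left (1 / 2 : ℂ)
  have e5 : (1 / 2 : ℂ) * (fc (fun x => ∑ i, ((u x i : ℝ) : ℂ) * V i x) m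
      + fc (fun x => ∑ i, ((u x i : ℝ) : ℂ) * V i x) m - 0)
      = fc (fun x => ∑ i, ((u x i : ℝ) : ℂ) * V i x) m := by ring
  rw [e5] at h5
  refine ofReal_norm_le_of_hasSum h5 fun k => ?_
  have e6 : (1 / 2 : ℂ) * (∑ i, fcR (fun x => u x i) k * fc (V i) (m - k)
      + ((fun k => ∑ i, fcR (fun x => u x i) k * fc (V i) (m - k)) ∘ (Equiv.subLeft m)) k
      - (lwz N m : ℂ) * ∑ i, fcR (fun x => u x i) k * fcR (fun x => u x i) (m - k))
      = ((1 / 2 * (lwz N k + lwz N (m - k) - lwz N m) : ℝ) : ℂ)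
        * ∑ i, fcR (fun x => u x i) k * fcR (fun x => u x i) (m - k) := by
    simp only [Function.comp_apply, Equiv.subLeft_apply, sub_sub_cancel, hc, Finset.mul_sum,
      ← Finset.sum_add_distrib, ← Finset.sum_sub_distrib]
    refine Finset.sum_congr rfl fun i _ => ?_
    push_cast; ring
  rw [e6, norm_mul, Complex.norm_real, Real.norm_eq_abs, abs_mul]
  obtain ⟨t1, t2, t3⟩ := natAbs_triangle m k
  have s1 := lw_symbol_sum N (Nat.cast_nonneg k.natAbs) (Nat.cast_nonneg (m - k).natAbs)
    (Nat.cast_nonneg m.natAbs) t1 t2 t3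
  have s2 : ‖∑ i, fcR (fun x => u x i) k * fcR (fun x => u x i) (m - k)‖
      ≤ cSum u k * cSum u (m - k) := by
    refine (norm_sum_le _ _).trans ?_
    rw [cSum, Finset.sum_mul]
    refine Finset.sum_le_sum fun i _ => ?_
    rw [norm_mul]
    gcongr
    exact le_cSum u i _
  have s3 : |(1 / 2 : ℝ)| * |lwz N k + lwz N (m - k) - lwz N m|
      ≤ min (lwz N k) (lwz N (m - k)) := by
    rw [abs_of_pos (by norm_num : (0 : ℝ) < 1 / 2)]
    unfold lwz
    linarith
  exact mul_le_mul s3 s2 (norm_nonneg _) (le_min (lwz_nonneg _ _) (lwz_nonneg _ _))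

lemma SliceSol.norm_wedge_le (h : SliceSol u l f) (hV : ∀ i, MemLp (V i) 2 muc)
    (hc : ∀ i k, fc (V i) k = (lwz N k : ℂ) * fcR (fun x => u x i) k) (i j : Fin n) (m : ℤ) :
    ENNReal.ofReal ‖fc (fun x => V j x * ((u x i : ℝ) : ℂ)) m
        - fc (fun x => ((u x j : ℝ) : ℂ) * V i x) m‖
      ≤ ENNReal.ofReal ‖fc (fun x => ((u x j : ℝ) : ℂ) * ((f i x : ℝ) : ℂ)) m
        - fc (fun x => ((u x i : ℝ) : ℂ) * ((f j x : ℝ) : ℂ)) m‖ + 2 * commP N u m := by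
  set D := fc (fun x => V j x * ((u x i : ℝ) : ℂ)) m - fc (fun x => ((u x j : ℝ) : ℂ) * V i x) m
  set g := fc (fun x => ((u x j : ℝ) : ℂ) * ((f i x : ℝ) : ℂ)) m
        - fc (fun x => ((u x i : ℝ) : ℂ) * ((f j x : ℝ) : ℂ)) m
  set τ : ℝ := lw N m.natAbs / m.natAbs with hτ
  have h1 := (fc_mul (hV j) (h.reg.half i).mem m).sub (fc_mul (h.reg.half j).mem (hV i) m)
  have h2 := h1.sub ((h.commutator i j m).mul_left ((τ / (2 * π) : ℝ) : ℂ))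
  have hle : ENNReal.ofReal ‖D - ((τ / (2 * π) : ℝ) : ℂ) * g‖ ≤ 2 * commP N u m := by
    rw [commP, ← ENNReal.tsum_mul_left]
    refine (ofReal_norm_le_of_hasSum h2 (r := fun k => 2 * (min (lwz N k) (lwz N (m - k)) *
      (cSum u k * cSum u (m - k)))) fun k => ?_).trans (le_of_eq ?_)
    · have e : fc (V j) k * fc (fun x => ((u x i : ℝ) : ℂ)) (m - k)
          - fc (fun x => ((u x j : ℝ) : ℂ)) k * fc (V i) (m - k)
          - ((τ / (2 * π) : ℝ) : ℂ) * (((2 * π * (k.natAbs - (m - k).natAbs) : ℝ) : ℂ) *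
            (fcR (fun x => u x i) (m - k) * fcR (fun x => u x j) k))
          = ((lwz N k - lwz N (m - k) - τ * (k.natAbs - (m - k).natAbs) : ℝ) : ℂ)
            * (fcR (fun x => u x j) k * fcR (fun x => u x i) (m - k)) := by
        have e1 : τ / (2 * π) * (2 * π * (k.natAbs - (m - k).natAbs))
            = τ * (k.natAbs - (m - k).natAbs) := by
          field_simp
        rw [← mul_assoc ((τ / (2 * π) : ℝ) : ℂ), ← Complex.ofReal_mul, e1, hc, hc]
        simp only [fcR]
        push_cast; ring
      rw [e, norm_mul, Complex.norm_real, Real.norm_eq_abs, norm_mul, ← mul_assoc 2]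
      obtain ⟨t1, t2, t3⟩ := natAbs_triangle m k
      have s1 := lw_symbol_diff N (Nat.cast_nonneg (m - k).natAbs) (Nat.cast_nonneg k.natAbs)
        (Nat.cast_nonneg m.natAbs) (by linarith) (by linarith) (by linarith)
      rw [min_comm] at s1
      refine mul_le_mul s1 ?_ (by positivity)
        (mul_nonneg zero_le_two (le_min (lwz_nonneg _ _) (lwz_nonneg _ _)))
      exact mul_le_mul (le_cSum u j k) (le_cSum u i _) (norm_nonneg _) (cSum_nonneg u k)
    · refine tsum_congr fun k => ?_
      rw [ENNReal.ofReal_mul zero_le_two, ENNReal.ofReal_ofNat]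
  have hτ1 : ‖((τ / (2 * π) : ℝ) : ℂ)‖ ≤ 1 := by
    have a1 : 0 ≤ τ := div_nonneg (lw_nonneg _ _) (Nat.cast_nonneg _)
    have a2 : τ ≤ 1 := div_le_one_of_le₀ (lw_le_self N (Nat.cast_nonneg _)) (Nat.cast_nonneg _)
    rw [Complex.norm_real, Real.norm_of_nonneg (by positivity), div_le_one (by positivity)]
    linarith [Real.pi_gt_three]
  have hn : ‖D‖ ≤ ‖g‖ + ‖D - ((τ / (2 * π) : ℝ) : ℂ) * g‖ := by
    have b1 : D = ((τ / (2 * π) : ℝ) : ℂ) * g + (D - ((τ / (2 * π) : ℝ) : ℂ) * g) := by ring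
    calc ‖D‖ ≤ ‖((τ / (2 * π) : ℝ) : ℂ) * g‖ + ‖D - ((τ / (2 * π) : ℝ) : ℂ) * g‖ := by
          conv_lhs => rw [b1]
          exact norm_add_le _ _
      _ ≤ _ := by
          gcongr
          rw [norm_mul]
          exact mul_le_of_le_one_left (norm_nonneg _) hτ1
  calc ENNReal.ofReal ‖D‖ ≤ ENNReal.ofReal (‖g‖ + ‖D - ((τ / (2 * π) : ℝ) : ℂ) * g‖) :=
        ENNReal.ofReal_le_ofReal hn
    _ = ENNReal.ofReal ‖g‖ + ENNReal.ofReal ‖D - ((τ / (2 * π) : ℝ) : ℂ) * g‖ :=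
        ENNReal.ofReal_add (norm_nonneg _) (norm_nonneg _)
    _ ≤ _ := by gcongr

end

lemma tsum_fc_sq {f : ℝ → ℂ} (hf : MemLp f 2 muc) :
    ∑' k, ENNReal.ofReal (‖fc f k‖ ^ 2) = ENNReal.ofReal (1 / (2 * π)) * ∫⁻ x, ‖f x‖ₑ ^ 2 ∂muc := by
  have h := hasSum_fc_sq hf
  rw [← ENNReal.ofReal_tsum_of_nonneg (fun k => by positivity) h.summable, h.tsum_eq,
    ENNReal.ofReal_mul (by positivity), integral_eq_lintegral_of_nonneg_ae
      (f := fun x => ‖f x‖ ^ 2) (Eventually.of_forall fun x => by positivity) (hf.1.norm.pow 2),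
    ENNReal.ofReal_toReal]
  · congr 2; ext x
    rw [ENNReal.ofReal_pow (norm_nonneg _), ofReal_norm]
  · have := (memLp_two_iff hf.1).mp hf
    refine (lt_of_le_of_lt (le_of_eq ?_) this).ne
    congr 1; ext x
    rw [ENNReal.ofReal_pow (norm_nonneg _), ofReal_norm]

lemma lagrange_identity {ι : Type*} [Fintype ι] (u a : ι → ℝ) :
    ∑ i, ∑ j, (a j * u i - u j * a i) ^ 2
      = 2 * ((∑ i, u i ^ 2) * ∑ i, a i ^ 2) - 2 * (∑ i, u i * a i) ^ 2 := by
  have h1 : ∀ i j, (a j * u i - u j * a i) ^ 2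
      = u i ^ 2 * a j ^ 2 + a i ^ 2 * u j ^ 2 - 2 * ((u i * a i) * (u j * a j)) := fun i j => by
    ring
  simp only [h1, Finset.sum_sub_distrib, Finset.sum_add_distrib, ← Finset.mul_sum, ← Finset.sum_mul]
  ring

lemma lagrange_complex {ι : Type*} [Fintype ι] (u : ι → ℝ) (hu : ∑ i, u i ^ 2 = 1) (V : ι → ℂ) :
    ∑ i, ‖V i‖ ^ 2 ≤ ‖∑ i, (u i : ℂ) * V i‖ ^ 2
      + ∑ i, ∑ j, ‖V j * (u i : ℂ) - (u j : ℂ) * V i‖ ^ 2 := by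
  have h1 := lagrange_identity u fun i => (V i).re
  have h2 := lagrange_identity u fun i => (V i).im
  rw [hu, one_mul] at h1 h2
  have e : ∀ z : ℂ, ‖z‖ ^ 2 = z.re ^ 2 + z.im ^ 2 := fun z => by
    rw [← Complex.normSq_eq_norm_sq, Complex.normSq_apply]; ring
  have p1 : 0 ≤ ∑ i, ∑ j, ((V j).re * u i - u j * (V i).re) ^ 2 := by positivity
  have p2 : 0 ≤ ∑ i, ∑ j, ((V j).im * u i - u j * (V i).im) ^ 2 := by positivity
  simp only [e, Complex.re_sum, Complex.im_sum, Complex.sub_re, Complex.sub_im,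
    Complex.re_ofReal_mul, Complex.im_ofReal_mul, Complex.re_mul_ofReal, Complex.im_mul_ofReal,
    Finset.sum_add_distrib]
  linarith

section

variable {n : ℕ} {u : ℝ → E n} {l : ℝ → ℝ} {f : Fin n → ℝ → ℝ}

lemma SphereReg.memLp_mul (h : SphereReg u) {g : ℝ → ℂ} (hg : MemLp g 2 muc) (i : Fin n) :
    MemLp (fun x => ((u x i : ℝ) : ℂ) * g x) 2 muc := by
  refine hg.of_le ((h.aesm i).mul hg.1) ?_
  filter_upwards [h.abs_le i] with x hx
  rw [norm_mul]
  exact mul_le_of_le_one_left (norm_nonneg _) hx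

lemma SphereReg.tsum_fc_mul_le (h : SphereReg u) {g : ℝ → ℂ} (hg : MemLp g 2 muc) (i : Fin n) :
    ∑' k, ENNReal.ofReal (‖fc (fun x => ((u x i : ℝ) : ℂ) * g x) k‖ ^ 2)
      ≤ ∑' k, ENNReal.ofReal (‖fc g k‖ ^ 2) := by
  rw [tsum_fc_sq (h.memLp_mul hg i), tsum_fc_sq hg]
  refine mul_le_mul' le_rfl (lintegral_mono_ae ?_)
  filter_upwards [h.abs_le i] with x hx
  gcongr
  rw [← ofReal_norm, ← ofReal_norm, norm_mul]
  exact ENNReal.ofReal_le_ofReal (mul_le_of_le_one_left (norm_nonneg _) hx)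

lemma SphereReg.sum_le_dot_wedge (h : SphereReg u) {V : Fin n → ℝ → ℂ}
    (hV : ∀ i, MemLp (V i) 2 muc) :
    ∑ i, ∑' k, ENNReal.ofReal (‖fc (V i) k‖ ^ 2)
      ≤ ∑' m, ENNReal.ofReal (‖fc (fun x => ∑ i, ((u x i : ℝ) : ℂ) * V i x) m‖ ^ 2)
        + ∑ i, ∑ j, ∑' m, ENNReal.ofReal (‖fc (fun x => V j x * ((u x i : ℝ) : ℂ)) m
          - fc (fun x => ((u x j : ℝ) : ℂ) * V i x) m‖ ^ 2) := by
  have hr : ∀ i j, MemLp (fun x => V j x * ((u x i : ℝ) : ℂ)) 2 muc := fun i j => by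
    simpa only [mul_comm] using h.memLp_mul (hV j) i
  have hw : ∀ i j, MemLp (fun x => V j x * ((u x i : ℝ) : ℂ) - ((u x j : ℝ) : ℂ) * V i x) 2 muc :=
    fun i j => (hr i j).sub (h.memLp_mul (hV i) j)
  have hd : MemLp (fun x => ∑ i, ((u x i : ℝ) : ℂ) * V i x) 2 muc :=
    memLp_finsetSum _ fun i _ => h.memLp_mul (hV i) i
  have e : ∀ i j m, fc (fun x => V j x * ((u x i : ℝ) : ℂ)) m
      - fc (fun x => ((u x j : ℝ) : ℂ) * V i x) m
      = fc (fun x => V j x * ((u x i : ℝ) : ℂ) - ((u x j : ℝ) : ℂ) * V i x) m := fun i j m =>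
    (fc_sub (MemLp.int1 (hr i j)) (MemLp.int1 (h.memLp_mul (hV i) j)) m).symm
  simp only [e, tsum_fc_sq hd, fun i => tsum_fc_sq (hV i), fun i j => tsum_fc_sq (hw i j),
    ← Finset.mul_sum, ← mul_add]
  refine mul_le_mul' le_rfl ?_
  have m1 : ∀ i, AEMeasurable (fun x => ‖V i x‖ₑ ^ 2) muc := fun i => (hV i).1.enorm.pow_const 2
  have m2 : ∀ i j, AEMeasurable (fun x => ‖V j x * ((u x i : ℝ) : ℂ)
      - ((u x j : ℝ) : ℂ) * V i x‖ₑ ^ 2) muc := fun i j => (hw i j).1.enorm.pow_const 2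
  have m3 : AEMeasurable (fun x => ‖∑ i, ((u x i : ℝ) : ℂ) * V i x‖ₑ ^ 2) muc :=
    hd.1.enorm.pow_const 2
  rw [← lintegral_finsetSum' _ fun i _ => m1 i]
  simp only [fun i => (lintegral_finsetSum' Finset.univ fun j _ => m2 i j).symm]
  rw [← lintegral_finsetSum' _ fun i _ => Finset.aemeasurable_fun_sum _ fun j _ => m2 i j,
    ← lintegral_add_left' m3]
  refine lintegral_mono_ae ?_
  filter_upwards [h.sum_sq] with x hx
  have := ENNReal.ofReal_le_ofReal (lagrange_complex (fun i => u x i) hx fun i => V i x)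
  rw [ENNReal.ofReal_add (by positivity) (by positivity)] at this
  simpa only [ENNReal.ofReal_sum_of_nonneg, sq_nonneg, Finset.sum_nonneg, implies_true,
    ENNReal.ofReal_pow, norm_nonneg, ofReal_norm] using this

/-- Squared `L²` norm of the forcing, in Fourier variables. -/
def forcing (f : Fin n → ℝ → ℝ) : ℝ≥0∞ := ∑ i, ∑' k, ENNReal.ofReal (‖fcR (f i) k‖ ^ 2)

lemma SliceSol.sum_wedge_f_le (h : SliceSol u l f) :
    ∑ i, ∑ j, ∑' m, ENNReal.ofReal ‖fc (fun x => ((u x j : ℝ) : ℂ) * ((f i x : ℝ) : ℂ)) m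
        - fc (fun x => ((u x i : ℝ) : ℂ) * ((f j x : ℝ) : ℂ)) m‖ ^ 2 ≤ 4 * n * forcing f := by
  have h1 : ∀ i j, ∑' m, ENNReal.ofReal ‖fc (fun x => ((u x j : ℝ) : ℂ) * ((f i x : ℝ) : ℂ)) m
        - fc (fun x => ((u x i : ℝ) : ℂ) * ((f j x : ℝ) : ℂ)) m‖ ^ 2
      ≤ 2 * ((∑' k, ENNReal.ofReal (‖fcR (f i) k‖ ^ 2))
        + ∑' k, ENNReal.ofReal (‖fcR (f j) k‖ ^ 2)) := by
    intro i j
    refine le_trans ?_ (mul_le_mul' le_rfl (add_le_add (h.reg.tsum_fc_mul_le (h.mem i) j)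
      (h.reg.tsum_fc_mul_le (h.mem j) i)))
    rw [← ENNReal.tsum_add, ← ENNReal.tsum_mul_left]
    refine ENNReal.tsum_le_tsum fun m => ?_
    simp only [ENNReal.ofReal_pow (norm_nonneg _)]
    refine le_trans ?_ (enn_add_sq_le _ _)
    rw [← ENNReal.ofReal_add (norm_nonneg _) (norm_nonneg _)]
    gcongr
    exact norm_sub_le _ _
  refine (Finset.sum_le_sum fun i _ => Finset.sum_le_sum fun j _ => h1 i j).trans (le_of_eq ?_)
  simp only [← Finset.mul_sum, Finset.sum_add_distrib, Finset.sum_const, Finset.card_univ,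
    Fintype.card_fin, nsmul_eq_mul, forcing]
  ring

lemma cSum_sq_le (u : ℝ → E n) (k : ℤ) :
    cSum u k ^ 2 ≤ n * ∑ i, ‖fcR (fun x => u x i) k‖ ^ 2 := by
  simpa [cSum] using sq_sum_le_card_mul_sum_sq (s := Finset.univ)
    (f := fun i => ‖fcR (fun x => u x i) k‖)

lemma tsum_cSum_le (u : ℝ → E n) {r : ℤ → ℝ} (hr : ∀ k, 0 ≤ r k) :
    ∑' k, ENNReal.ofReal (r k * cSum u k ^ 2)
      ≤ n * ∑ i, ∑' k, ENNReal.ofReal (r k * ‖fcR (fun x => u x i) k‖ ^ 2) := by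
  rw [← Summable.tsum_finsetSum fun i _ => ENNReal.summable, ← ENNReal.tsum_mul_left]
  refine ENNReal.tsum_le_tsum fun k => ?_
  rw [← ENNReal.ofReal_sum_of_nonneg fun i _ => mul_nonneg (hr k) (sq_nonneg _),
    ← ENNReal.ofReal_natCast, ← ENNReal.ofReal_mul (Nat.cast_nonneg n), ← Finset.mul_sum,
    mul_left_comm]
  gcongr
  · exact hr k
  · exact cSum_sq_le u k

lemma tsum_commP_sq_le (u : ℝ → E n) (N : ℕ) :
    ∑' m, commP N u m ^ 2 ≤ 12 * n ^ 2 * (hHalf u *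
      ∑ i, ∑' k, ENNReal.ofReal (lwz N k ^ 2 * ‖fcR (fun x => u x i) k‖ ^ 2)) := by
  refine (conv_lwz_le N (cSum_nonneg u)).trans ?_
  have h1 := tsum_cSum_le u (r := fun k => (k.natAbs : ℝ)) fun k => Nat.cast_nonneg _
  have h2 := tsum_cSum_le u (r := fun k => lwz N k ^ 2) fun k => sq_nonneg _
  simp only [← hHalfR_eq, ← hHalf_eq_sum] at h1
  refine (mul_le_mul' le_rfl (mul_le_mul' h1 h2)).trans (le_of_eq ?_)
  ring

lemma lwz_sq_le (N : ℕ) (k : ℤ) : lwz N k ^ 2 ≤ N * k.natAbs := by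
  rw [lwz, lw_sq N (Nat.cast_nonneg _), mul_comm]
  gcongr
  exact min_le_right _ _

lemma SphereReg.summable_lwz (h : SphereReg u) (N : ℕ) (i : Fin n) :
    Summable fun k => lwz N k ^ 2 * ‖fcR (fun x => u x i) k‖ ^ 2 := by
  refine Summable.of_nonneg_of_le (fun k => by positivity) (fun k => ?_)
    ((summable_hHalfR (h.half i).fin).mul_left (N : ℝ))
  rw [← mul_assoc]
  gcongr
  exact lwz_sq_le N k

lemma SliceSol.trunc_le (h : SliceSol u l f)
    (hε : 24 * n ^ 2 * (1 + 8 * n ^ 2) * hHalf u ≤ 1) (N : ℕ) :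
    ∑ i, ∑' k, ENNReal.ofReal (lwz N k ^ 2 * ‖fcR (fun x => u x i) k‖ ^ 2)
      ≤ 16 * n * forcing f := by
  have hV : ∀ i, ∃ V : ℝ → ℂ, MemLp V 2 muc ∧
      ∀ k, fc V k = (lwz N k : ℂ) * fcR (fun x => u x i) k := fun i => by
    refine exists_memLp_of_summable_sq ((h.reg.summable_lwz N i).congr fun k => ?_)
    rw [norm_mul, Complex.norm_real, mul_pow, Real.norm_eq_abs, sq_abs]
  choose V hV hc using hV
  set S := ∑ i, ∑' k, ENNReal.ofReal (lwz N k ^ 2 * ‖fcR (fun x => u x i) k‖ ^ 2) with hS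
  set Q := ∑' m, commP N u m ^ 2 with hQ
  have hSV : S = ∑ i, ∑' k, ENNReal.ofReal (‖fc (V i) k‖ ^ 2) := by
    refine Finset.sum_congr rfl fun i _ => tsum_congr fun k => ?_
    rw [hc, norm_mul, Complex.norm_real, mul_pow, Real.norm_eq_abs, sq_abs]
  have hSfin : S ≠ ⊤ := ENNReal.sum_ne_top.mpr fun i _ => by
    rw [← ENNReal.ofReal_tsum_of_nonneg (fun k => by positivity) (h.reg.summable_lwz N i)]
    exact ENNReal.ofReal_ne_top
  have h1 : ∑' m, ENNReal.ofReal (‖fc (fun x => ∑ i, ((u x i : ℝ) : ℂ) * V i x) m‖ ^ 2) ≤ Q := by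
    refine ENNReal.tsum_le_tsum fun m => ?_
    rw [ENNReal.ofReal_pow (norm_nonneg _)]
    gcongr
    exact h.reg.norm_dot_le hV hc m
  have h2 : ∑ i, ∑ j, ∑' m, ENNReal.ofReal (‖fc (fun x => V j x * ((u x i : ℝ) : ℂ)) m
      - fc (fun x => ((u x j : ℝ) : ℂ) * V i x) m‖ ^ 2)
      ≤ 2 * (4 * n * forcing f) + 8 * n ^ 2 * Q := by
    have h3 : ∀ i j, ∑' m, ENNReal.ofReal (‖fc (fun x => V j x * ((u x i : ℝ) : ℂ)) m
        - fc (fun x => ((u x j : ℝ) : ℂ) * V i x) m‖ ^ 2)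
        ≤ 2 * (∑' m, ENNReal.ofReal ‖fc (fun x => ((u x j : ℝ) : ℂ) * ((f i x : ℝ) : ℂ)) m
        - fc (fun x => ((u x i : ℝ) : ℂ) * ((f j x : ℝ) : ℂ)) m‖ ^ 2) + 8 * Q := fun i j => by
      rw [hQ, ← ENNReal.tsum_mul_left, ← ENNReal.tsum_mul_left, ← ENNReal.tsum_add]
      refine ENNReal.tsum_le_tsum fun m => ?_
      rw [ENNReal.ofReal_pow (norm_nonneg _)]
      refine (pow_le_pow_left' (h.norm_wedge_le hV hc i j m) 2).trans ?_
      refine (enn_add_sq_le _ _).trans (le_of_eq ?_)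
      ring
    refine (Finset.sum_le_sum fun i _ => Finset.sum_le_sum fun j _ => h3 i j).trans ?_
    simp only [Finset.sum_add_distrib, ← Finset.mul_sum, Finset.sum_const, Finset.card_univ,
      Fintype.card_fin, nsmul_eq_mul]
    refine add_le_add (mul_le_mul' le_rfl h.sum_wedge_f_le) (le_of_eq ?_)
    ring
  have h4 : S ≤ (1 + 8 * n ^ 2) * Q + 8 * n * forcing f := by
    rw [hSV]
    refine (h.reg.sum_le_dot_wedge hV).trans ((add_le_add h1 h2).trans (le_of_eq ?_))
    ring
  have h5 : 2 * ((1 + 8 * n ^ 2) * Q) ≤ S := by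
    calc 2 * ((1 + 8 * n ^ 2) * Q)
        ≤ 2 * ((1 + 8 * n ^ 2) * (12 * n ^ 2 * (hHalf u * S))) := by
          gcongr
          exact tsum_commP_sq_le u N
      _ = (24 * n ^ 2 * (1 + 8 * n ^ 2) * hHalf u) * S := by ring
      _ ≤ 1 * S := by gcongr
      _ = S := one_mul S
  have h6 : S + S ≤ S + 16 * n * forcing f := by
    calc S + S = 2 * S := (two_mul S).symm
      _ ≤ 2 * ((1 + 8 * n ^ 2) * Q + 8 * n * forcing f) := by gcongr
      _ = 2 * ((1 + 8 * n ^ 2) * Q) + 16 * n * forcing f := by ring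
      _ ≤ _ := by gcongr
  exact (ENNReal.add_le_add_iff_left hSfin).mp h6

lemma SliceSol.laplacian_le (h : SliceSol u l f)
    (hε : 24 * n ^ 2 * (1 + 8 * n ^ 2) * hHalf u ≤ 1) :
    ∑ i, ∑' k : ℤ, ENNReal.ofReal ((k.natAbs : ℝ) ^ 2 * ‖fcR (fun x => u x i) k‖ ^ 2)
      ≤ 16 * n * forcing f := by
  rw [← Summable.tsum_finsetSum fun i _ => ENNReal.summable]
  rw [ENNReal.tsum_eq_iSup_sum]
  refine iSup_le fun s => ?_
  refine le_trans ?_ (h.trunc_le hε (s.sup Int.natAbs))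
  rw [← Summable.tsum_finsetSum fun i _ => ENNReal.summable]
  refine le_trans (Finset.sum_le_sum fun k hk => ?_) (ENNReal.sum_le_tsum s)
  refine Finset.sum_le_sum fun i _ => ?_
  rw [lwz, lw_sq _ (Nat.cast_nonneg _), min_eq_left, ← sq]
  exact_mod_cast Finset.le_sup (f := Int.natAbs) hk

end

lemma hasSum_fcR_sq {f : ℝ → ℝ} (hf : MemLp (fun x => (f x : ℂ)) 2 muc) :
    HasSum (fun k => ‖fcR f k‖ ^ 2) (1 / (2 * π) * ∫ x, f x ^ 2 ∂muc) := by
  have := hasSum_fc_sq hf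
  unfold fcR
  simpa only [Complex.norm_real, Real.norm_eq_abs, sq_abs] using this

lemma memLp_of_ofReal {f : ℝ → ℝ} (hf : MemLp (fun x => (f x : ℂ)) 2 muc) : MemLp f 2 muc := by
  simpa using hf.re

lemma forcing_eq {n : ℕ} {f : Fin n → ℝ → ℝ} (hf : ∀ i, MemLp (fun x => (f i x : ℂ)) 2 muc) :
    forcing f = ENNReal.ofReal (1 / (2 * π) * ∑ i, ∫ x, f i x ^ 2 ∂muc) := by
  rw [forcing, Finset.mul_sum, ENNReal.ofReal_sum_of_nonneg]
  · refine Finset.sum_congr rfl fun i _ => ?_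
    rw [← (hasSum_fcR_sq (hf i)).tsum_eq,
      ENNReal.ofReal_tsum_of_nonneg (fun k => by positivity) (hasSum_fcR_sq (hf i)).summable]
  · intro i _
    have : 0 ≤ ∫ x, f i x ^ 2 ∂muc := integral_nonneg fun x => sq_nonneg _
    positivity

section
variable {n : ℕ} {u : ℝ → E n} {l : ℝ → ℝ} {f : Fin n → ℝ → ℝ}

lemma SliceSol.forcing_density_le (h : SliceSol u l f)
    (hε : 24 * n ^ 2 * (1 + 8 * n ^ 2) * hHalf u ≤ 1) :
    forcing (fun i x => l x * u x i) ≤ ENNReal.ofReal (2 + 128 * π ^ 2 * n) * forcing f := by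
  have key : ∀ i k, ENNReal.ofReal (‖fcR (fun x => l x * u x i) k‖ ^ 2)
      ≤ 2 * ENNReal.ofReal (‖fcR (f i) k‖ ^ 2) + ENNReal.ofReal (8 * π ^ 2) *
        ENNReal.ofReal ((k.natAbs : ℝ) ^ 2 * ‖fcR (fun x => u x i) k‖ ^ 2) := by
    intro i k
    have e2 : 2 * ENNReal.ofReal (‖fcR (f i) k‖ ^ 2) = ENNReal.ofReal (2 * ‖fcR (f i) k‖ ^ 2) := by
      rw [ENNReal.ofReal_mul (by norm_num), ENNReal.ofReal_ofNat]
    rw [← h.eq, ← ENNReal.ofReal_mul (by positivity), e2,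
      ← ENNReal.ofReal_add (by positivity) (by positivity)]
    refine ENNReal.ofReal_le_ofReal ?_
    have h1 := norm_add_le (fcR (f i) k)
      (((2 * π * k.natAbs : ℝ) : ℂ) * fcR (fun x => u x i) k)
    rw [norm_mul, Complex.norm_real, Real.norm_of_nonneg (by positivity)] at h1
    have h2 := pow_le_pow_left₀ (norm_nonneg _) h1 2
    refine h2.trans ?_
    nlinarith [sq_nonneg (‖fcR (f i) k‖ - 2 * π * k.natAbs * ‖fcR (fun x => u x i) k‖)]
  calc forcing (fun i x => l x * u x i)
      ≤ ∑ i, ∑' k : ℤ, (2 * ENNReal.ofReal (‖fcR (f i) k‖ ^ 2) + ENNReal.ofReal (8 * π ^ 2) *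
        ENNReal.ofReal ((k.natAbs : ℝ) ^ 2 * ‖fcR (fun x => u x i) k‖ ^ 2)) :=
        Finset.sum_le_sum fun i _ => ENNReal.tsum_le_tsum fun k => key i k
    _ = 2 * forcing f + ENNReal.ofReal (8 * π ^ 2) * ∑ i, ∑' k : ℤ,
        ENNReal.ofReal ((k.natAbs : ℝ) ^ 2 * ‖fcR (fun x => u x i) k‖ ^ 2) := by
      simp only [ENNReal.tsum_add, ENNReal.tsum_mul_left, Finset.sum_add_distrib, forcing,
        Finset.mul_sum]
    _ ≤ 2 * forcing f + ENNReal.ofReal (8 * π ^ 2) * (16 * n * forcing f) := by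
      gcongr
      exact h.laplacian_le hε
    _ = ENNReal.ofReal (2 + 128 * π ^ 2 * n) * forcing f := by
      rw [ENNReal.ofReal_add (by norm_num) (by positivity), add_mul,
        show 128 * π ^ 2 * n = 8 * π ^ 2 * (16 * n) by ring,
        ENNReal.ofReal_mul (p := 8 * π ^ 2) (by positivity),
        ENNReal.ofReal_mul (p := 16) (by norm_num), ENNReal.ofReal_ofNat, ENNReal.ofReal_ofNat,
        ENNReal.ofReal_natCast, mul_assoc (ENNReal.ofReal _)]

lemma SliceSol.memLp_density (h : SliceSol u l f)
    (hε : 24 * n ^ 2 * (1 + 8 * n ^ 2) * hHalf u ≤ 1) (i : Fin n) :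
    MemLp (fun x => ((l x * u x i : ℝ) : ℂ)) 2 muc := by
  have h1 := h.forcing_density_le hε
  rw [forcing_eq h.mem] at h1
  have h2 : ∑' k, ENNReal.ofReal (‖fcR (fun x => l x * u x i) k‖ ^ 2) ≠ ⊤ := by
    refine (lt_of_le_of_lt (le_trans ?_ h1) (ENNReal.mul_lt_top ENNReal.ofReal_lt_top
      ENNReal.ofReal_lt_top)).ne
    exact Finset.single_le_sum (f := fun i => ∑' k,
      ENNReal.ofReal (‖fcR (fun x => l x * u x i) k‖ ^ 2)) (fun _ _ => zero_le) (Finset.mem_univ i)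
  obtain ⟨g, hg, hgc⟩ := exists_memLp_of_summable_sq
    (summable_of_tsum_ofReal_ne_top (fun k => by positivity) h2)
  exact (memLp_congr_ae (ae_eq_of_fc_eq (MemLp.int1 hg) (h.int i).ofReal fun k => hgc k)).mp hg

lemma SliceSol.sum_integral_density_le (h : SliceSol u l f)
    (hε : 24 * n ^ 2 * (1 + 8 * n ^ 2) * hHalf u ≤ 1) :
    ∑ i, ∫ x, (l x * u x i) ^ 2 ∂muc ≤ (2 + 128 * π ^ 2 * n) * ∑ i, ∫ x, f i x ^ 2 ∂muc := by
  have h1 := h.forcing_density_le hε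
  have p : 0 ≤ ∑ i, ∫ x, f i x ^ 2 ∂muc :=
    Finset.sum_nonneg fun i _ => integral_nonneg fun x => sq_nonneg _
  rw [forcing_eq h.mem, forcing_eq (h.memLp_density hε), ← ENNReal.ofReal_mul (by positivity),
    ENNReal.ofReal_le_ofReal_iff (by positivity)] at h1
  have h2 : 0 < 1 / (2 * π) := by positivity
  refine le_of_mul_le_mul_left ?_ h2
  linarith

lemma SliceSol.memLp_lagrange (h : SliceSol u l f)
    (hε : 24 * n ^ 2 * (1 + 8 * n ^ 2) * hHalf u ≤ 1) : MemLp l 2 muc := by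
  have h1 : ∀ i, MemLp (fun x => u x i * (l x * u x i)) 2 muc := fun i => by
    have := h.reg.memLp_mul (h.memLp_density hε i) i
    refine memLp_of_ofReal ?_
    convert this using 2
    push_cast; ring
  have h2 : MemLp (fun x => ∑ i, u x i * (l x * u x i)) 2 muc := memLp_finsetSum _ fun i _ => h1 i
  refine (memLp_congr_ae ?_).mp h2
  filter_upwards [h.reg.sum_sq] with x hx
  calc ∑ i, u x i * (l x * u x i) = l x * ∑ i, u x i ^ 2 := by
        rw [Finset.mul_sum]; exact Finset.sum_congr rfl fun i _ => by ring
    _ = l x := by rw [hx, mul_one]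

lemma SliceSol.integral_lagrange_sq_le (h : SliceSol u l f)
    (hε : 24 * n ^ 2 * (1 + 8 * n ^ 2) * hHalf u ≤ 1) :
    ∫ x, l x ^ 2 ∂muc ≤ (2 + 128 * π ^ 2 * n) * ∑ i, ∫ x, f i x ^ 2 ∂muc := by
  refine le_trans (le_of_eq ?_) (h.sum_integral_density_le hε)
  rw [← integral_finsetSum _ fun i _ => (memLp_of_ofReal (h.memLp_density hε i)).integrable_sq]
  refine integral_congr_ae ?_
  filter_upwards [h.reg.sum_sq] with x hx
  calc l x ^ 2 = l x ^ 2 * ∑ i, u x i ^ 2 := by rw [hx, mul_one]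
    _ = ∑ i, (l x * u x i) ^ 2 := by
      rw [Finset.mul_sum]; exact Finset.sum_congr rfl fun i _ => by ring

end

/-- A scalar Ladyzhenskaya-type inequality on the circle. -/
lemma HalfReg.integral_sq_sq_le {z : ℝ → ℝ} (hz : HalfReg z)
    (hz2 : MemLp (fun x => ((z x ^ 2 : ℝ) : ℂ)) 2 muc) :
    ∫ x, (z x ^ 2) ^ 2 ∂muc ≤ 8 * π * ((∑' k, ‖fcR z k‖ ^ 2) *
      (2 * (∑' k : ℤ, (k.natAbs : ℝ) * ‖fcR z k‖ ^ 2) + ∑' k, ‖fcR z k‖ ^ 2)) := by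
  have hs := hz.hasSum_sq
  have hH := summable_hHalfR hz.fin
  have p1 : 0 ≤ ∑' k, ‖fcR z k‖ ^ 2 := tsum_nonneg fun k => by positivity
  have p2 : 0 ≤ ∑' k : ℤ, (k.natAbs : ℝ) * ‖fcR z k‖ ^ 2 := tsum_nonneg fun k => by positivity
  have h1 : ∀ m, ENNReal.ofReal ‖fcR (fun x => z x ^ 2) m‖
      ≤ ∑' a, ENNReal.ofReal ‖fcR z a‖ * ENNReal.ofReal ‖fcR z (m - a)‖ := by
    intro m
    have := fc_mul hz.mem hz.mem m
    refine (ofReal_norm_le_of_hasSum (s := fcR (fun x => z x ^ 2) m) ?_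
      (r := fun a => ‖fcR z a‖ * ‖fcR z (m - a)‖)
      fun a => (norm_mul (fcR z a) (fcR z (m - a))).le).trans (le_of_eq ?_)
    · unfold fcR
      have e : (fun x => (((z x) ^ 2 : ℝ) : ℂ)) = fun x => (z x : ℂ) * (z x : ℂ) := by
        ext x; push_cast; ring
      rw [e]; exact this
    · exact tsum_congr fun a => ENNReal.ofReal_mul (norm_nonneg _)
  have h2 := conv_self_le fun a => ENNReal.ofReal ‖fcR z a‖
  have h3 : ENNReal.ofReal (1 / (2 * π) * ∫ x, (z x ^ 2) ^ 2 ∂muc)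
      ≤ ENNReal.ofReal (4 * ((∑' k, ‖fcR z k‖ ^ 2) *
      (2 * (∑' k : ℤ, (k.natAbs : ℝ) * ‖fcR z k‖ ^ 2) + ∑' k, ‖fcR z k‖ ^ 2))) := by
    rw [← (hasSum_fcR_sq hz2).tsum_eq,
      ENNReal.ofReal_tsum_of_nonneg (fun k => by positivity) (hasSum_fcR_sq hz2).summable]
    refine (ENNReal.tsum_le_tsum fun m => ?_).trans (h2.trans (le_of_eq ?_))
    · rw [ENNReal.ofReal_pow (norm_nonneg _)]
      exact pow_le_pow_left' (h1 m) 2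
    · have e1 : ∑' k, ENNReal.ofReal ‖fcR z k‖ ^ 2 = ENNReal.ofReal (∑' k, ‖fcR z k‖ ^ 2) := by
        rw [ENNReal.ofReal_tsum_of_nonneg (fun k => by positivity) hs]
        exact tsum_congr fun k => (ENNReal.ofReal_pow (norm_nonneg _) 2).symm
      have e2 : ∑' b : ℤ, (2 * (b.natAbs : ℝ≥0∞) + 1) * ENNReal.ofReal ‖fcR z b‖ ^ 2
          = ENNReal.ofReal (2 * (∑' k : ℤ, (k.natAbs : ℝ) * ‖fcR z k‖ ^ 2)
            + ∑' k, ‖fcR z k‖ ^ 2) := by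
        rw [← tsum_mul_left, ← (hH.mul_left 2).tsum_add hs,
          ENNReal.ofReal_tsum_of_nonneg (fun k => by positivity) ((hH.mul_left 2).add hs)]
        refine tsum_congr fun k => ?_
        rw [ENNReal.ofReal_add (by positivity) (by positivity), ENNReal.ofReal_mul (by norm_num),
          ENNReal.ofReal_mul (by positivity), ENNReal.ofReal_pow (norm_nonneg _)]
        rw [ENNReal.ofReal_ofNat, ENNReal.ofReal_natCast]; ring
      rw [e1, e2, ← ENNReal.ofReal_mul p1, ENNReal.ofReal_mul (p := 4) (by norm_num),
        ENNReal.ofReal_ofNat]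
  rw [ENNReal.ofReal_le_ofReal_iff (by positivity)] at h3
  have h4 := mul_le_mul_of_nonneg_left h3 (show 0 ≤ 2 * π by positivity)
  have e : 2 * π * (1 / (2 * π) * ∫ x, (z x ^ 2) ^ 2 ∂muc) = ∫ x, (z x ^ 2) ^ 2 ∂muc := by
    field_simp
  rw [e] at h4
  linarith

lemma integral_mul_sq_le {p q : ℝ → ℝ} (hp : MemLp p 2 muc) (hq : MemLp q 2 muc) :
    (∫ x, p x * q x ∂muc) ^ 2 ≤ (∫ x, p x ^ 2 ∂muc) * ∫ x, q x ^ 2 ∂muc := by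
  have i1 := hp.integrable_sq
  have i2 := hq.integrable_sq
  have i3 : Integrable (fun x => p x * q x) muc := hp.integrable_mul hq
  have h : ∀ t : ℝ, 0 ≤ (∫ x, p x ^ 2 ∂muc) * (t * t) + (2 * ∫ x, p x * q x ∂muc) * t
      + ∫ x, q x ^ 2 ∂muc := by
    intro t
    have : 0 ≤ ∫ x, (p x * t + q x) ^ 2 ∂muc := integral_nonneg fun x => sq_nonneg _
    have e : ∫ x, (p x * t + q x) ^ 2 ∂muc
        = ∫ x, (p x ^ 2 * (t * t) + (p x * q x) * (2 * t)) + q x ^ 2 ∂muc :=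
      integral_congr_ae (Eventually.of_forall fun x => by ring)
    have j1 : Integrable (fun x => p x ^ 2 * (t * t) + (p x * q x) * (2 * t)) muc :=
      (i1.mul_const _).add (i3.mul_const _)
    rw [e, integral_add j1 i2, integral_add (i1.mul_const _) (i3.mul_const _),
      integral_mul_const, integral_mul_const] at this
    linarith
  have := discrim_le_zero h
  rw [discrim] at this
  nlinarith

section
variable {n : ℕ} {u v : ℝ → E n} {l m : ℝ → ℝ} {f g : Fin n → ℝ → ℝ}

/-- The energy identity for the difference of two solutions, in one coordinate. -/
lemma SliceSol.integral_diff (hu : SliceSol u l f) (hv : SliceSol v m g)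
    (hεu : 24 * n ^ 2 * (1 + 8 * n ^ 2) * hHalf u ≤ 1)
    (hεv : 24 * n ^ 2 * (1 + 8 * n ^ 2) * hHalf v ≤ 1) (i : Fin n) :
    ∫ x, (u x i - v x i) * (f i x - g i x) ∂muc
      = (∫ x, (u x i - v x i) * (l x * u x i - m x * v x i) ∂muc)
        - 4 * π ^ 2 * ∑' k : ℤ, (k.natAbs : ℝ) * ‖fcR (fun x => u x i - v x i) k‖ ^ 2 := by
  have hz : HalfReg (fun x => u x i - v x i) := by
    simpa only [sub_eq_add_neg] using (hu.reg.half i).add (hv.reg.half i).neg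
  have mω : MemLp (fun x => ((f i x - g i x : ℝ) : ℂ)) 2 muc := by
    simp only [Complex.ofReal_sub]
    exact (hu.mem i).sub (hv.mem i)
  have mF : MemLp (fun x => ((l x * u x i - m x * v x i : ℝ) : ℂ)) 2 muc := by
    simp only [Complex.ofReal_sub (l _ * _)]
    exact (hu.memLp_density hεu i).sub (hv.memLp_density hεv i)
  have e1 : ∀ k, fcR (fun x => l x * u x i - m x * v x i) k
      = fcR (fun x => f i x - g i x) k
        + ((2 * π * k.natAbs : ℝ) : ℂ) * fcR (fun x => u x i - v x i) k := by
    intro k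
    have s : ∀ {p q : ℝ → ℝ}, Integrable p muc → Integrable q muc →
        fcR (fun x => p x - q x) k = fcR p k - fcR q k := fun {p q} hp hq => by
      have := fc_sub (hp.ofReal (𝕜 := ℂ)) (hq.ofReal (𝕜 := ℂ)) k
      simp only [fcR, Complex.ofReal_sub]
      exact this
    rw [s (hu.int i) (hv.int i), s (hu.reg.half i).integrable (hv.reg.half i).integrable,
      s ((memLp_of_ofReal (hu.mem i)).integrable one_le_two)
        ((memLp_of_ofReal (hv.mem i)).integrable one_le_two), ← hu.eq, ← hv.eq]
    ring
  have c : ∀ {p : ℝ → ℝ}, MemLp (fun x => (p x : ℂ)) 2 muc →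
      HasSum (fun k => (fcR (fun x => u x i - v x i) k * (starRingEnd ℂ) (fcR p k)).re)
        (1 / (2 * π) * ∫ x, (u x i - v x i) * p x ∂muc) := fun {p} hp => by
    have h := hasSum_fc_mul_conj hz.mem hp
    have e : (((1 / (2 * π) : ℝ) : ℂ) * ∫ x, ((u x i - v x i : ℝ) : ℂ)
        * (starRingEnd ℂ) ((p x : ℝ) : ℂ) ∂muc)
        = ((1 / (2 * π) * ∫ x, (u x i - v x i) * p x ∂muc : ℝ) : ℂ) := by
      rw [Complex.ofReal_mul, ← integral_complex_ofReal]
      congr 2; ext x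
      rw [Complex.conj_ofReal, Complex.ofReal_mul]
    rw [e] at h
    exact Complex.hasSum_re h
  have h3 := (c mF).sub (c mω)
  have h4 : HasSum (fun k : ℤ => 2 * π * ((k.natAbs : ℝ) * ‖fcR (fun x => u x i - v x i) k‖ ^ 2))
      (1 / (2 * π) * (∫ x, (u x i - v x i) * (l x * u x i - m x * v x i) ∂muc)
        - 1 / (2 * π) * ∫ x, (u x i - v x i) * (f i x - g i x) ∂muc) := by
    refine Eq.subst (motive := fun z => HasSum z _) (funext fun k => ?_) h3
    rw [e1, ← Complex.sub_re, ← mul_sub, ← map_sub, add_sub_cancel_left, map_mul,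
      Complex.conj_ofReal, mul_left_comm, Complex.mul_conj, ← Complex.ofReal_mul,
      Complex.ofReal_re, Complex.normSq_eq_norm_sq]
    ring
  have h5 := h4.tsum_eq
  rw [tsum_mul_left] at h5
  have hπ := pi_pos
  have h6 : 2 * π * (1 / (2 * π)) = 1 := by field_simp
  linear_combination (2 * π) * h5 + ((∫ x, (u x i - v x i) * (l x * u x i - m x * v x i) ∂muc)
        - ∫ x, (u x i - v x i) * (f i x - g i x) ∂muc) * h6

lemma sphere_diff_identity {ι : Type*} [Fintype ι] {a b : ι → ℝ} (ha : ∑ i, a i ^ 2 = 1)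
    (hb : ∑ i, b i ^ 2 = 1) (p q : ℝ) :
    ∑ i, (a i - b i) * (p * a i - q * b i) = ∑ i, (p + q) / 2 * (a i - b i) ^ 2 := by
  have h1 : ∀ i, (a i - b i) * (p * a i - q * b i)
      = (p + q) / 2 * (a i - b i) ^ 2 + (p - q) / 2 * (a i ^ 2 - b i ^ 2) := fun i => by ring
  simp only [h1, Finset.sum_add_distrib, ← Finset.mul_sum, Finset.sum_sub_distrib, ha, hb]
  ring

/-- Growth of the squared distance of two solutions of small energy. -/
lemma SliceSol.sum_integral_diff_le (hu : SliceSol u l f) (hv : SliceSol v m g)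
    (hεu : 24 * n ^ 2 * (1 + 8 * n ^ 2) * hHalf u ≤ 1)
    (hεv : 24 * n ^ 2 * (1 + 8 * n ^ 2) * hHalf v ≤ 1) :
    ∑ i, ∫ x, (u x i - v x i) * (f i x - g i x) ∂muc
      ≤ (1 + (2 + 128 * π ^ 2 * n) * (∑ i, ∫ x, f i x ^ 2 ∂muc + ∑ i, ∫ x, g i x ^ 2 ∂muc))
        * ∑ i, ∫ x, (u x i - v x i) ^ 2 ∂muc := by
  have hz : ∀ i, HalfReg (fun x => u x i - v x i) := fun i => by
    simpa only [sub_eq_add_neg] using (hu.reg.half i).add (hv.reg.half i).neg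
  have ml := hu.memLp_lagrange hεu
  have mm := hv.memLp_lagrange hεv
  have mp : MemLp (fun x => (l x + m x) / 2) 2 muc := by
    have := (ml.add mm).const_mul (1 / 2)
    refine (memLp_congr_ae (Eventually.of_forall fun x => ?_)).mp this
    simp only [Pi.add_apply]; ring
  have mz2 : ∀ i, MemLp (fun x => (((u x i - v x i) ^ 2 : ℝ) : ℂ)) 2 muc := fun i => by
    refine memLp_of_bdd (Complex.measurable_ofReal.comp
      ((hz i).meas.pow_const 2)).aestronglyMeasurable (C := 4) ?_ 2
    filter_upwards [hu.reg.abs_le i, hv.reg.abs_le i] with x h1 h2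
    rw [Complex.norm_real, Real.norm_eq_abs, abs_le] at h1 h2
    rw [Function.comp_apply, Complex.norm_real, Real.norm_of_nonneg (sq_nonneg _)]
    nlinarith
  have hL : ∫ x, ((l x + m x) / 2) ^ 2 ∂muc ≤ (2 + 128 * π ^ 2 * n) / 2 *
      (∑ i, ∫ x, f i x ^ 2 ∂muc + ∑ i, ∫ x, g i x ^ 2 ∂muc) := by
    have h1 : ∫ x, ((l x + m x) / 2) ^ 2 ∂muc ≤ ∫ x, (l x ^ 2 / 2 + m x ^ 2 / 2) ∂muc :=
      integral_mono mp.integrable_sq ((ml.integrable_sq.div_const 2).add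
        (mm.integrable_sq.div_const 2)) fun x => by nlinarith [sq_nonneg (l x - m x)]
    rw [integral_add (ml.integrable_sq.div_const 2) (mm.integrable_sq.div_const 2),
      integral_div, integral_div] at h1
    linarith [hu.integral_lagrange_sq_le hεu, hv.integral_lagrange_sq_le hεv]
  set L := ∫ x, ((l x + m x) / 2) ^ 2 ∂muc with hLdef
  have hL0 : 0 ≤ L := integral_nonneg fun x => sq_nonneg _
  have iF : ∀ i, Integrable (fun x => (u x i - v x i) * (l x * u x i - m x * v x i)) muc :=
    fun i => (memLp_of_ofReal (hz i).mem).integrable_mul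
      ((memLp_of_ofReal (hu.memLp_density hεu i)).sub (memLp_of_ofReal (hv.memLp_density hεv i)))
  have iG : ∀ i, Integrable (fun x => (l x + m x) / 2 * (u x i - v x i) ^ 2) muc :=
    fun i => mp.integrable_mul (memLp_of_ofReal (mz2 i))
  have hsum : ∑ i, ∫ x, (u x i - v x i) * (l x * u x i - m x * v x i) ∂muc
      = ∑ i, ∫ x, (l x + m x) / 2 * (u x i - v x i) ^ 2 ∂muc := by
    rw [← integral_finsetSum _ fun i _ => iF i, ← integral_finsetSum _ fun i _ => iG i]
    refine integral_congr_ae ?_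
    filter_upwards [hu.reg.sum_sq, hv.reg.sum_sq] with x h1 h2
    exact sphere_diff_identity h1 h2 _ _
  have hi : ∀ i, (∫ x, (l x + m x) / 2 * (u x i - v x i) ^ 2 ∂muc) - 4 * π ^ 2 *
      ∑' k : ℤ, (k.natAbs : ℝ) * ‖fcR (fun x => u x i - v x i) k‖ ^ 2
      ≤ (1 + 2 * L) * ∫ x, (u x i - v x i) ^ 2 ∂muc := by
    intro i
    have h1 := integral_mul_sq_le mp (memLp_of_ofReal (mz2 i))
    have h2 := (hz i).integral_sq_sq_le (mz2 i)
    have h3 := (hasSum_fcR_sq (hz i).mem).tsum_eq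
    set H := ∑' k : ℤ, (k.natAbs : ℝ) * ‖fcR (fun x => u x i - v x i) k‖ ^ 2
    set Y := ∑' k : ℤ, ‖fcR (fun x => u x i - v x i) k‖ ^ 2
    have p1 : 0 ≤ H := tsum_nonneg fun k => by positivity
    have p2 : 0 ≤ Y := tsum_nonneg fun k => by positivity
    have hπ := pi_gt_three
    have e : ∫ x, (u x i - v x i) ^ 2 ∂muc = 2 * π * Y := by rw [h3]; field_simp
    rw [e]
    set P := ∫ x, (l x + m x) / 2 * (u x i - v x i) ^ 2 ∂muc
    have h4 : P ^ 2 ≤ (8 * π * L * Y) * (2 * H + Y) :=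
      h1.trans ((mul_le_mul_of_nonneg_left h2 hL0).trans (le_of_eq (by ring)))
    have h5 : P ≤ (8 * π * L * Y + (2 * H + Y)) / 2 := by
      refine le_of_sq_le_sq ?_ (by positivity)
      nlinarith [sq_nonneg (8 * π * L * Y - (2 * H + Y))]
    have h6 : H ≤ 4 * π ^ 2 * H := le_mul_of_one_le_left p1 (by nlinarith)
    have h7 : Y ≤ 4 * π * Y := le_mul_of_one_le_left p2 (by linarith)
    linarith
  rw [Finset.sum_congr rfl fun i _ => hu.integral_diff hv hεu hεv i, Finset.sum_sub_distrib, hsum,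
    ← Finset.sum_sub_distrib]
  refine (Finset.sum_le_sum fun i _ => hi i).trans ?_
  rw [← Finset.mul_sum]
  refine mul_le_mul_of_nonneg_right (by linarith)
    (Finset.sum_nonneg fun i _ => integral_nonneg fun x => sq_nonneg _)

end

lemma exists_subset_Ioo_of_isCompact {K : Set ℝ} (hK : IsCompact K) (h0 : K ⊆ Set.Ioi 0) :
    ∃ α β : ℝ, 0 < α ∧ α < β ∧ K ⊆ Set.Ioo α β := by
  rcases K.eq_empty_or_nonempty with rfl | hne
  · exact ⟨1, 2, by norm_num, by norm_num, Set.empty_subset _⟩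
  obtain ⟨p, hp, hpl⟩ := hK.exists_isLeast hne
  obtain ⟨q, hq, hqg⟩ := hK.exists_isGreatest hne
  have h1 : 0 < p := h0 hp
  have h2 : p ≤ q := hpl hq
  exact ⟨p / 2, q + 1, by linarith, by linarith,
    fun x hx => ⟨by linarith [hpl hx], by linarith [hqg hx]⟩⟩

/-- The primitive, supported in `(0, ∞)`, of a test function of vanishing integral. -/
lemma exists_primitive_test {θ : ℝ → ℝ} (h1 : ContDiff ℝ (⊤ : ℕ∞) θ) (h2 : HasCompactSupport θ)
    (h3 : tsupport θ ⊆ Set.Ioi 0) (h0 : ∫ t, θ t = 0) :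
    ∃ Θ : ℝ → ℝ, ContDiff ℝ (⊤ : ℕ∞) Θ ∧ HasCompactSupport Θ ∧ tsupport Θ ⊆ Set.Ioi 0 ∧
      deriv Θ = θ := by
  obtain ⟨α, β, hα, hαβ, hK⟩ := exists_subset_Ioo_of_isCompact h2.isCompact h3
  have hz : ∀ t, t ∉ Set.Ioo α β → θ t = 0 := fun t ht =>
    image_eq_zero_of_notMem_tsupport fun h => ht (hK h)
  set Θ : ℝ → ℝ := fun t => ∫ s in α..t, θ s with hΘ
  have hd : ∀ t, HasDerivAt Θ (θ t) t := fun t =>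
    h1.continuous.integral_hasStrictDerivAt α t |>.hasDerivAt
  have hd' : deriv Θ = θ := funext fun t => (hd t).deriv
  have hs : tsupport Θ ⊆ Set.Icc α β := by
    refine closure_minimal (fun t ht => ?_) isClosed_Icc
    by_contra hn
    refine ht ?_
    rw [Set.mem_Icc, not_and_or, not_le, not_le] at hn
    rcases hn with hn | hn
    · simp only [hΘ]
      rw [intervalIntegral.integral_congr (g := fun _ => 0)]
      · simp
      · intro s hs
        rw [Set.uIcc_of_ge hn.le] at hs
        exact hz s fun h => absurd hs.2 (not_le.2 h.1)
    · simp only [hΘ]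
      rw [intervalIntegral.integral_eq_integral_of_support_subset, h0]
      intro s hs
      by_contra hs'
      exact hs (hz s fun h => hs' ⟨h.1, h.2.le.trans hn.le⟩)
  refine ⟨Θ, ?_, isCompact_Icc.of_isClosed_subset (isClosed_tsupport _) hs,
    fun t ht => hα.trans_le (hs ht).1, hd'⟩
  rw [contDiff_infty_iff_deriv, hd']
  exact ⟨fun t => (hd t).differentiableAt, h1⟩

lemma intervalIntegrable_of_Ioc {b : ℝ → ℝ} (hb : ∀ T, IntegrableOn b (Set.Ioc 0 T)) {s t : ℝ}
    (hs : 0 ≤ s) (ht : 0 ≤ t) : IntervalIntegrable b volume s t := by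
  rw [intervalIntegrable_iff]
  refine (hb (max s t)).mono_set ?_
  exact Set.Ioc_subset_Ioc_left (le_min hs ht)

lemma integral_deriv_mul_primitive {b η : ℝ → ℝ} (hb : ∀ T, IntegrableOn b (Set.Ioc 0 T))
    (h1 : ContDiff ℝ (⊤ : ℕ∞) η) (h2 : HasCompactSupport η) (h3 : tsupport η ⊆ Set.Ioi 0) :
    ∫ t in Set.Ioi 0, deriv η t * (∫ s in (0 : ℝ)..t, b s) = -∫ t in Set.Ioi 0, η t * b t := by
  obtain ⟨α, β, hα, hαβ, hK⟩ := exists_subset_Ioo_of_isCompact h2.isCompact h3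
  have hz : ∀ t, t ∉ Set.Ioo α β → η t = 0 := fun t ht =>
    image_eq_zero_of_notMem_tsupport fun h => ht (hK h)
  have hz' : ∀ t, t ∉ Set.Ioo α β → deriv η t = 0 := fun t ht =>
    image_eq_zero_of_notMem_tsupport fun h => ht (hK (tsupport_deriv_subset h))
  have hβ : 0 ≤ β := (hα.trans hαβ).le
  have key : ∀ f : ℝ → ℝ, (∀ t, t ∉ Set.Ioo α β → f t = 0) →
      ∫ t in Set.Ioi 0, f t = ∫ t in (0 : ℝ)..β, f t := by
    intro f hf
    rw [intervalIntegral.integral_of_le hβ]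
    refine (setIntegral_eq_of_subset_of_forall_sdiff_eq_zero measurableSet_Ioi
      Set.Ioc_subset_Ioi_self fun t ht => hf t fun h => ht.2 ⟨ht.1, h.2.le⟩)
  rw [key _ fun t ht => by rw [hz' t ht, zero_mul], key _ fun t ht => by rw [hz t ht, zero_mul]]
  have hI : IntervalIntegrable b volume 0 β := intervalIntegrable_of_Ioc hb le_rfl hβ
  have hB := hI.absolutelyContinuousOnInterval_intervalIntegral (c := 0) (by simp)
  have hη : AbsolutelyContinuousOnInterval η 0 β :=
    ((h1.of_le (by norm_cast)).contDiffOn (n := 1)).absolutelyContinuousOnInterval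
  have := hη.integral_mul_deriv_eq_deriv_mul hB
  rw [hz β fun h => lt_irrefl _ h.2, hz 0 fun h => not_lt.2 hα.le h.1] at this
  simp only [zero_mul, sub_zero, zero_sub] at this
  rw [← neg_eq_iff_eq_neg, ← this]
  refine intervalIntegral.integral_congr_ae ?_
  filter_upwards [hI.ae_hasDerivAt_integral] with t ht htm
  rw [(ht (Set.uIoc_subset_uIcc htm) 0 (by simp)).deriv]

lemma exists_ae_eq_const_add_integral {a b : ℝ → ℝ} (ha : ∀ T, IntegrableOn a (Set.Ioc 0 T))
    (hb : ∀ T, IntegrableOn b (Set.Ioc 0 T))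
    (h : ∀ η : ℝ → ℝ, ContDiff ℝ (⊤ : ℕ∞) η → HasCompactSupport η → tsupport η ⊆ Set.Ioi 0 →
      ∫ t in Set.Ioi 0, deriv η t * a t = -∫ t in Set.Ioi 0, η t * b t) :
    ∃ c, ∀ᵐ t ∂(volume.restrict (Set.Ioi (0 : ℝ))), a t = c + ∫ s in (0 : ℝ)..t, b s := by
  set B : ℝ → ℝ := fun t => ∫ s in (0 : ℝ)..t, b s with hBdef
  have hBi : ∀ T, IntegrableOn B (Set.Ioc 0 T) := by
    intro T
    rcases le_total T 0 with hT | hT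
    · simp [Set.Ioc_eq_empty (not_lt.2 hT)]
    have hI : IntervalIntegrable b volume 0 T := intervalIntegrable_of_Ioc hb le_rfl hT
    have hB := hI.absolutelyContinuousOnInterval_intervalIntegral (c := 0) (by simp)
    have := hB.continuousOn
    rw [Set.uIcc_of_le hT] at this
    exact (this.integrableOn_compact isCompact_Icc).mono_set Set.Ioc_subset_Icc_self
  have hD : ∀ T, IntegrableOn (fun t => a t - B t) (Set.Ioc 0 T) := fun T => (ha T).sub (hBi T)
  have hDz : ∀ η : ℝ → ℝ, ContDiff ℝ (⊤ : ℕ∞) η → HasCompactSupport η →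
      tsupport η ⊆ Set.Ioi 0 → ∫ t in Set.Ioi 0, deriv η t * (a t - B t) = 0 := by
    intro η h1 h2 h3
    have hη' : Continuous (deriv η) := h1.continuous_deriv (by norm_cast)
    simp only [mul_sub]
    rw [integral_sub (integrableOn_compactSupport_mul hη' h2.deriv ha)
      (integrableOn_compactSupport_mul hη' h2.deriv hBi), h η h1 h2 h3,
      integral_deriv_mul_primitive hb h1 h2 h3, sub_self]
  let φ : ContDiffBump (1 : ℝ) := ⟨1 / 4, 1 / 2, by norm_num, by norm_num⟩
  set η₀ : ℝ → ℝ := φ.normed volume with hη₀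
  have g1 : ContDiff ℝ (⊤ : ℕ∞) η₀ := φ.contDiff_normed
  have g2 : HasCompactSupport η₀ := φ.hasCompactSupport_normed
  have g3 : tsupport η₀ ⊆ Set.Ioi 0 := by
    rw [hη₀, φ.tsupport_normed_eq, Real.closedBall_eq_Icc]
    intro t ht
    have := ht.1
    simp only [φ] at this
    rw [Set.mem_Ioi]
    norm_num at this
    linarith
  have g0 : ∫ t, η₀ t = 1 := φ.integral_normed
  refine ⟨∫ t in Set.Ioi 0, η₀ t * (a t - B t), ?_⟩
  set c := ∫ t in Set.Ioi 0, η₀ t * (a t - B t) with hc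
  have hcT : ∀ T : ℝ, IntegrableOn (fun _ : ℝ => c) (Set.Ioc 0 T) := fun T =>
    integrableOn_const (by simp)
  have := ae_eq_zero_of_integral_test (g := fun t => a t - B t - c) (fun T => (hD T).sub (hcT T)) ?_
  · filter_upwards [this] with t ht
    linarith
  intro η h1 h2 h3
  set m := ∫ t, η t with hm
  have hts : tsupport (fun t => η t - m * η₀ t) ⊆ tsupport η ∪ tsupport η₀ := by
    refine closure_minimal (fun t ht => ?_) ((isClosed_tsupport _).union (isClosed_tsupport _))
    by_contra hn
    rw [Set.mem_union, not_or] at hn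
    refine ht ?_
    simp only
    rw [image_eq_zero_of_notMem_tsupport hn.1, image_eq_zero_of_notMem_tsupport hn.2]
    simp
  obtain ⟨Θ, k1, k2, k3, k4⟩ := exists_primitive_test (θ := fun t => η t - m * η₀ t)
    (h1.sub (contDiff_const.mul g1))
    ((h2.isCompact.union g2.isCompact).of_isClosed_subset (isClosed_tsupport _) hts)
    (hts.trans (Set.union_subset h3 g3)) (by
      rw [integral_sub (h1.continuous.integrable_of_hasCompactSupport h2)
        ((g1.continuous.integrable_of_hasCompactSupport g2).const_mul m),
        integral_const_mul, g0, ← hm, mul_one, sub_self])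
  have e := hDz Θ k1 k2 k3
  rw [k4] at e
  have i1 := integrableOn_compactSupport_mul h1.continuous h2 hD
  have i2 := integrableOn_compactSupport_mul g1.continuous g2 hD
  have e1 : ∫ t in Set.Ioi 0, (η t - m * η₀ t) * (a t - B t)
      = (∫ t in Set.Ioi 0, η t * (a t - B t)) - m * c := by
    rw [hc, ← integral_const_mul, ← integral_sub i1 (i2.const_mul m)]
    exact integral_congr_ae (Eventually.of_forall fun t => by ring)
  have e2 : ∫ t in Set.Ioi 0, η t * (a t - B t - c)
      = (∫ t in Set.Ioi 0, η t * (a t - B t)) - m * c := by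
    have : ∫ t in Set.Ioi 0, η t = m :=
      setIntegral_eq_integral_of_forall_compl_eq_zero fun t ht =>
        image_eq_zero_of_notMem_tsupport fun h => ht (h3 h)
    rw [← this, ← integral_mul_const, ← integral_sub i1
      ((h1.continuous.integrable_of_hasCompactSupport h2).integrableOn.mul_const c)]
    exact integral_congr_ae (Eventually.of_forall fun t => by ring)
  rw [e2, ← e1, e]

section

variable {n : ℕ} {u₀ : ℝ → E n} {u w : ℝ → ℝ → E n}

lemma neBot_nhdsGT_inf_ae :
    (𝓝[>] (0 : ℝ) ⊓ ae (volume.restrict (Set.Ioi (0 : ℝ)))).NeBot := by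
  rw [inf_neBot_iff]
  intro s hs t ht
  obtain ⟨δ, hδ, hs⟩ := mem_nhdsGT_iff_exists_Ioo_subset.1 hs
  have h0 : (volume.restrict (Set.Ioi (0 : ℝ))) (Set.Ioo 0 δ) ≠ 0 := by
    rw [Measure.restrict_apply measurableSet_Ioo,
      Set.inter_eq_left.2 Set.Ioo_subset_Ioi_self, Real.volume_Ioo]
    simpa using hδ
  obtain ⟨x, hx, hxt⟩ := (frequently_ae_mem_iff.2 h0).and_eventually ht |>.exists
  exact ⟨x, hs hx, hxt⟩

lemma tendsto_intervalIntegral_nhdsGT {b : ℝ → ℝ} (hb : ∀ T, IntegrableOn b (Set.Ioc 0 T)) :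
    Tendsto (fun t => ∫ s in (0 : ℝ)..t, b s) (𝓝[>] 0) (𝓝 0) := by
  have hI : IntervalIntegrable b volume 0 1 := intervalIntegrable_of_Ioc hb le_rfl zero_le_one
  have h1 := (hI.absolutelyContinuousOnInterval_intervalIntegral (c := 0) (by simp)).continuousOn
  rw [Set.uIcc_of_le zero_le_one] at h1
  have h2 := (h1 0 (by simp)).mono_left (nhdsWithin_mono 0 Set.Ioc_subset_Icc_self)
  simpa only [nhdsWithin_Ioc_eq_nhdsGT zero_lt_one, intervalIntegral.integral_same] using h2

lemma IsEnergySolAux.slice_weakDeriv (h : IsEnergySolAux n u₀ u w) (i : Fin n) {ψ : ℝ → ℝ}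
    (hψ : ContDiff ℝ (⊤ : ℕ∞) ψ) (hp : Function.Periodic ψ (2 * π)) {η : ℝ → ℝ}
    (h1 : ContDiff ℝ (⊤ : ℕ∞) η) (h2 : HasCompactSupport η) (h3 : tsupport η ⊆ Set.Ioi 0) :
    ∫ t in Set.Ioi 0, deriv η t * ∫ x, u t x i * ψ x ∂muc
      = -∫ t in Set.Ioi 0, η t * ∫ x, w t x i * ψ x ∂muc := by
  have hf := h.weakDeriv _ (isSTTest_single i h1 h2 h3 hψ hp)
  have hd : ∀ t x (j : Fin n), deriv (fun s =>
      ((η s * ψ x) • EuclideanSpace.single i (1 : ℝ) : E n) j) t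
      = ((deriv η t * ψ x) • EuclideanSpace.single i (1 : ℝ) : E n) j := by
    intro t x j
    simp only [PiLp.smul_apply, smul_eq_mul]
    rw [deriv_mul_const_field, deriv_mul_const_field]
  simp only [hd, sum_mul_smul_single (fun j => u _ _ j),
    sum_mul_smul_single (fun j => w _ _ j)] at hf
  simp only [← integral_const_mul]
  calc _ = _ := ?_
    _ = _ := hf
    _ = _ := ?_
  · congr 1; ext t; congr 1; ext x; ring
  · congr 2; ext t; congr 1; ext x; ring

lemma SphereReg.sq_integral_sub_le {a : ℝ → E n} (ha : SphereReg a) (hm₀ : Measurable u₀)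
    (hn₀ : ∀ x, ‖u₀ x‖ = 1) {ψ : ℝ → ℝ} (hψ : Continuous ψ) (hb : ∀ x, |ψ x| ≤ 1) (i : Fin n)
    (hfin : ∫⁻ x in circ, (‖a x - u₀ x‖₊ : ℝ≥0∞) ^ 2 ≠ ⊤) :
    ((∫ x, a x i * ψ x ∂muc) - ∫ x, u₀ x i * ψ x ∂muc) ^ 2
      ≤ (∫⁻ x in circ, (‖a x - u₀ x‖₊ : ℝ≥0∞) ^ 2).toReal * ∫ x, ψ x ^ 2 ∂muc := by
  have m0 : MemLp (fun x => u₀ x i) 2 muc :=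
    MemLp.of_bound (measurable_coord hm₀ i).aestronglyMeasurable 1
      (Eventually.of_forall fun x => (PiLp.norm_apply_le (u₀ x) i).trans (hn₀ x).le)
  have ma : MemLp (fun x => a x i) 2 muc := memLp_of_ofReal (ha.half i).mem
  have mψ : MemLp ψ 2 muc :=
    MemLp.of_bound hψ.aestronglyMeasurable 1 (Eventually.of_forall fun x => hb x)
  have md : MemLp (fun x => a x i - u₀ x i) 2 muc := ma.sub m0
  have Ia : Integrable (fun x => a x i * ψ x) muc := ma.integrable_mul mψ
  have I0 : Integrable (fun x => u₀ x i * ψ x) muc := m0.integrable_mul mψ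
  rw [← integral_sub Ia I0]
  simp only [← sub_mul]
  refine (integral_mul_sq_le md mψ).trans ?_
  refine mul_le_mul_of_nonneg_right ?_ (integral_nonneg fun x => sq_nonneg _)
  rw [integral_eq_lintegral_of_nonneg_ae (Eventually.of_forall fun x => sq_nonneg _)
    md.integrable_sq.aestronglyMeasurable]
  refine ENNReal.toReal_mono hfin (lintegral_mono fun x => ?_)
  rw [← sq_abs, ENNReal.ofReal_pow (abs_nonneg _), ← Real.norm_eq_abs, ofReal_norm]
  gcongr
  rw [enorm_eq_nnnorm]
  exact_mod_cast PiLp.norm_apply_le (a x - u₀ x) i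

lemma IsEnergySolAux.slice_eq (h : IsEnergySolAux n u₀ u w) (hm₀ : Measurable u₀)
    (hn₀ : ∀ x, ‖u₀ x‖ = 1) (i : Fin n) {ψ : ℝ → ℝ} (hψ : ContDiff ℝ (⊤ : ℕ∞) ψ)
    (hp : Function.Periodic ψ (2 * π)) (hb : ∀ x, |ψ x| ≤ 1) :
    ∀ᵐ t ∂(volume.restrict (Set.Ioi (0 : ℝ))),
      ∫ x, u t x i * ψ x ∂muc = (∫ x, u₀ x i * ψ x ∂muc)
        + ∫ s in (0 : ℝ)..t, ∫ x, w s x i * ψ x ∂muc := by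
  have Ib : ∀ T, IntegrableOn (fun t => ∫ x, w t x i * ψ x ∂muc) (Set.Ioc 0 T) := fun T =>
    integrableOn_slice ((h.memLp_w T i).integrable one_le_two) hψ.continuous hb
  obtain ⟨c, hc⟩ := exists_ae_eq_const_add_integral
    (fun T => integrableOn_slice (h.integrable_u T i) hψ.continuous hb) Ib
    fun η h1 h2 h3 => h.slice_weakDeriv i hψ hp h1 h2 h3
  suffices c = ∫ x, u₀ x i * ψ x ∂muc by rwa [← this]
  have := neBot_nhdsGT_inf_ae
  set F := 𝓝[>] (0 : ℝ) ⊓ ae (volume.restrict (Set.Ioi (0 : ℝ)))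
  have l1 : Tendsto (fun t => (c + (∫ s in (0 : ℝ)..t, ∫ x, w s x i * ψ x ∂muc)
      - ∫ x, u₀ x i * ψ x ∂muc) ^ 2) F (𝓝 ((c + 0 - ∫ x, u₀ x i * ψ x ∂muc) ^ 2)) :=
    ((((tendsto_intervalIntegral_nhdsGT Ib).mono_left inf_le_left).const_add c).sub_const _).pow 2
  have l2 : Tendsto (fun t => (∫⁻ x in circ, (‖u t x - u₀ x‖₊ : ℝ≥0∞) ^ 2).toReal
      * ∫ x, ψ x ^ 2 ∂muc) F (𝓝 ((0 : ℝ≥0∞).toReal * ∫ x, ψ x ^ 2 ∂muc)) :=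
    (((ENNReal.tendsto_toReal ENNReal.zero_ne_top).comp h.init).mono_left inf_le_left).mul_const _
  have l3 := le_of_tendsto_of_tendsto l1 l2 (by
    have e1 : ∀ᶠ t in F, ∫⁻ x in circ, (‖u t x - u₀ x‖₊ : ℝ≥0∞) ^ 2 < ⊤ :=
      inf_le_left (α := Filter ℝ) (h.init.eventually_lt_const ENNReal.zero_lt_top)
    have e2 : ∀ᶠ t in F, _ := inf_le_right (α := Filter ℝ) hc
    have e3 : ∀ᶠ t in F, _ := inf_le_right (α := Filter ℝ) h.sphereReg
    filter_upwards [e1, e2, e3] with t t1 t2 t3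
    rw [← t2]
    exact t3.sq_integral_sub_le hm₀ hn₀ hψ.continuous hb i t1.ne)
  simp only [ENNReal.toReal_zero, zero_mul, add_zero] at l3
  exact sub_eq_zero.1 (pow_eq_zero_iff two_ne_zero |>.1 (le_antisymm l3 (sq_nonneg _)))

lemma IsEnergySolAux.integrable_primitive (h : IsEnergySolAux n u₀ u w) (i : Fin n) (t : ℝ) :
    Integrable (fun x => ∫ s in Set.Ioc 0 t, w s x i) muc :=
  ((h.memLp_w t i).integrable one_le_two).integral_prod_right

lemma IsEnergySolAux.integral_primitive_mul (h : IsEnergySolAux n u₀ u w) (i : Fin n) (t : ℝ)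
    {ψ : ℝ → ℝ} (hψ : Continuous ψ) (hb : ∀ x, |ψ x| ≤ 1) :
    ∫ x, (∫ s in Set.Ioc 0 t, w s x i) * ψ x ∂muc
      = ∫ s in Set.Ioc 0 t, ∫ x, w s x i * ψ x ∂muc := by
  simp only [← integral_mul_const]
  rw [integral_integral_swap]
  have : Integrable (fun p : ℝ × ℝ => w p.1 p.2 i * ψ p.2)
      ((volume.restrict (Set.Ioc (0 : ℝ) t)).prod muc) :=
    ((h.memLp_w t i).integrable one_le_two).mul_bdd (c := 1)
      (hψ.comp continuous_snd).aestronglyMeasurable (Eventually.of_forall fun p => hb p.2)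
  exact this.swap

/-- The time slices of a solution are obtained by integrating the weak time derivative. -/
lemma IsEnergySolAux.ae_eq_add_integral (h : IsEnergySolAux n u₀ u w) (hm₀ : Measurable u₀)
    (hn₀ : ∀ x, ‖u₀ x‖ = 1) :
    ∀ᵐ t ∂(volume.restrict (Set.Ioi (0 : ℝ))), ∀ i, ∀ᵐ x ∂muc,
      u t x i = u₀ x i + ∫ s in Set.Ioc 0 t, w s x i := by
  have hc : ∀ᵐ t ∂(volume.restrict (Set.Ioi (0 : ℝ))), ∀ (i : Fin n) (k : ℤ), _ :=
    ae_all_iff.mpr fun i => ae_all_iff.mpr fun k =>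
      h.slice_eq hm₀ hn₀ i (ψ := fun x => Real.cos (k * x)) (by fun_prop)
        (periodic_int_mul Real.cos_periodic k) (fun x => Real.abs_cos_le_one _)
  have hs : ∀ᵐ t ∂(volume.restrict (Set.Ioi (0 : ℝ))), ∀ (i : Fin n) (k : ℤ), _ :=
    ae_all_iff.mpr fun i => ae_all_iff.mpr fun k =>
      h.slice_eq hm₀ hn₀ i (ψ := fun x => Real.sin (k * x)) (by fun_prop)
        (periodic_int_mul Real.sin_periodic k) (fun x => Real.abs_sin_le_one _)
  filter_upwards [hc, hs, h.sphereReg, ae_restrict_mem measurableSet_Ioi] with t h1 h2 h3 h0 i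
  have hpi : ((2 * π : ℝ) : ℂ) ≠ 0 := by exact_mod_cast Real.two_pi_pos.ne'
  have I0 : Integrable (fun x => u₀ x i) muc :=
    Integrable.of_bound (measurable_coord hm₀ i).aestronglyMeasurable 1
      (Eventually.of_forall fun x => (PiLp.norm_apply_le (u₀ x) i).trans (hn₀ x).le)
  have IW := h.integrable_primitive i t
  have Iu := (h3.half i).integrable
  have IuW : Integrable (fun x => u₀ x i + ∫ s in Set.Ioc 0 t, w s x i) muc := I0.add IW
  have key : ∀ k, fc (fun x => (u t x i : ℂ)) k
      = fc (fun x => ((u₀ x i + ∫ s in Set.Ioc 0 t, w s x i : ℝ) : ℂ)) k := by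
    intro k
    change fcR (fun x => u t x i) k = fcR (fun x => u₀ x i + ∫ s in Set.Ioc 0 t, w s x i) k
    apply mul_left_cancel₀ hpi
    have split : ∀ ψ : ℝ → ℝ, Continuous ψ → (∀ x, |ψ x| ≤ 1) →
        ∫ x, (u₀ x i + ∫ s in Set.Ioc 0 t, w s x i) * ψ x ∂muc
          = (∫ x, u₀ x i * ψ x ∂muc) + ∫ s in (0 : ℝ)..t, ∫ x, w s x i * ψ x ∂muc := by
      intro ψ hψ hb
      rw [intervalIntegral.integral_of_le (Set.mem_Ioi.1 h0).le,
        ← h.integral_primitive_mul i t hψ hb, ← integral_add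
        (I0.mul_bdd (c := 1) hψ.aestronglyMeasurable (Eventually.of_forall hb))
        (IW.mul_bdd (c := 1) hψ.aestronglyMeasurable (Eventually.of_forall hb))]
      simp only [add_mul]
    rw [fcR_eq_cos_sin Iu, fcR_eq_cos_sin IuW, h1 i k, h2 i k,
      ← split _ (by fun_prop) fun x => Real.abs_cos_le_one _,
      ← split _ (by fun_prop) fun x => Real.abs_sin_le_one _]
  filter_upwards [ae_eq_of_fc_eq Iu.ofReal IuW.ofReal key] with x hx
  exact_mod_cast hx

end

lemma sq_integral_Ioc_eq {b : ℝ → ℝ} {t : ℝ} (ht : 0 ≤ t) (hb : IntegrableOn b (Set.Ioc 0 t)) :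
    (∫ s in Set.Ioc 0 t, b s) ^ 2
      = 2 * ∫ s in Set.Ioc 0 t, (∫ r in Set.Ioc 0 s, b r) * b s := by
  have hI : IntervalIntegrable b volume 0 t :=
    (intervalIntegrable_iff_integrableOn_Ioc_of_le ht).2 hb
  have hB := hI.absolutelyContinuousOnInterval_intervalIntegral (c := 0) (by simp)
  have h1 := hB.integral_mul_deriv_eq_deriv_mul hB
  have h2 : ∫ s in (0 : ℝ)..t, (∫ r in (0 : ℝ)..s, b r) * deriv (fun s => ∫ r in (0 : ℝ)..s, b r) s
      = ∫ s in Set.Ioc 0 t, (∫ r in Set.Ioc 0 s, b r) * b s := by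
    rw [intervalIntegral.integral_of_le ht]
    refine integral_congr_ae ?_
    rw [EventuallyEq, ae_restrict_iff' measurableSet_Ioc]
    filter_upwards [hI.ae_hasDerivAt_integral] with s hs hsm
    rw [(hs (by rw [Set.uIcc_of_le ht]; exact ⟨hsm.1.le, hsm.2⟩) 0 (by simp)).deriv,
      intervalIntegral.integral_of_le hsm.1.le]
  simp only [mul_comm (deriv _ _)] at h1
  rw [h2, intervalIntegral.integral_same, intervalIntegral.integral_of_le ht] at h1
  linarith

lemma continuousOn_primitive_Icc {P : ℝ → ℝ} (hP : ∀ T, IntegrableOn P (Set.Ioc 0 T)) {T : ℝ}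
    (hT : 0 ≤ T) : ContinuousOn (fun t => ∫ s in (0 : ℝ)..t, P s) (Set.Icc 0 T) := by
  have hI : IntervalIntegrable P volume 0 T := intervalIntegrable_of_Ioc hP le_rfl hT
  have := (hI.absolutelyContinuousOnInterval_intervalIntegral (c := 0) (by simp)).continuousOn
  rwa [Set.uIcc_of_le hT] at this

/-- A Gronwall inequality with an integrable coefficient. -/
lemma ae_nonpos_of_gronwall {y P c : ℝ → ℝ} (hP : ∀ T, IntegrableOn P (Set.Ioc 0 T))
    (hc : ∀ T, IntegrableOn c (Set.Ioc 0 T))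
    (hc0 : ∀ᵐ t ∂(volume.restrict (Set.Ioi (0 : ℝ))), 0 ≤ c t)
    (hy : ∀ᵐ t ∂(volume.restrict (Set.Ioi (0 : ℝ))), y t = ∫ s in (0 : ℝ)..t, P s)
    (hPy : ∀ᵐ t ∂(volume.restrict (Set.Ioi (0 : ℝ))), P t ≤ c t * y t) :
    ∀ᵐ t ∂(volume.restrict (Set.Ioi (0 : ℝ))), y t ≤ 0 := by
  set Q : ℝ → ℝ := fun t => ∫ s in (0 : ℝ)..t, P s with hQ
  suffices ∀ T, 0 ≤ T → Q T ≤ 0 by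
    filter_upwards [hy, ae_restrict_mem measurableSet_Ioi] with t h1 h2
    rw [h1]
    exact this t (Set.mem_Ioi.1 h2).le
  intro T hT
  have hQc : ContinuousOn Q (Set.Icc 0 T) := continuousOn_primitive_Icc hP hT
  have hcc : ContinuousOn (fun t => ∫ s in (0 : ℝ)..t, c s) (Set.Icc 0 T) :=
    continuousOn_primitive_Icc hc hT
  have hcl : IsClosed ({t | Q t ≤ 0} ∩ Set.Icc 0 T) := by
    rw [Set.inter_comm]
    exact hQc.preimage_isClosed_of_isClosed isClosed_Icc isClosed_Iic
  refine hcl.Icc_subset_of_forall_mem_nhdsGT_of_Icc_subset (a := 0) (b := T) ?_ ?_ ⟨hT, le_rfl⟩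
  · simp [hQ]
  intro τ hτ hsub
  have hQτ : Q τ ≤ 0 := hsub ⟨hτ.1, le_rfl⟩
  have hsmall : ∀ᶠ t in 𝓝[>] τ, ∫ s in τ..t, c s < 1 / 2 := by
    have h1 := (hcc τ ⟨hτ.1, hτ.2.le⟩).mono_left
      (nhdsWithin_mono τ fun t (ht : t ∈ Set.Ioc τ T) => ⟨hτ.1.trans ht.1.le, ht.2⟩)
    rw [nhdsWithin_Ioc_eq_nhdsGT hτ.2] at h1
    have h2 := h1.sub_const (∫ s in (0 : ℝ)..τ, c s)
    rw [sub_self] at h2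
    filter_upwards [h2.eventually_lt_const one_half_pos, self_mem_nhdsWithin] with t ht hm
    rwa [intervalIntegral.integral_interval_sub_left
      (intervalIntegrable_of_Ioc hc le_rfl (hτ.1.trans (Set.mem_Ioi.1 hm).le))
      (intervalIntegrable_of_Ioc hc le_rfl hτ.1)] at ht
  obtain ⟨σ, hσ, hσs⟩ := mem_nhdsGT_iff_exists_Ioo_subset.1 hsmall
  refine mem_nhdsGT_iff_exists_Ioo_subset.2 ⟨min σ T, lt_min hσ hτ.2, fun t ht => ?_⟩
  have htT : t ≤ T := (ht.2.trans_le (min_le_right _ _)).le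
  have htσ : t < σ := ht.2.trans_le (min_le_left _ _)
  obtain ⟨m, hm, hmax⟩ := isCompact_Icc.exists_isMaxOn (Set.nonempty_Icc.2 ht.1.le)
    (hQc.mono (Set.Icc_subset_Icc hτ.1 htT))
  suffices Q m ≤ 0 from (hmax ⟨ht.1.le, le_rfl⟩).trans this
  by_contra! hpos
  have hτm : τ < m := lt_of_le_of_ne hm.1 fun h => by rw [← h] at hpos; linarith
  have hm0 : 0 ≤ m := hτ.1.trans hm.1
  have e1 : Q m - Q τ = ∫ s in τ..m, P s :=
    intervalIntegral.integral_interval_sub_left (intervalIntegrable_of_Ioc hP le_rfl hm0)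
      (intervalIntegrable_of_Ioc hP le_rfl hτ.1)
  have e2 : ∫ s in τ..m, P s ≤ ∫ s in τ..m, c s * Q m := by
    refine intervalIntegral.integral_mono_ae_restrict hm.1 (intervalIntegrable_of_Ioc hP hτ.1 hm0)
      ((intervalIntegrable_of_Ioc hc hτ.1 hm0).mul_const _) ?_
    have hsub : Set.Ioc τ m ⊆ Set.Ioi 0 := fun s hs => hτ.1.trans_lt hs.1
    rw [← restrict_Ioc_eq_restrict_Icc]
    filter_upwards [ae_restrict_of_ae_restrict_of_subset hsub hy,
      ae_restrict_of_ae_restrict_of_subset hsub hPy,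
      ae_restrict_of_ae_restrict_of_subset hsub hc0, ae_restrict_mem measurableSet_Ioc]
      with s s1 s2 s3 s4
    refine s2.trans (mul_le_mul_of_nonneg_left ?_ s3)
    rw [s1]
    exact hmax ⟨s4.1.le, s4.2.trans hm.2⟩
  rw [intervalIntegral.integral_mul_const] at e2
  have e3 : ∫ s in τ..m, c s < 1 / 2 := hσs ⟨hτm, hm.2.trans_lt htσ⟩
  nlinarith

section

variable {n : ℕ} {u₀ : ℝ → E n} {u v w w' : ℝ → ℝ → E n}

lemma measurable_integral_Ioc {g : ℝ × ℝ → ℝ} (hg : Measurable g) :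
    Measurable fun p : ℝ × ℝ => ∫ r in Set.Ioc 0 p.1, g (r, p.2) := by
  have hS : MeasurableSet {q : (ℝ × ℝ) × ℝ | q.2 ∈ Set.Ioc 0 q.1.1} := by
    simp only [Set.mem_Ioc]
    exact (measurableSet_lt measurable_const measurable_snd).inter
      (measurableSet_le measurable_snd (measurable_fst.comp measurable_fst))
  have hm : Measurable fun q : (ℝ × ℝ) × ℝ => (Set.Ioc 0 q.1.1).indicator
      (fun r => g (r, q.1.2)) q.2 :=
    (hg.comp (by fun_prop : Measurable fun q : (ℝ × ℝ) × ℝ => (q.2, q.1.2))).indicator hS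
  have := hm.stronglyMeasurable.integral_prod_right' (ν := volume)
  simp only [integral_indicator measurableSet_Ioc] at this
  exact this.measurable

lemma IsEnergySolAux.diff_eq_integral (h : IsEnergySolAux n u₀ u w)
    (h' : IsEnergySolAux n u₀ v w') (hm₀ : Measurable u₀) (hn₀ : ∀ x, ‖u₀ x‖ = 1) :
    ∀ᵐ t ∂(volume.restrict (Set.Ioi (0 : ℝ))), ∀ i, ∀ᵐ x ∂muc,
      u t x i - v t x i = ∫ s in Set.Ioc 0 t, (w s x i - w' s x i) := by
  filter_upwards [h.ae_eq_add_integral hm₀ hn₀, h'.ae_eq_add_integral hm₀ hn₀] with t h1 h2 i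
  filter_upwards [h1 i, h2 i, ((h.memLp_w t i).integrable one_le_two).prod_left_ae,
    ((h'.memLp_w t i).integrable one_le_two).prod_left_ae] with x x1 x2 x3 x4
  rw [x1, x2, integral_sub x3 x4]
  ring

lemma IsEnergySolAux.integrable_diff_mul (h : IsEnergySolAux n u₀ u w)
    (h' : IsEnergySolAux n u₀ v w') (T : ℝ) (i : Fin n) :
    Integrable (fun p : ℝ × ℝ => (u p.1 p.2 i - v p.1 p.2 i) * (w p.1 p.2 i - w' p.1 p.2 i))
      ((volume.restrict (Set.Ioc (0 : ℝ) T)).prod muc) := by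
  refine Integrable.bdd_mul (c := 2) (((h.memLp_w T i).integrable one_le_two).sub
    ((h'.memLp_w T i).integrable one_le_two)) ((measurable_coord h.meas i).sub
    (measurable_coord h'.meas i)).aestronglyMeasurable ?_
  filter_upwards [h.ae_abs_le T i, h'.ae_abs_le T i] with p h1 h2
  exact (norm_sub_le _ _).trans (by linarith)

/-- Evolution of the squared `L²` distance of two solutions. -/
lemma IsEnergySolAux.integral_diff_sq_eq (h : IsEnergySolAux n u₀ u w)
    (h' : IsEnergySolAux n u₀ v w') (hm₀ : Measurable u₀) (hn₀ : ∀ x, ‖u₀ x‖ = 1) (i : Fin n) :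
    ∀ᵐ t ∂(volume.restrict (Set.Ioi (0 : ℝ))), ∫ x, (u t x i - v t x i) ^ 2 ∂muc
      = 2 * ∫ s in Set.Ioc 0 t, ∫ x, (u s x i - v s x i) * (w s x i - w' s x i) ∂muc := by
  have hd := h.diff_eq_integral h' hm₀ hn₀
  have hmw : Measurable fun p : ℝ × ℝ => w p.1 p.2 i - w' p.1 p.2 i :=
    (measurable_coord h.wMeas i).sub (measurable_coord h'.wMeas i)
  have hmu : Measurable fun p : ℝ × ℝ => u p.1 p.2 i - v p.1 p.2 i :=
    (measurable_coord h.meas i).sub (measurable_coord h'.meas i)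
  have hdx : ∀ᵐ x ∂muc, ∀ᵐ s ∂(volume.restrict (Set.Ioi (0 : ℝ))),
      u s x i - v s x i = ∫ r in Set.Ioc 0 s, (w r x i - w' r x i) := by
    refine (Measure.ae_ae_comm (μ := volume.restrict (Set.Ioi (0 : ℝ)))
      (p := fun s x => u s x i - v s x i = ∫ r in Set.Ioc 0 s, (w r x i - w' r x i))
      (measurableSet_eq_fun hmu (measurable_integral_Ioc hmw))).1 ?_
    filter_upwards [hd] with t ht using ht i
  filter_upwards [hd, ae_restrict_mem measurableSet_Ioi] with t ht ht0
  rw [integral_integral_swap (h.integrable_diff_mul h' t i), ← integral_const_mul]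
  refine integral_congr_ae ?_
  filter_upwards [ht i, hdx, ((h.memLp_w t i).integrable one_le_two).prod_left_ae,
    ((h'.memLp_w t i).integrable one_le_two).prod_left_ae] with x x1 x2 x3 x4
  have hi : IntegrableOn (fun s => w s x i - w' s x i) (Set.Ioc 0 t) := x3.sub x4
  rw [x1, sq_integral_Ioc_eq (Set.mem_Ioi.1 ht0).le hi]
  congr 1
  refine integral_congr_ae ?_
  filter_upwards [ae_Ioc x2 t] with s hs
  rw [hs]

lemma IsEnergySolAux.sliceSol (h : IsEnergySolAux n u₀ u w) :
    ∀ᵐ t ∂(volume.restrict (Set.Ioi (0 : ℝ))),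
      SliceSol (u t) (gagl (u t)) (fun i x => w t x i) := by
  filter_upwards [h.sphereReg, h.memLp_w_slice, h.fourier_eq] with t h1 h2 h3
  exact ⟨h1, fun i => (h2 i).ofReal, h1.integrable_gagl_mul, h3⟩

lemma IsEnergySolAux.integrableOn_sum_sq (h : IsEnergySolAux n u₀ u w) (T : ℝ) :
    IntegrableOn (fun t => ∑ i, ∫ x, w t x i ^ 2 ∂muc) (Set.Ioc 0 T) :=
  integrable_finsetSum _ fun i _ => (h.memLp_w T i).integrable_sq.integral_prod_left

lemma IsEnergySolAux.ae_eq_of_small (h : IsEnergySolAux n u₀ u w)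
    (h' : IsEnergySolAux n u₀ v w') (hm₀ : Measurable u₀) (hn₀ : ∀ x, ‖u₀ x‖ = 1)
    (hεu : ∀ᵐ t ∂(volume.restrict (Set.Ioi (0 : ℝ))),
      24 * n ^ 2 * (1 + 8 * n ^ 2) * hHalf (u t) ≤ 1)
    (hεv : ∀ᵐ t ∂(volume.restrict (Set.Ioi (0 : ℝ))),
      24 * n ^ 2 * (1 + 8 * n ^ 2) * hHalf (v t) ≤ 1) :
    ∀ᵐ p ∂STmeasure, u p.1 p.2 = v p.1 p.2 := by
  have hP : ∀ T, IntegrableOn (fun s => 2 * ∑ i, ∫ x, (u s x i - v s x i)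
      * (w s x i - w' s x i) ∂muc) (Set.Ioc 0 T) := fun T =>
    (integrable_finsetSum _ fun i _ =>
      (h.integrable_diff_mul h' T i).integral_prod_left).const_mul 2
  have hy : ∀ᵐ t ∂(volume.restrict (Set.Ioi (0 : ℝ))), ∑ i, ∫ x, (u t x i - v t x i) ^ 2 ∂muc
      = ∫ s in (0 : ℝ)..t, 2 * ∑ i, ∫ x, (u s x i - v s x i) * (w s x i - w' s x i) ∂muc := by
    filter_upwards [ae_all_iff.2 fun i => h.integral_diff_sq_eq h' hm₀ hn₀ i,
      ae_restrict_mem measurableSet_Ioi] with t ht ht0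
    rw [intervalIntegral.integral_of_le (Set.mem_Ioi.1 ht0).le, integral_const_mul,
      integral_finsetSum _ fun i _ => (h.integrable_diff_mul h' t i).integral_prod_left,
      Finset.mul_sum]
    exact Finset.sum_congr rfl fun i _ => ht i
  have hc : ∀ T, IntegrableOn (fun t => 2 * (1 + (2 + 128 * π ^ 2 * n)
      * (∑ i, ∫ x, w t x i ^ 2 ∂muc + ∑ i, ∫ x, w' t x i ^ 2 ∂muc))) (Set.Ioc 0 T) := by
    intro T
    have h1 : IntegrableOn (fun _ : ℝ => (1 : ℝ)) (Set.Ioc 0 T) := integrableOn_const (by simp)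
    have h2 := (h.integrableOn_sum_sq T).add (h'.integrableOn_sum_sq T)
    exact (h1.add (h2.const_mul _)).const_mul 2
  have hle := ae_nonpos_of_gronwall (c := fun t => 2 * (1 + (2 + 128 * π ^ 2 * n)
      * (∑ i, ∫ x, w t x i ^ 2 ∂muc + ∑ i, ∫ x, w' t x i ^ 2 ∂muc))) hP
    hc
    (Eventually.of_forall fun t => by
      have h1 : 0 ≤ ∑ i, ∫ x, w t x i ^ 2 ∂muc :=
        Finset.sum_nonneg fun i _ => integral_nonneg fun x => sq_nonneg _
      have h2 : 0 ≤ ∑ i, ∫ x, w' t x i ^ 2 ∂muc :=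
        Finset.sum_nonneg fun i _ => integral_nonneg fun x => sq_nonneg _
      positivity) hy (by
    filter_upwards [h.sliceSol, h'.sliceSol, hεu, hεv] with t t1 t2 t3 t4
    have := t1.sum_integral_diff_le t2 t3 t4
    linarith)
  refine (Measure.ae_prod_iff_ae_ae (measurableSet_eq_fun h.meas h'.meas)).2 ?_
  filter_upwards [hle, h.sphereReg, h'.sphereReg] with t ht t1 t2
  have hz : ∀ i, ∀ᵐ x ∂muc, u t x i - v t x i = 0 := by
    have hn : ∀ i, 0 ≤ ∫ x, (u t x i - v t x i) ^ 2 ∂muc := fun i =>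
      integral_nonneg fun x => sq_nonneg _
    intro i
    have h0 := (Finset.sum_eq_zero_iff_of_nonneg fun i _ => hn i).1
      (le_antisymm ht (Finset.sum_nonneg fun i _ => hn i)) i (Finset.mem_univ i)
    have hm : MemLp (fun x => u t x i - v t x i) 2 muc :=
      (memLp_of_ofReal (t1.half i).mem).sub (memLp_of_ofReal (t2.half i).mem)
    filter_upwards [(integral_eq_zero_iff_of_nonneg (fun x => sq_nonneg _) hm.integrable_sq).1 h0]
      with x hx
    exact pow_eq_zero_iff two_ne_zero |>.1 hx
  filter_upwards [ae_all_iff.2 hz] with x hx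
  ext i
  exact sub_eq_zero.1 (hx i)

end

/-- Uniqueness of small-energy energy-class solutions of the
half-harmonic gradient flow into `S^{n-1}`. -/
theorem uniqueness_small_energy (n : ℕ) (hn : 2 ≤ n) :
    ∃ ε : ℝ, 0 < ε ∧
      ∀ u₀ : ℝ → E n, Measurable u₀ → Function.Periodic u₀ (2 * π) →
        (∀ x, ‖u₀ x‖ = 1) →
        ∀ u v : ℝ → ℝ → E n,
          IsEnergySol n u₀ u → IsEnergySol n u₀ v →
          (∀ᵐ t ∂(volume.restrict (Set.Ioi (0 : ℝ))), hHalf (u t) ≤ ENNReal.ofReal (ε ^ 2)) →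
          (∀ᵐ t ∂(volume.restrict (Set.Ioi (0 : ℝ))), hHalf (v t) ≤ ENNReal.ofReal (ε ^ 2)) →
          ∀ᵐ p ∂STmeasure, u p.1 p.2 = v p.1 p.2 := by
  have hn1 : (2 : ℝ) ≤ n := by exact_mod_cast hn
  set K : ℝ := 24 * n ^ 2 * (1 + 8 * n ^ 2) with hK
  have hK1 : 1 ≤ K := by nlinarith
  have key : ∀ a : ℝ≥0∞, a ≤ ENNReal.ofReal ((1 / K) ^ 2) →
      24 * n ^ 2 * (1 + 8 * n ^ 2) * a ≤ 1 := by
    intro a ha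
    have hKe : (24 * n ^ 2 * (1 + 8 * n ^ 2) : ℝ≥0∞) = ENNReal.ofReal K := by
      rw [hK]
      have : (24 * (n : ℝ) ^ 2 * (1 + 8 * (n : ℝ) ^ 2))
        = ((24 * n ^ 2 * (1 + 8 * n ^ 2) : ℕ) : ℝ) := by push_cast; ring
      rw [this, ENNReal.ofReal_natCast]
      push_cast
      ring
    rw [hKe]
    refine (mul_le_mul' le_rfl ha).trans ?_
    rw [← ENNReal.ofReal_mul (by positivity), ENNReal.ofReal_le_one, one_div, pow_two,
      mul_inv_cancel_left₀ (by positivity)]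
    exact inv_le_one_of_one_le₀ hK1
  refine ⟨1 / K, by positivity, fun u₀ hm₀ _ hn₀ u v hu hv hεu hεv => ?_⟩
  obtain ⟨w, h⟩ := hu
  obtain ⟨w', h'⟩ := hv
  exact h.ae_eq_of_small h' hm₀ hn₀ (hεu.mono fun t ht => key _ ht) (hεv.mono fun t ht => key _ ht)

end
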